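/- arXiv:1012.5863 — 3 statements merged into one kernel-verified Lean document; each statement's English description precedes it below -/
import Mathlib

section
/- Let (E, ‖·‖_E) be a real separable normed space, regarded as a metric space with d(x,y) = ‖x − y‖_E. Then the following are equivalent: (1) E is a positive semidefinite metric space; (2) E is a positive definite metric space; (3) E is of negative type, i.e., there exist a real Hilbert space H and φ : E → H with ‖φ(x) − φ(y)‖² = ‖x − y‖_E for all x, y ∈ E; (4) there exists a linear map T from E into L₁[0,1] (the space of integrable real functions on [0,1] with the L¹ norm) such that ‖T(x)‖₁ = ‖x‖_E for every x ∈ E. -/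
open MeasureTheory

universe u

attribute [local instance] MeasureTheory.Measure.Subtype.measureSpace

/-- A metric space is positive definite if every finite subspace has positive
definite similarity matrix `[e^{-d(x,y)}]`. -/
def PosDefSpace (A : Type*) [MetricSpace A] : Prop :=
  ∀ s : Finset A, (Matrix.of fun x y : ↥s => Real.exp (-dist (x : A) (y : A))).PosDef

/-- A metric space is positive semidefinite if every finite subspace has positive
semidefinite similarity matrix `[e^{-d(x,y)}]`. -/
def PosSemidefSpace (A : Type*) [MetricSpace A] : Prop :=
  ∀ s : Finset A, (Matrix.of fun x y : ↥s => Real.exp (-dist (x : A) (y : A))).PosSemidef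

/-- A metric space is of negative type if there are a real Hilbert space `H` and
`φ : A → H` with `‖φ x - φ y‖² = d(x,y)`. -/
def NegativeType (A : Type u) [MetricSpace A] : Prop :=
  ∃ (H : Type u) (_ : NormedAddCommGroup H) (_ : InnerProductSpace ℝ H)
    (_ : CompleteSpace H) (φ : A → H), ∀ x y : A, ‖φ x - φ y‖ ^ 2 = dist x y

/-- A positive semidefinite real kernel. -/
def PSDK {X : Type*} (k : X → X → ℝ) : Prop :=
  ∀ (s : Finset X) (c : X → ℝ), 0 ≤ ∑ x ∈ s, ∑ y ∈ s, c x * c y * k x y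

theorem exists_feature {X : Type} (k : X → X → ℝ) (hs : ∀ x y, k x y = k y x) (hk : PSDK k) :
    ∃ (H : Type) (_ : NormedAddCommGroup H) (_ : InnerProductSpace ℝ H) (_ : CompleteSpace H)
      (ψ : X → H), ∀ x y, inner ℝ (ψ x) (ψ y) = k x y := by
  let K : Matrix X X (ℝ →L[ℝ] ℝ) := Matrix.of fun x y => k x y • ContinuousLinearMap.id ℝ ℝ
  have hH : K.IsHermitian := by
    ext x y
    have h1 : star (ContinuousLinearMap.id ℝ ℝ) = ContinuousLinearMap.id ℝ ℝ :=
      star_one (ℝ →L[ℝ] ℝ)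
    simp [K, Matrix.conjTranspose, hs x y, h1]
  have hK : K.PosSemidef := by
    have htf := (RKHS.posSemidef_tfae (K := K)).out 0 2
    refine htf.mpr ⟨hH, fun v => ?_⟩
    have := hk v.support v
    rw [Finset.sum_comm] at this
    simp only [Finsupp.sum, K]
    simp
    refine this.trans (le_of_eq ?_)
    refine Finset.sum_congr rfl fun x _ => Finset.sum_congr rfl fun y _ => ?_
    ring
  have : Fact K.PosSemidef := ⟨hK⟩
  refine ⟨RKHS.OfKernel K, inferInstance, inferInstance, inferInstance,
    fun x => RKHS.kerFun (RKHS.OfKernel K) x 1, fun x y => ?_⟩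
  rw [← RKHS.kernel_inner, RKHS.OfKernel.kernel_ofKernel]
  simp [K, hs x y]

theorem PSDK.of_feature {X H : Type*} [NormedAddCommGroup H] [InnerProductSpace ℝ H]
    {k : X → X → ℝ} (ψ : X → H) (h : ∀ x y, inner ℝ (ψ x) (ψ y) = k x y) : PSDK k := by
  intro s c
  have : ∑ x ∈ s, ∑ y ∈ s, c x * c y * k x y
      = inner ℝ (∑ x ∈ s, c x • ψ x) (∑ y ∈ s, c y • ψ y) := by
    rw [sum_inner]
    refine Finset.sum_congr rfl fun x _ => ?_
    rw [inner_sum]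
    refine Finset.sum_congr rfl fun y _ => ?_
    rw [real_inner_smul_left, real_inner_smul_right, h]; ring
  rw [this]
  exact real_inner_self_nonneg

theorem PSDK.iff_matrix {X : Type*} {k : X → X → ℝ} (hs : ∀ x y, k x y = k y x) :
    PSDK k ↔ (Matrix.of k).PosSemidef := by
  constructor
  · intro h
    refine ⟨by ext x y; simp [hs x y], fun v => ?_⟩
    refine (h v.support v).trans (le_of_eq ?_)
    simp only [Finsupp.sum]
    refine Finset.sum_congr rfl fun x _ => Finset.sum_congr rfl fun y _ => ?_
    simp; ring
  · intro h s c
    classical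
    have := h.2 (Finsupp.onFinset s (fun x => if x ∈ s then c x else 0)
      (fun x hx => by by_contra h; simp [h] at hx))
    refine this.trans (le_of_eq ?_)
    rw [Finsupp.onFinset_sum _ (by simp)]
    refine Finset.sum_congr rfl fun x hx => ?_
    rw [Finsupp.onFinset_sum _ (by simp)]
    refine Finset.sum_congr rfl fun y hy => ?_
    simp [hx, hy]; ring

theorem PSDK.mul {X : Type*} {k l : X → X → ℝ} (hks : ∀ x y, k x y = k y x)
    (hls : ∀ x y, l x y = l y x) (hk : PSDK k) (hl : PSDK l) :
    PSDK (fun x y => k x y * l x y) := by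
  rw [PSDK.iff_matrix hks] at hk
  rw [PSDK.iff_matrix hls] at hl
  rw [PSDK.iff_matrix (fun x y => by rw [hks, hls])]
  exact hk.hadamard hl

theorem PSDK.pow {X : Type*} {k : X → X → ℝ} (hks : ∀ x y, k x y = k y x)
    (hk : PSDK k) (n : ℕ) : PSDK (fun x y => k x y ^ n) := by
  induction n with
  | zero =>
    exact PSDK.of_feature (H := ℝ) (fun _ => 1) (by simp)
  | succ n ih =>
    simp only [pow_succ]
    exact ih.mul (fun x y => by rw [hks]) hks hk

theorem PSDK.exp {X : Type*} {k : X → X → ℝ} (hks : ∀ x y, k x y = k y x)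
    (hk : PSDK k) : PSDK (fun x y => Real.exp (k x y)) := by
  intro s c
  have h1 : HasSum (fun n : ℕ => ∑ x ∈ s, ∑ y ∈ s, c x * c y * (k x y ^ n / n.factorial))
      (∑ x ∈ s, ∑ y ∈ s, c x * c y * Real.exp (k x y)) := by
    refine hasSum_sum fun x _ => hasSum_sum fun y _ => HasSum.mul_left _ ?_
    rw [Real.exp_eq_exp_ℝ]
    exact NormedSpace.expSeries_div_hasSum_exp (k x y)
  refine h1.nonneg fun n => ?_
  have := hk.pow hks n s c
  have h2 : ∑ x ∈ s, ∑ y ∈ s, c x * c y * (k x y ^ n / n.factorial)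
    = (∑ x ∈ s, ∑ y ∈ s, c x * c y * k x y ^ n) / n.factorial := by
    simp only [Finset.sum_div]
    refine Finset.sum_congr rfl fun x _ => Finset.sum_congr rfl fun y _ => ?_
    ring
  rw [h2]; positivity

theorem PSDK.gaussian {X H : Type*} [NormedAddCommGroup H] [InnerProductSpace ℝ H]
    (φ : X → H) : PSDK (fun x y => Real.exp (-‖φ x - φ y‖ ^ 2)) := by
  intro s c
  have h0 : PSDK (fun x y => 2 * inner ℝ (φ x) (φ y)) :=
    PSDK.of_feature (fun x => Real.sqrt 2 • φ x) (fun x y => by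
      rw [real_inner_smul_left, real_inner_smul_right, ← mul_assoc]; simp)
  have := h0.exp (fun x y => by rw [real_inner_comm]) s (fun x => c x * Real.exp (-‖φ x‖ ^ 2))
  refine this.trans (le_of_eq ?_)
  refine Finset.sum_congr rfl fun x _ => Finset.sum_congr rfl fun y _ => ?_
  have : -‖φ x - φ y‖ ^ 2 = -‖φ x‖ ^ 2 + -‖φ y‖ ^ 2 + 2 * inner ℝ (φ x) (φ y) := by
    rw [norm_sub_sq_real]; ring
  beta_reduce
  rw [this, Real.exp_add, Real.exp_add]; ring

/-- Strict positivity of the Gaussian kernel. -/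
theorem gaussian_strict {X H : Type} [NormedAddCommGroup H] [InnerProductSpace ℝ H]
    (φ : X → H) (hφ : Function.Injective φ) (s : Finset X) (c : X → ℝ)
    (h : ∑ x ∈ s, ∑ y ∈ s, c x * c y * Real.exp (-‖φ x - φ y‖ ^ 2) ≤ 0) :
    ∀ x ∈ s, c x = 0 := by
  obtain ⟨G, _, _, _, ψ, hψ⟩ := exists_feature (X := H) (fun x y => Real.exp (-‖x - y‖ ^ 2))
    (fun x y => by rw [norm_sub_rev]) (PSDK.gaussian (fun x : H => x))
  have h1 : ∑ x ∈ s, ∑ y ∈ s, c x * c y * Real.exp (-‖φ x - φ y‖ ^ 2)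
      = inner ℝ (∑ x ∈ s, c x • ψ (φ x)) (∑ y ∈ s, c y • ψ (φ y)) := by
    rw [sum_inner]
    refine Finset.sum_congr rfl fun x _ => ?_
    rw [inner_sum]
    refine Finset.sum_congr rfl fun y _ => ?_
    rw [real_inner_smul_left, real_inner_smul_right, hψ]; ring
  rw [h1] at h
  have h2 : ∑ x ∈ s, c x • ψ (φ x) = 0 := by
    rw [← inner_self_eq_zero (𝕜 := ℝ)]
    exact le_antisymm h real_inner_self_nonneg
  have h3 : ∀ v : H, ∑ x ∈ s, (c x * Real.exp (-‖φ x‖ ^ 2)) * Real.exp (2 * inner ℝ (φ x) v) = 0 := by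
    intro v
    have h4 : inner ℝ (∑ x ∈ s, c x • ψ (φ x)) (ψ v) = 0 := by rw [h2, inner_zero_left]
    rw [sum_inner] at h4
    have h5 : ∑ x ∈ s, inner ℝ (c x • ψ (φ x)) (ψ v) =
        (∑ x ∈ s, (c x * Real.exp (-‖φ x‖ ^ 2)) * Real.exp (2 * inner ℝ (φ x) v))
          * Real.exp (-‖v‖ ^ 2) := by
      rw [Finset.sum_mul]
      refine Finset.sum_congr rfl fun x _ => ?_
      rw [real_inner_smul_left, hψ]
      have : -‖φ x - v‖ ^ 2 = -‖φ x‖ ^ 2 + 2 * inner ℝ (φ x) v + -‖v‖ ^ 2 := by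
        rw [norm_sub_sq_real]; ring
      rw [this, Real.exp_add, Real.exp_add]; ring
    rw [h5] at h4
    exact (mul_eq_zero.mp h4).resolve_right (Real.exp_pos _).ne'
  let χ : X → (Multiplicative H →* ℝ) := fun x =>
    { toFun := fun v => Real.exp (2 * inner ℝ (φ x) (Multiplicative.toAdd v))
      map_one' := by simp
      map_mul' := fun a b => by
        simp [inner_add_right, mul_add, Real.exp_add] }
  have hχ : Function.Injective χ := by
    intro x y hxy
    apply hφ
    refine ext_inner_right ℝ fun v => ?_
    have := DFunLike.congr_fun hxy (Multiplicative.ofAdd v)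
    have h6 := Real.exp_injective this
    simpa using h6
  have hli := (linearIndependent_monoidHom (Multiplicative H) ℝ).comp χ hχ
  rw [linearIndependent_iff'] at hli
  have := hli s (fun x => c x * Real.exp (-‖φ x‖ ^ 2)) (by
    ext v
    have := h3 (Multiplicative.toAdd v)
    simpa [Finset.sum_apply, χ] using this)
  intro x hx
  exact (mul_eq_zero.mp (this x hx)).resolve_right (Real.exp_pos _).ne'

theorem posDef_of_negType (A : Type) [MetricSpace A] (h : NegativeType A) : PosDefSpace A := by
  obtain ⟨H, _, _, _, φ, hφ⟩ := h
  have hinj : Function.Injective φ := by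
    intro x y hxy
    have := hφ x y
    rw [hxy] at this
    simpa [eq_comm] using this
  intro s
  classical
  refine Matrix.PosDef.of_dotProduct_mulVec_pos (by ext x y; simp [dist_comm]) fun v hv => ?_
  by_contra hneg
  apply hv
  have key := gaussian_strict (fun x : s => φ x) (hinj.comp Subtype.val_injective) Finset.univ v (by
    refine le_trans (le_of_eq ?_) (not_lt.mp hneg)
    simp only [dotProduct, Matrix.mulVec, Finset.mul_sum]
    refine Finset.sum_congr rfl fun x _ => Finset.sum_congr rfl fun y _ => ?_
    simp [hφ]; ring)
  ext x
  exact key x (Finset.mem_univ _)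

theorem psdk_of_space (A : Type) [MetricSpace A] (h : PosSemidefSpace A) :
    PSDK (fun x y : A => Real.exp (-dist x y)) := by
  intro s c
  have := (h s).dotProduct_mulVec_nonneg (fun x : s => c x)
  refine this.trans (le_of_eq ?_)
  simp only [dotProduct, Matrix.mulVec, Finset.mul_sum]
  rw [← Finset.sum_coe_sort s]
  refine Finset.sum_congr rfl fun x _ => ?_
  rw [← Finset.sum_coe_sort s]
  refine Finset.sum_congr rfl fun y _ => ?_
  simp; ring

theorem negType_of_kernel (E : Type) [NormedAddCommGroup E]
    (h : PSDK (fun x y : E => ‖x‖ + ‖y‖ - ‖x - y‖)) : NegativeType E := by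
  have h' : PSDK (fun x y : E => (‖x‖ + ‖y‖ - ‖x - y‖) / 2) := by
    intro s c
    have := h s c
    have h2 : ∑ x ∈ s, ∑ y ∈ s, c x * c y * ((‖x‖ + ‖y‖ - ‖x - y‖) / 2)
      = (∑ x ∈ s, ∑ y ∈ s, c x * c y * (‖x‖ + ‖y‖ - ‖x - y‖)) / 2 := by
      simp only [Finset.sum_div]
      refine Finset.sum_congr rfl fun x _ => Finset.sum_congr rfl fun y _ => ?_
      ring
    rw [h2]; positivity
  obtain ⟨H, i1, i2, i3, ψ, hψ⟩ := exists_feature _ (fun x y => by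
    rw [norm_sub_rev, add_comm ‖x‖]) h'
  refine ⟨H, i1, i2, i3, ψ, fun x y => ?_⟩
  rw [norm_sub_sq_real, ← real_inner_self_eq_norm_sq, ← real_inner_self_eq_norm_sq, hψ, hψ, hψ,
    dist_eq_norm]
  simp; ring

theorem psdk_scaled (E : Type) [NormedAddCommGroup E] [NormedSpace ℝ E]
    (h : PSDK (fun x y : E => Real.exp (-dist x y))) (t : ℝ) (ht : 0 < t) :
    PSDK (fun x y : E => Real.exp (-(t * ‖x - y‖))) := by
  obtain ⟨H, i1, i2, i3, ψ, hψ⟩ := exists_feature _ (fun x y => by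
    rw [dist_comm]) h
  refine PSDK.of_feature (fun x => ψ (t • x)) fun x y => ?_
  rw [hψ, dist_eq_norm, ← smul_sub, norm_smul, Real.norm_of_nonneg ht.le]

theorem negType_of_psd (E : Type) [NormedAddCommGroup E] [NormedSpace ℝ E]
    (h : PosSemidefSpace E) : NegativeType E := by
  have h0 := psdk_of_space E h
  refine negType_of_kernel E fun s c => ?_
  have h1 : ∀ t : ℝ, 0 < t → 0 ≤ ∑ x ∈ s, ∑ y ∈ s, c x * c y *
      (t⁻¹ * (Real.exp (-(t * ‖x - y‖)) - Real.exp (-(t * (‖x‖ + ‖y‖))))) := by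
    intro t ht
    obtain ⟨H, i1, i2, i3, ψ, hψ⟩ := exists_feature _ (fun x y => by
      rw [norm_sub_rev]) (psdk_scaled E h0 t ht)
    have := PSDK.of_feature (fun x => ψ x - inner ℝ (ψ x) (ψ 0) • ψ 0)
      (k := fun x y => Real.exp (-(t * ‖x - y‖)) - Real.exp (-(t * (‖x‖ + ‖y‖)))) (fun x y => by
        simp only [inner_sub_left, inner_sub_right, real_inner_smul_left, real_inner_smul_right, hψ,
          mul_add, neg_add, Real.exp_add]
        simp) s c
    have h2 : ∑ x ∈ s, ∑ y ∈ s, c x * c y *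
      (t⁻¹ * (Real.exp (-(t * ‖x - y‖)) - Real.exp (-(t * (‖x‖ + ‖y‖)))))
      = t⁻¹ * ∑ x ∈ s, ∑ y ∈ s, c x * c y *
      ((Real.exp (-(t * ‖x - y‖)) - Real.exp (-(t * (‖x‖ + ‖y‖))))) := by
      simp only [Finset.mul_sum]
      refine Finset.sum_congr rfl fun x _ => Finset.sum_congr rfl fun y _ => ?_
      ring
    rw [h2]; positivity
  have hd : ∀ u v : ℝ, Filter.Tendsto
      (fun t : ℝ => t⁻¹ * (Real.exp (-(t * u)) - Real.exp (-(t * v)))) (nhdsWithin 0 (Set.Ioi 0))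
      (nhds (v - u)) := by
    intro u v
    have h3 : HasDerivAt (fun t : ℝ => Real.exp (-(t * u)) - Real.exp (-(t * v))) (v - u) 0 := by
      have ha : ∀ w : ℝ, HasDerivAt (fun t : ℝ => Real.exp (-(t * w))) (-w) 0 := by
        intro w
        have := (((hasDerivAt_id (0:ℝ)).mul_const w).neg).exp
        simpa using this
      have := (ha u).sub (ha v)
      convert! this using 1; ring
    have := h3.hasDerivWithinAt (s := Set.Ioi 0)
    rw [hasDerivWithinAt_iff_tendsto_slope' (by simp)] at this
    refine this.congr fun t => ?_
    simp [slope, vsub_eq_sub]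
  refine ge_of_tendsto (x := nhdsWithin (0:ℝ) (Set.Ioi 0)) (f := fun t : ℝ => ∑ x ∈ s, ∑ y ∈ s, c x * c y *
      (t⁻¹ * (Real.exp (-(t * ‖x - y‖)) - Real.exp (-(t * (‖x‖ + ‖y‖)))))) ?_ ?_
  · exact tendsto_finsetSum _ fun x _ => tendsto_finsetSum _ fun y _ => (hd _ _).const_mul _
  · filter_upwards [self_mem_nhdsWithin] with t ht using h1 t ht

theorem step_int (s t : ℝ) :
    Integrable (fun r : ℝ => ((if r < s then (1:ℝ) else 0) - (if r < t then (1:ℝ) else 0)) ^ 2) ∧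
    ∫ r : ℝ, ((if r < s then (1:ℝ) else 0) - (if r < t then (1:ℝ) else 0)) ^ 2 = |s - t| := by
  have h : (fun r : ℝ => ((if r < s then (1:ℝ) else 0) - (if r < t then (1:ℝ) else 0)) ^ 2)
      = (Set.Ico (min s t) (max s t)).indicator (fun _ => (1:ℝ)) := by
    ext r
    by_cases h1 : r < s <;> by_cases h2 : r < t <;>
      simp [Set.indicator, h1, h2]
  rw [h]
  constructor
  · refine (integrable_indicator_iff measurableSet_Ico).mpr ?_
    simp
  · rw [integral_indicator measurableSet_Ico]
    simp [max_sub_min_eq_abs, abs_sub_comm]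

theorem abs_kernel {ι : Type*} (s : Finset ι) (u c : ι → ℝ) :
    0 ≤ ∑ x ∈ s, ∑ y ∈ s, c x * c y * (|u x| + |u y| - |u x - u y|) := by
  let st : ℝ → ℝ → ℝ := fun a r => if r < a then (1:ℝ) else 0
  have h1 : ∀ a b : ℝ, Integrable (fun r => (st a r - st b r) ^ 2) := fun a b => (step_int a b).1
  have h2 : ∀ a b : ℝ, ∫ r, (st a r - st b r) ^ 2 = |a - b| := fun a b => (step_int a b).2
  have h3 : ∀ a b : ℝ, Integrable (fun r => (st a r - st 0 r) ^ 2 + (st b r - st 0 r) ^ 2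
      - (st a r - st b r) ^ 2) := fun a b => ((h1 _ _).add (h1 _ _)).sub (h1 _ _)
  have h4 : ∀ a b : ℝ, |a| + |b| - |a - b| = ∫ r, ((st a r - st 0 r) ^ 2 + (st b r - st 0 r) ^ 2
      - (st a r - st b r) ^ 2) := by
    intro a b
    have h0 : Integrable (fun r => (st a r - st 0 r) ^ 2 + (st b r - st 0 r) ^ 2) :=
      (h1 _ _).add (h1 _ _)
    rw [integral_sub h0 (h1 _ _), integral_add (h1 _ _) (h1 _ _), h2, h2, h2]
    simp
  have h5 : ∑ x ∈ s, ∑ y ∈ s, c x * c y * (|u x| + |u y| - |u x - u y|)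
      = ∫ r, ∑ x ∈ s, ∑ y ∈ s, c x * c y * ((st (u x) r - st 0 r) ^ 2 + (st (u y) r - st 0 r) ^ 2
      - (st (u x) r - st (u y) r) ^ 2) := by
    rw [integral_finsetSum _ fun x _ => integrable_finsetSum _ fun y _ => (h3 _ _).const_mul _]
    refine Finset.sum_congr rfl fun x _ => ?_
    rw [integral_finsetSum _ fun y _ => (h3 _ _).const_mul _]
    refine Finset.sum_congr rfl fun y _ => ?_
    rw [integral_const_mul, h4]
  rw [h5]
  refine integral_nonneg fun r => ?_
  have h6 : ∑ x ∈ s, ∑ y ∈ s, c x * c y * ((st (u x) r - st 0 r) ^ 2 + (st (u y) r - st 0 r) ^ 2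
      - (st (u x) r - st (u y) r) ^ 2) = 2 * (∑ x ∈ s, c x * (st (u x) r - st 0 r)) ^ 2 := by
    rw [sq, Finset.sum_mul_sum, Finset.mul_sum]
    refine Finset.sum_congr rfl fun x _ => ?_
    rw [Finset.mul_sum]
    refine Finset.sum_congr rfl fun y _ => ?_
    ring
  show 0 ≤ ∑ x ∈ s, ∑ y ∈ s, c x * c y * ((st (u x) r - st 0 r) ^ 2 + (st (u y) r - st 0 r) ^ 2
      - (st (u x) r - st (u y) r) ^ 2)
  rw [h6]; positivity

theorem negType_of_embedding (E : Type) [NormedAddCommGroup E] [NormedSpace ℝ E]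
    {α : Type*} [MeasurableSpace α] (μ : Measure α) (T : E →ₗ[ℝ] Lp ℝ 1 μ)
    (hT : ∀ x, ‖T x‖ = ‖x‖) : NegativeType E := by
  refine negType_of_kernel E fun s c => ?_
  have hi : ∀ f : Lp ℝ 1 μ, Integrable (fun t => |f t|) μ := fun f => (L1.integrable_coeFn f).abs
  have hn : ∀ x, ‖x‖ = ∫ t, |T x t| ∂μ := by
    intro x
    rw [← hT, L1.norm_eq_integral_norm]; rfl
  have hsub : ∀ x y, (fun t => |T (x - y) t|) =ᵐ[μ] fun t => |T x t - T y t| := by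
    intro x y
    rw [map_sub]
    filter_upwards [Lp.coeFn_sub (T x) (T y)] with t ht
    rw [ht]; rfl
  have hi2 : ∀ x y, Integrable (fun t => |T x t - T y t|) μ := fun x y =>
    (hi _).congr (hsub x y)
  have hk : ∀ x y, ‖x‖ + ‖y‖ - ‖x - y‖ = ∫ t, (|T x t| + |T y t| - |T x t - T y t|) ∂μ := by
    intro x y
    have h0 : Integrable (fun t => |T x t| + |T y t|) μ := (hi _).add (hi _)
    rw [integral_sub h0 (hi2 x y), integral_add (hi _) (hi _), hn, hn y, hn (x - y),
      integral_congr_ae (hsub x y)]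
  have hi3 : ∀ x y, Integrable (fun t => |T x t| + |T y t| - |T x t - T y t|) μ := fun x y =>
    ((hi _).add (hi _)).sub (hi2 x y)
  have h5 : ∑ x ∈ s, ∑ y ∈ s, c x * c y * (‖x‖ + ‖y‖ - ‖x - y‖)
      = ∫ t, ∑ x ∈ s, ∑ y ∈ s, c x * c y * (|T x t| + |T y t| - |T x t - T y t|) ∂μ := by
    rw [integral_finsetSum _ fun x _ => integrable_finsetSum _ fun y _ => (hi3 _ _).const_mul _]
    refine Finset.sum_congr rfl fun x _ => ?_
    rw [integral_finsetSum _ fun y _ => (hi3 _ _).const_mul _]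
    refine Finset.sum_congr rfl fun y _ => ?_
    rw [integral_const_mul, hk]
  rw [h5]
  exact integral_nonneg fun t => abs_kernel s (fun x => T x t) c

section Bochner
variable {V : Type} [NormedAddCommGroup V] [InnerProductSpace ℝ V]
  [MeasurableSpace V] [BorelSpace V] [FiniteDimensional ℝ V]

theorem gauss_integrable (b : ℝ) (hb : 0 < b) :
    Integrable (fun x : V => Real.exp (-b * ‖x‖ ^ 2)) := by
  have := (GaussianFourier.integrable_cexp_neg_mul_sq_norm_add (V := V) (b := (b : ℂ))
    (by simpa using hb) 0 0).norm
  refine this.congr (Filter.Eventually.of_forall fun x => ?_)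
  simp only [zero_mul, add_zero, Complex.norm_exp]
  norm_cast

theorem quad_nonneg (f : V → ℝ) {H : Type} [NormedAddCommGroup H]
    [InnerProductSpace ℝ H] [CompleteSpace H] (ψ : V → H) (hc : Continuous ψ)
    (hψ : ∀ x y, inner ℝ (ψ x) (ψ y) = f (x - y)) (h : V → ℝ)
    (hh : Integrable h) : 0 ≤ ∫ x, ∫ y, h x * h y * f (x - y) := by
  have hb : ∀ x, ‖ψ x‖ = Real.sqrt (f 0) := by
    intro x
    rw [norm_eq_sqrt_real_inner, hψ, sub_self]
  have hi : Integrable (fun x => h x • ψ x) := by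
    refine Integrable.smul_bdd hh (Real.sqrt (f 0)) hc.aestronglyMeasurable ?_
    exact Filter.Eventually.of_forall fun x => (hb x).le
  have h1 : ∫ x, ∫ y, h x * h y * f (x - y) = inner ℝ (∫ x, h x • ψ x) (∫ x, h x • ψ x) := by
    rw [← integral_inner hi]
    refine integral_congr_ae (Filter.Eventually.of_forall fun x => ?_)
    beta_reduce
    rw [real_inner_comm, ← integral_inner hi]
    refine integral_congr_ae (Filter.Eventually.of_forall fun y => ?_)
    beta_reduce
    rw [real_inner_smul_left, real_inner_smul_right, hψ]; ring
  rw [h1]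
  exact real_inner_self_nonneg

theorem fourier_gauss_nonneg (f : V → ℝ) (hf : Continuous f) (hi : Integrable f) {H : Type}
    [NormedAddCommGroup H]
    [InnerProductSpace ℝ H] [CompleteSpace H] (ψ : V → H) (hc : Continuous ψ)
    (hψ : ∀ x y, inner ℝ (ψ x) (ψ y) = f (x - y)) (ξ : V) (b : ℝ) (hb : 0 < b) :
    0 ≤ ∫ z, Real.exp (-b / 2 * ‖z‖ ^ 2) * (f z * Real.cos (2 * Real.pi * inner ℝ z ξ)) := by
  have hG := gauss_integrable (V := V) b hb
  have hbd : ∀ x, |f x| ≤ f 0 := by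
    intro x
    have h1 := abs_real_inner_le_norm (ψ x) (ψ 0)
    rw [hψ, sub_zero] at h1
    have hb : ∀ x, ‖ψ x‖ = Real.sqrt (f 0) := by
      intro x
      rw [norm_eq_sqrt_real_inner, hψ, sub_self]
    have : 0 ≤ f 0 := by
      rw [← sub_self (0:V), ← hψ]; exact real_inner_self_nonneg
    rwa [hb, hb, Real.mul_self_sqrt this] at h1
  have hC : Integrable (fun x : V => Real.exp (-b * ‖x‖ ^ 2) * Real.cos (2 * Real.pi * inner ℝ x ξ)) := by
    refine hG.mul_bdd (c := 1) (by fun_prop) (Filter.Eventually.of_forall fun x => ?_)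
    simpa using Real.abs_cos_le_one _
  have hS : Integrable (fun x : V => Real.exp (-b * ‖x‖ ^ 2) * Real.sin (2 * Real.pi * inner ℝ x ξ)) := by
    refine hG.mul_bdd (c := 1) (by fun_prop) (Filter.Eventually.of_forall fun x => ?_)
    simpa using Real.abs_sin_le_one _
  -- integrability of the product kernel
  have hprod : ∀ h : V → ℝ, Integrable h →
      Integrable (fun p : V × V => h p.1 * h p.2 * f (p.1 - p.2)) (volume.prod volume) := by
    intro h hh
    refine (hh.mul_prod hh).mul_bdd (c := f 0) (by fun_prop) (Filter.Eventually.of_forall fun p => ?_)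
    exact hbd _
  have q1 := quad_nonneg f ψ hc hψ _ hC
  have q2 := quad_nonneg f ψ hc hψ _ hS
  have q3 : 0 ≤ (∫ x : V, ∫ y : V, (Real.exp (-b * ‖x‖ ^ 2) * Real.exp (-b * ‖y‖ ^ 2)) *
      (f (x - y) * Real.cos (2 * Real.pi * inner ℝ (x - y) ξ))) := by
    refine (add_nonneg q1 q2).trans (le_of_eq ?_)
    refine (integral_integral_add (hprod _ hC) (hprod _ hS)).symm.trans ?_
    refine integral_congr_ae (Filter.Eventually.of_forall fun x => ?_)
    refine integral_congr_ae (Filter.Eventually.of_forall fun y => ?_)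
    beta_reduce
    rw [inner_sub_left, mul_sub, Real.cos_sub]; ring
  have hsub : ∀ x : V, (∫ y : V, (Real.exp (-b * ‖x‖ ^ 2) * Real.exp (-b * ‖y‖ ^ 2)) *
      (f (x - y) * Real.cos (2 * Real.pi * inner ℝ (x - y) ξ))) =
      ∫ z : V, (Real.exp (-b * ‖x‖ ^ 2) * Real.exp (-b * ‖x - z‖ ^ 2)) *
      (f z * Real.cos (2 * Real.pi * inner ℝ z ξ)) := by
    intro x
    rw [← integral_sub_left_eq_self (fun z : V => (Real.exp (-b * ‖x‖ ^ 2) * Real.exp (-b * ‖x - z‖ ^ 2)) *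
      (f z * Real.cos (2 * Real.pi * inner ℝ z ξ))) volume x]
    simp
  simp_rw [hsub] at q3
  have hFC : Integrable (fun z : V => f z * Real.cos (2 * Real.pi * inner ℝ z ξ)) := by
    refine hi.mul_bdd (c := 1) (by fun_prop) (Filter.Eventually.of_forall fun x => ?_)
    simpa using Real.abs_cos_le_one _
  rw [integral_integral_swap] at q3
  · have hin : ∀ z : V, (∫ x : V, (Real.exp (-b * ‖x‖ ^ 2) * Real.exp (-b * ‖x - z‖ ^ 2)) *
      (f z * Real.cos (2 * Real.pi * inner ℝ z ξ))) =
      (∫ x : V, Real.exp (-(2 * b) * ‖x‖ ^ 2)) * (Real.exp (-b / 2 * ‖z‖ ^ 2) *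
        (f z * Real.cos (2 * Real.pi * inner ℝ z ξ))) := by
      intro z
      rw [integral_mul_const]
      suffices hI : ∫ x : V, Real.exp (-b * ‖x‖ ^ 2) * Real.exp (-b * ‖x - z‖ ^ 2) =
          (∫ x : V, Real.exp (-(2 * b) * ‖x‖ ^ 2)) * Real.exp (-b / 2 * ‖z‖ ^ 2) by
        rw [hI, mul_assoc]
      rw [← integral_mul_const]
      rw [← integral_sub_right_eq_self (fun x : V => Real.exp (-(2 * b) * ‖x‖ ^ 2) *
        Real.exp (-b / 2 * ‖z‖ ^ 2)) ((1/2 : ℝ) • z)]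
      refine integral_congr_ae (Filter.Eventually.of_forall fun x => ?_)
      beta_reduce
      rw [← Real.exp_add, ← Real.exp_add]
      congr 1
      rw [norm_sub_sq_real, norm_sub_sq_real, norm_smul, real_inner_smul_right]
      norm_num
      ring
    simp_rw [hin] at q3
    rw [integral_const_mul] at q3
    have hpos : 0 < ∫ x : V, Real.exp (-(2 * b) * ‖x‖ ^ 2) :=
      integral_exp_pos (gauss_integrable (2 * b) (by positivity))
    exact nonneg_of_mul_nonneg_right q3 hpos
  · have : Integrable (fun p : V × V => (Real.exp (-b * ‖p.1‖ ^ 2) *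
        (f p.2 * Real.cos (2 * Real.pi * inner ℝ p.2 ξ)))) (volume.prod volume) := hG.mul_prod hFC
    refine (this.bdd_mul (c := 1) (f := fun p : V × V => Real.exp (-b * ‖p.1 - p.2‖ ^ 2)) (by fun_prop)
      (Filter.Eventually.of_forall fun p => ?_)).congr (Filter.Eventually.of_forall fun p => ?_)
    · rw [Real.norm_of_nonneg (Real.exp_pos _).le, Real.exp_le_one_iff]
      have := sq_nonneg ‖p.1 - p.2‖
      nlinarith
    · simp only [Function.uncurry]; ring

theorem fourier_nonneg (f : V → ℝ) (hf : Continuous f) (hi : Integrable f) {H : Type}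
    [NormedAddCommGroup H]
    [InnerProductSpace ℝ H] [CompleteSpace H] (ψ : V → H) (hc : Continuous ψ)
    (hψ : ∀ x y, inner ℝ (ψ x) (ψ y) = f (x - y)) (ξ : V) :
    0 ≤ ∫ z, (f z * Real.cos (2 * Real.pi * inner ℝ z ξ)) := by
  have hFC : Integrable (fun z : V => f z * Real.cos (2 * Real.pi * inner ℝ z ξ)) := by
    refine hi.mul_bdd (c := 1) (by fun_prop) (Filter.Eventually.of_forall fun x => ?_)
    simpa using Real.abs_cos_le_one _
  have ht : Filter.Tendsto (fun b : ℝ => ∫ z, Real.exp (-b / 2 * ‖z‖ ^ 2) *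
      (f z * Real.cos (2 * Real.pi * inner ℝ z ξ))) (nhdsWithin 0 (Set.Ioi 0))
      (nhds (∫ z, (f z * Real.cos (2 * Real.pi * inner ℝ z ξ)))) := by
    refine tendsto_integral_filter_of_dominated_convergence _ ?_ ?_ hFC.norm ?_
    · exact Filter.Eventually.of_forall fun b => by fun_prop
    · filter_upwards [self_mem_nhdsWithin] with b (hb : 0 < b)
      refine Filter.Eventually.of_forall fun z => ?_
      rw [norm_mul]
      refine mul_le_of_le_one_left (norm_nonneg _) ?_
      rw [Real.norm_of_nonneg (Real.exp_pos _).le, Real.exp_le_one_iff]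
      have := sq_nonneg ‖z‖
      nlinarith
    · refine Filter.Eventually.of_forall fun z => ?_
      refine Filter.Tendsto.mono_left ?_ nhdsWithin_le_nhds
      have : Continuous (fun b : ℝ => Real.exp (-b / 2 * ‖z‖ ^ 2) *
        (f z * Real.cos (2 * Real.pi * inner ℝ z ξ))) := by fun_prop
      simpa using this.tendsto 0
  refine ge_of_tendsto ht ?_
  filter_upwards [self_mem_nhdsWithin] with b (hb : 0 < b)
  exact fourier_gauss_nonneg f hf hi ψ hc hψ ξ b hb

end Bochner

section Bochner2
open scoped FourierTransform
variable {V : Type} [NormedAddCommGroup V] [InnerProductSpace ℝ V]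
  [MeasurableSpace V] [BorelSpace V] [FiniteDimensional ℝ V]

theorem fourier_ofReal_even (f : V → ℝ) (hi : Integrable f) (he : ∀ x, f (-x) = f x) (ξ : V) :
    𝓕 (fun z => (f z : ℂ)) ξ = ((∫ z, (f z * Real.cos (2 * Real.pi * inner ℝ z ξ)) : ℝ) : ℂ) := by
  have hFC : Integrable (fun z : V => f z * Real.cos (2 * Real.pi * inner ℝ z ξ)) := by
    refine hi.mul_bdd (c := 1) (by fun_prop) (Filter.Eventually.of_forall fun x => ?_)
    simpa using Real.abs_cos_le_one _
  have hFS : Integrable (fun z : V => f z * Real.sin (2 * Real.pi * inner ℝ z ξ)) := by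
    refine hi.mul_bdd (c := 1) (by fun_prop) (Filter.Eventually.of_forall fun x => ?_)
    simpa using Real.abs_sin_le_one _
  have hS0 : ∫ z, f z * Real.sin (2 * Real.pi * inner ℝ z ξ) = 0 := by
    have := integral_neg_eq_self (fun z => f z * Real.sin (2 * Real.pi * inner ℝ z ξ)) volume
    simp only [he, inner_neg_left, mul_neg, Real.sin_neg, integral_neg] at this
    linarith
  rw [Real.fourier_eq']
  have h1 : ∀ z : V, Complex.exp (((-2 * Real.pi * inner ℝ z ξ : ℝ) : ℂ) * Complex.I) • (f z : ℂ)
      = ((f z * Real.cos (2 * Real.pi * inner ℝ z ξ) : ℝ) : ℂ) -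
        ((f z * Real.sin (2 * Real.pi * inner ℝ z ξ) : ℝ) : ℂ) * Complex.I := by
    intro z
    rw [Complex.exp_mul_I, show -2 * Real.pi * inner ℝ z ξ = -(2 * Real.pi * inner ℝ z ξ) by ring,
      ← Complex.ofReal_cos, ← Complex.ofReal_sin, Real.cos_neg, Real.sin_neg]
    push_cast
    rw [smul_eq_mul]
    ring
  simp_rw [h1]
  rw [integral_sub hFC.ofReal (hFS.ofReal.mul_const _), integral_mul_const, integral_complex_ofReal,
    integral_complex_ofReal, hS0]
  simp

theorem bochner (f : V → ℝ) (hf : Continuous f) (hi : Integrable f) {H : Type}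
    [NormedAddCommGroup H]
    [InnerProductSpace ℝ H] [CompleteSpace H] (ψ : V → H) (hc : Continuous ψ)
    (hψ : ∀ x y, inner ℝ (ψ x) (ψ y) = f (x - y)) :
    ∃ μ : Measure V, IsFiniteMeasure μ ∧ ∀ a, ∫ ξ, Real.cos (2 * Real.pi * inner ℝ a ξ) ∂μ = f a := by
  have he : ∀ x, f (-x) = f x := by
    intro x
    rw [← zero_sub, ← hψ, real_inner_comm, hψ, sub_zero]
  set g : V → ℝ := fun ξ => ∫ z, (f z * Real.cos (2 * Real.pi * inner ℝ z ξ)) with hg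
  have hF : 𝓕 (fun z => (f z : ℂ)) = fun ξ => (g ξ : ℂ) := by
    ext ξ; exact fourier_ofReal_even f hi he ξ
  have hg0 : ∀ ξ, 0 ≤ g ξ := fun ξ => fourier_nonneg f hf hi ψ hc hψ ξ
  have hfi : Integrable (fun z => (f z : ℂ)) := hi.ofReal
  have hgc : Continuous g := by
    have : Continuous (𝓕 (fun z => (f z : ℂ))) :=
      VectorFourier.fourierIntegral_continuous Real.continuous_fourierChar
        (L := innerₗ V) continuous_inner hfi
    rw [hF] at this
    exact (Complex.continuous_re.comp this)
  have hgb : ∀ ξ, |g ξ| ≤ ∫ z, |f z| := by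
    intro ξ
    rw [← Real.norm_eq_abs]
    refine (norm_integral_le_integral_norm
      (fun z => f z * Real.cos (2 * Real.pi * inner ℝ z ξ))).trans ?_
    refine integral_mono_of_nonneg (Filter.Eventually.of_forall fun z => norm_nonneg _) hi.abs
      (Filter.Eventually.of_forall fun z => ?_)
    beta_reduce
    rw [norm_mul]
    exact mul_le_of_le_one_right (abs_nonneg _) (by simpa using Real.abs_cos_le_one _)
  -- Gaussian-weighted integrals converge to `f 0`
  have hB : Filter.Tendsto (fun c : ℝ => ∫ w : V, Real.exp (-c⁻¹ * ‖w‖ ^ 2) * g w) Filter.atTop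
      (nhds (f 0)) := by
    have h0 := Real.tendsto_integral_gaussian_smul' (v := (0 : V)) hfi
      (by fun_prop : Continuous (fun z => (f z : ℂ))).continuousAt
    have h1 : Filter.Tendsto (fun c : ℝ => ((∫ w : V, Real.exp (-c⁻¹ * ‖w‖ ^ 2) * g w : ℝ) : ℂ))
        Filter.atTop (nhds (f 0 : ℂ)) := by
      refine h0.congr' ?_
      filter_upwards [Filter.Ioi_mem_atTop 0] with c (hc : 0 < c)
      have J : Integrable (fun w : V ↦ Complex.exp (- c⁻¹ * ‖w‖ ^ 2 + 2 * Real.pi * Complex.I * (inner ℝ (0:V) w : ℝ))) :=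
        GaussianFourier.integrable_cexp_neg_mul_sq_norm_add (by simpa) _ _
      have h2 := (VectorFourier.integral_fourierIntegral_smul_eq_flip (L := innerₗ V)
        Real.continuous_fourierChar continuous_inner J hfi)
      have h3 : ∫ w : V, 𝓕 (fun w : V ↦ Complex.exp (- c⁻¹ * ‖w‖ ^ 2 + 2 * Real.pi * Complex.I * (inner ℝ (0:V) w : ℝ))) w
          • (f w : ℂ) = ∫ w : V, Complex.exp (- c⁻¹ * ‖w‖ ^ 2 + 2 * Real.pi * Complex.I * (inner ℝ (0:V) w : ℝ)) •
            𝓕 (fun z => (f z : ℂ)) w := by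
        simpa using! h2
      rw [hF] at h3
      rw [← integral_complex_ofReal]
      refine Eq.trans ?_ (h3.trans ?_)
      · refine integral_congr_ae (Filter.Eventually.of_forall fun w => ?_)
        beta_reduce
        have e1 : (Real.pi : ℂ) / (c⁻¹ : ℂ) = Real.pi * c := by simp
        have e2 : -(Real.pi:ℂ) ^ 2 * (‖(0:V) - w‖:ℂ) ^ 2 / (c⁻¹ : ℂ)
            = -(Real.pi:ℂ) ^ 2 * c * (‖(0:V) - w‖:ℂ) ^ 2 := by
          rw [div_inv_eq_mul]; ring
        rw [fourier_gaussian_innerProductSpace' (by simpa), Complex.ofReal_inv, e1, e2]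
      · refine integral_congr_ae (Filter.Eventually.of_forall fun w => ?_)
        simp
    have := (Complex.continuous_re.tendsto _).comp h1
    simpa [Function.comp_def] using this
  have hgi : Integrable g := by
    refine ⟨hgc.aestronglyMeasurable, ?_⟩
    rw [hasFiniteIntegral_iff_ofReal (Filter.Eventually.of_forall hg0)]
    have hn : Filter.Tendsto (fun n : ℕ => ∫ w : V, Real.exp (-((n : ℝ) + 1)⁻¹ * ‖w‖ ^ 2) * g w)
        Filter.atTop (nhds (f 0)) :=
      hB.comp (Filter.tendsto_atTop_add_const_right _ 1 tendsto_natCast_atTop_atTop)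
    have hl : ∫⁻ w : V, ENNReal.ofReal (g w) ≤ Filter.liminf (fun n : ℕ =>
        ∫⁻ w : V, ENNReal.ofReal (Real.exp (-((n : ℝ) + 1)⁻¹ * ‖w‖ ^ 2) * g w)) Filter.atTop := by
      refine le_trans (le_of_eq ?_) (lintegral_liminf_le fun n => by fun_prop)
      refine lintegral_congr fun w => ?_
      refine (Filter.Tendsto.liminf_eq ?_).symm
      refine ENNReal.tendsto_ofReal ?_
      have h1 : Filter.Tendsto (fun n : ℕ => ((n : ℝ) + 1)⁻¹) Filter.atTop (nhds 0) :=
        tendsto_inv_atTop_zero.comp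
          (Filter.tendsto_atTop_add_const_right _ 1 tendsto_natCast_atTop_atTop)
      have h2 : Continuous (fun b : ℝ => Real.exp (-b * ‖w‖ ^ 2) * g w) := by fun_prop
      simpa [Function.comp_def] using (h2.tendsto 0).comp h1
    refine lt_of_le_of_lt hl ?_
    have h3 : Filter.Tendsto (fun n : ℕ =>
        ∫⁻ w : V, ENNReal.ofReal (Real.exp (-((n : ℝ) + 1)⁻¹ * ‖w‖ ^ 2) * g w)) Filter.atTop
        (nhds (ENNReal.ofReal (f 0))) := by
      refine (ENNReal.tendsto_ofReal hn).congr fun n => ?_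
      rw [ofReal_integral_eq_lintegral_ofReal]
      · refine (gauss_integrable (V := V) (((n : ℝ) + 1)⁻¹) (by positivity)).mul_bdd
          (c := ∫ z, |f z|) hgc.aestronglyMeasurable (Filter.Eventually.of_forall hgb)
      · exact Filter.Eventually.of_forall fun w => mul_nonneg (Real.exp_pos _).le (hg0 w)
    rw [h3.liminf_eq]
    exact ENNReal.ofReal_lt_top
  refine ⟨volume.withDensity (fun ξ => ENNReal.ofReal (g ξ)),
    isFiniteMeasure_withDensity_ofReal hgi.2, fun a => ?_⟩
  have hinv : 𝓕⁻ (𝓕 (fun z => (f z : ℂ))) a = f a :=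
    hfi.fourierInv_fourier_eq (by rw [hF]; exact hgi.ofReal)
      (by fun_prop : Continuous (fun z => (f z : ℂ))).continuousAt
  rw [hF, Real.fourierInv_eq'] at hinv
  have hre := congrArg Complex.re hinv
  rw [Complex.ofReal_re] at hre
  rw [integral_withDensity_eq_integral_toReal_smul (by fun_prop) (by simp), ← hre]
  have hint : Integrable (fun v : V => Complex.exp (((2 * Real.pi * inner ℝ v a : ℝ) : ℂ) * Complex.I) • (g v : ℂ)) := by
    refine Integrable.bdd_mul (c := 1) hgi.ofReal (by fun_prop) (Filter.Eventually.of_forall fun x => ?_)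
    rw [Complex.norm_exp_ofReal_mul_I]
  have h4 := Complex.reCLM.integral_comp_comm hint
  simp only [Complex.reCLM_apply] at h4
  rw [← h4]
  refine integral_congr_ae (Filter.Eventually.of_forall fun v => ?_)
  beta_reduce
  rw [ENNReal.toReal_ofReal (hg0 v), smul_eq_mul, smul_eq_mul, Complex.re_mul_ofReal,
    Complex.exp_ofReal_mul_I_re, real_inner_comm, mul_comm]

end Bochner2

theorem lint_scale (φ : ℝ → ℝ) (hφ : Continuous φ) (h0 : φ 0 = 0) (p : ℝ) (hp : 0 < p) (s : ℝ)
    (hs : 0 ≤ s) :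
    ∫⁻ r in Set.Ioi (0:ℝ), ENNReal.ofReal (φ (s * r) * r ^ (-1 - p))
      = ENNReal.ofReal (s ^ p) * ∫⁻ r in Set.Ioi (0:ℝ), ENNReal.ofReal (φ r * r ^ (-1 - p)) := by
  rcases hs.eq_or_lt with rfl | hs
  · simp [h0, Real.zero_rpow hp.ne']
  set F : ℝ → ENNReal := (Set.Ioi (0:ℝ)).indicator
    (fun r => ENNReal.ofReal (φ r * r ^ (-1 - p))) with hF
  have hFm : Measurable F := by
    refine Measurable.indicator ?_ measurableSet_Ioi
    have := hφ.measurable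
    fun_prop
  rw [← lintegral_indicator measurableSet_Ioi, ← lintegral_indicator measurableSet_Ioi, ← hF]
  have h1 : ∀ r, (Set.Ioi (0:ℝ)).indicator (fun r => ENNReal.ofReal (φ (s * r) * r ^ (-1 - p))) r
      = ENNReal.ofReal (s ^ (1 + p)) * F (s * r) := by
    intro r
    by_cases hr : 0 < r
    · have hsr : 0 < s * r := mul_pos hs hr
      rw [hF, Set.indicator_of_mem (Set.mem_Ioi.2 hr), Set.indicator_of_mem (Set.mem_Ioi.2 hsr),
        ← ENNReal.ofReal_mul (by positivity)]
      congr 1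
      rw [Real.mul_rpow hs.le hr.le]
      have : s ^ (1 + p) * s ^ (-1 - p) = 1 := by
        rw [← Real.rpow_add hs]; simp
      linear_combination (-(φ (s * r) * r ^ (-1 - p))) * this
    · have hsr : ¬ 0 < s * r := by
        intro h; exact hr (pos_of_mul_pos_right h hs.le |> fun h => h)
      rw [hF, Set.indicator_of_notMem (by simpa using hr), Set.indicator_of_notMem
        (by simpa using hsr), mul_zero]
  simp_rw [h1]
  rw [lintegral_const_mul _ (by fun_prop)]
  have h2 : ∫⁻ r, F (s * r) = ENNReal.ofReal s⁻¹ * ∫⁻ r, F r := by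
    rw [← lintegral_map (f := F) (g := fun r => s * r) hFm (by fun_prop), Real.map_volume_mul_left hs.ne',
      lintegral_smul_measure, abs_of_pos (inv_pos.2 hs), smul_eq_mul]
  rw [h2, ← mul_assoc, ← ENNReal.ofReal_mul (by positivity)]
  congr 2
  rw [Real.rpow_add hs, Real.rpow_one]
  field_simp

theorem lint_finite (φ : ℝ → ℝ) (hφ : Continuous φ) (h0 : ∀ r, 0 < r → 0 ≤ φ r)
    (h1 : ∀ r, 0 < r → φ r ≤ 2 * r) (h2 : ∀ r, 0 < r → φ r ≤ 2) (p : ℝ) (hp : 0 < p) (hp1 : p < 1) :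
    ∫⁻ r in Set.Ioi (0:ℝ), ENNReal.ofReal (φ r * r ^ (-1 - p)) ≠ ⊤ := by
  have hφm := hφ.measurable
  rw [← Set.Ioc_union_Ioi_eq_Ioi (zero_le_one' ℝ), lintegral_union measurableSet_Ioi
    (Set.Ioc_disjoint_Ioi le_rfl), ENNReal.add_ne_top]
  constructor
  · have hi : IntegrableOn (fun r : ℝ => 2 * r ^ (-p)) (Set.Ioc 0 1) := by
      have := intervalIntegral.intervalIntegrable_rpow' (a := 0) (b := 1) (r := -p) (by linarith)
      exact ((intervalIntegrable_iff_integrableOn_Ioc_of_le zero_le_one).1 this).const_mul 2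
    refine ne_top_of_le_ne_top hi.lintegral_lt_top.ne (setLIntegral_mono (by fun_prop) fun r hr => ?_)
    refine ENNReal.ofReal_le_ofReal ?_
    have e : r ^ (-p) = r * r ^ (-1 - p) := by
      rw [show (-p) = 1 + (-1 - p) by ring, Real.rpow_add hr.1, Real.rpow_one]
    rw [e, ← mul_assoc]
    exact mul_le_mul_of_nonneg_right (h1 r hr.1) (Real.rpow_nonneg hr.1.le _)
  · have hi : IntegrableOn (fun r : ℝ => 2 * r ^ (-1 - p)) (Set.Ioi 1) :=
      (integrableOn_Ioi_rpow_of_lt (by linarith) one_pos).const_mul 2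
    refine ne_top_of_le_ne_top hi.lintegral_lt_top.ne (setLIntegral_mono (by fun_prop) fun r hr => ?_)
    refine ENNReal.ofReal_le_ofReal ?_
    have hr0 : (0:ℝ) < r := lt_trans one_pos hr
    exact mul_le_mul_of_nonneg_right (h2 r hr0) (Real.rpow_nonneg hr0.le _)

theorem lint_pos (φ : ℝ → ℝ) (hφ : Continuous φ) (h0 : ∀ r, 0 < r → r < 1 → 0 < φ r) (p : ℝ) :
    ∫⁻ r in Set.Ioi (0:ℝ), ENNReal.ofReal (φ r * r ^ (-1 - p)) ≠ 0 := by
  have hφm := hφ.measurable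
  have : 0 < ∫⁻ r in Set.Ioo (0:ℝ) 1, ENNReal.ofReal (φ r * r ^ (-1 - p)) := by
    rw [setLIntegral_pos_iff (by fun_prop)]
    have : Set.Ioo (0:ℝ) 1 ⊆ Function.support (fun r => ENNReal.ofReal (φ r * r ^ (-1 - p)))
        ∩ Set.Ioo (0:ℝ) 1 := by
      intro r hr
      refine ⟨?_, hr⟩
      have : 0 < φ r * r ^ (-1 - p) := mul_pos (h0 r hr.1 hr.2) (Real.rpow_pos_of_pos hr.1 _)
      simpa using this
    refine lt_of_lt_of_le ?_ (measure_mono this)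
    simp
  exact (this.trans_le (lintegral_mono_set Set.Ioo_subset_Ioi_self)).ne'

section Moments
variable {V : Type} [NormedAddCommGroup V] [InnerProductSpace ℝ V]
  [MeasurableSpace V] [BorelSpace V] [FiniteDimensional ℝ V]

theorem moments (μ : Measure V) [IsFiniteMeasure μ] (N : V → ℝ) (hN0 : ∀ a, 0 ≤ N a)
    (hNs : ∀ r : ℝ, 0 ≤ r → ∀ a, N (r • a) = r * N a)
    (h : ∀ a, ∫ ξ, Real.cos (2 * Real.pi * inner ℝ a ξ) ∂μ = Real.exp (-N a))
    (p : ℝ) (hp : 0 < p) (hp1 : p < 1) :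
    ∃ C : ENNReal, C ≠ 0 ∧ C ≠ ⊤ ∧ ∀ a, ∫⁻ ξ, ENNReal.ofReal (|inner ℝ a ξ| ^ p) ∂μ
      = C * ENNReal.ofReal (N a ^ p) := by
  set K := ∫⁻ r in Set.Ioi (0:ℝ), ENNReal.ofReal ((1 - Real.cos r) * r ^ (-1 - p)) with hK
  set M := ∫⁻ r in Set.Ioi (0:ℝ), ENNReal.ofReal ((1 - Real.exp (-r)) * r ^ (-1 - p)) with hM
  have hK0 : K ≠ 0 := by
    refine lint_pos (fun r => 1 - Real.cos r) (by fun_prop) (fun r h0 h1 => ?_) p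
    have := Real.cos_lt_cos_of_nonneg_of_le_pi (le_refl 0) (by linarith [Real.pi_gt_three]) h0
    simp at this; linarith
  have hK1 : K ≠ ⊤ := by
    refine lint_finite (fun r => 1 - Real.cos r) (by fun_prop) (fun r _ => ?_) (fun r h0 => ?_)
      (fun r _ => ?_) p hp hp1
    · linarith [Real.cos_le_one r]
    · have h1 := Real.one_sub_sq_div_two_le_cos (x := r)
      have h2 := Real.neg_one_le_cos r
      rcases le_total r 1 with h | h <;> nlinarith
    · linarith [Real.neg_one_le_cos r]
  have hM0 : M ≠ 0 := by
    refine lint_pos (fun r => 1 - Real.exp (-r)) (by fun_prop) (fun r h0 h1 => ?_) p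
    have : Real.exp (-r) < 1 := Real.exp_lt_one_iff.2 (by linarith)
    linarith
  have hM1 : M ≠ ⊤ := by
    refine lint_finite (fun r => 1 - Real.exp (-r)) (by fun_prop) (fun r h0 => ?_) (fun r h0 => ?_)
      (fun r _ => ?_) p hp hp1
    · have : Real.exp (-r) < 1 := Real.exp_lt_one_iff.2 (by linarith)
      linarith
    · linarith [Real.add_one_le_exp (-r)]
    · linarith [Real.exp_pos (-r)]
  have hN00 : N 0 = 0 := by simpa using hNs 0 le_rfl 0
  have hμ : μ.real Set.univ = 1 := by simpa [hN00] using h 0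
  have key : ∀ a, (∫⁻ ξ, ENNReal.ofReal (|inner ℝ a ξ| ^ p) ∂μ) * K
      = ENNReal.ofReal ((N a / (2 * Real.pi)) ^ p) * M := by
    intro a
    rw [← lintegral_mul_const _ (by fun_prop)]
    have h1 : ∀ ξ : V, ENNReal.ofReal (|inner ℝ a ξ| ^ p) * K
        = ∫⁻ r in Set.Ioi (0:ℝ), ENNReal.ofReal ((1 - Real.cos (|inner ℝ a ξ| * r)) * r ^ (-1 - p)) := by
      intro ξ
      exact (lint_scale (fun r => 1 - Real.cos r) (by fun_prop) (by simp) p hp _ (abs_nonneg _)).symm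
    simp_rw [h1]
    rw [lintegral_lintegral_swap (by fun_prop)]
    rw [← lint_scale (fun r => 1 - Real.exp (-r)) (by fun_prop) (by simp) p hp _
      (div_nonneg (hN0 a) (by positivity))]
    refine setLIntegral_congr_fun measurableSet_Ioi fun r hr => ?_
    have hr0 : (0:ℝ) < r := hr
    beta_reduce
    have hci : Integrable (fun ξ : V => Real.cos (|inner ℝ a ξ| * r)) μ := by
      refine Integrable.of_bound (C := 1) (by fun_prop) (Filter.Eventually.of_forall fun x => ?_)
      simpa using Real.abs_cos_le_one _
    have hii : Integrable (fun ξ : V => (1 - Real.cos (|inner ℝ a ξ| * r)) * r ^ (-1 - p)) μ :=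
      ((integrable_const _).sub hci).mul_const _
    rw [← ofReal_integral_eq_lintegral_ofReal hii (Filter.Eventually.of_forall fun x =>
      mul_nonneg (by linarith [Real.cos_le_one (|inner ℝ a x| * r)]) (Real.rpow_nonneg hr0.le _))]
    congr 1
    rw [integral_mul_const, integral_sub (integrable_const _) hci]
    congr 2
    · simp [hμ]
    · have := h ((r / (2 * Real.pi)) • a)
      rw [hNs _ (by positivity)] at this
      rw [show N a / (2 * Real.pi) * r = r / (2 * Real.pi) * N a by ring, ← this]
      refine integral_congr_ae (Filter.Eventually.of_forall fun ξ => ?_)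
      beta_reduce
      rw [real_inner_smul_left, ← Real.cos_abs (2 * Real.pi * _)]
      congr 1
      rw [← mul_assoc, show 2 * Real.pi * (r / (2 * Real.pi)) = r by field_simp, abs_mul,
        abs_of_pos hr0, mul_comm]
  refine ⟨ENNReal.ofReal ((2 * Real.pi)⁻¹ ^ p) * M / K, ?_, ?_, fun a => ?_⟩
  · refine (ENNReal.div_pos (mul_ne_zero ?_ hM0) hK1).ne'
    have : 0 < (2 * Real.pi)⁻¹ ^ p := by positivity
    simpa using this
  · exact ENNReal.div_ne_top (ENNReal.mul_ne_top ENNReal.ofReal_ne_top hM1) hK0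
  · have h2 := key a
    rw [div_eq_mul_inv, Real.mul_rpow (hN0 a) (by positivity),
      ENNReal.ofReal_mul (Real.rpow_nonneg (hN0 a) _)] at h2
    have h3 := (ENNReal.eq_div_iff hK0 hK1).2 ((mul_comm _ _).trans h2)
    rw [h3]
    simp only [div_eq_mul_inv]
    ring

theorem moment_measure (μ : Measure V) [IsFiniteMeasure μ] (N : V → ℝ) (hN0 : ∀ a, 0 ≤ N a)
    (hNs : ∀ r : ℝ, 0 ≤ r → ∀ a, N (r • a) = r * N a)
    (h : ∀ a, ∫ ξ, Real.cos (2 * Real.pi * inner ℝ a ξ) ∂μ = Real.exp (-N a))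
    (p : ℝ) (hp : 0 < p) (hp1 : p < 1) :
    ∃ ν : Measure V, ∀ a, ∫⁻ ξ, ENNReal.ofReal (|inner ℝ a ξ| ^ p) ∂ν = ENNReal.ofReal (N a ^ p) := by
  obtain ⟨C, hC0, hC1, hC⟩ := moments μ N hN0 hNs h p hp hp1
  refine ⟨C⁻¹ • μ, fun a => ?_⟩
  rw [lintegral_smul_measure, hC, smul_eq_mul, ← mul_assoc, ENNReal.inv_mul_cancel hC0 hC1, one_mul]

end Moments

section FinDim
variable {V : Type} [NormedAddCommGroup V] [InnerProductSpace ℝ V]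
  [MeasurableSpace V] [BorelSpace V] [FiniteDimensional ℝ V]

theorem integrable_exp_neg_norm (c : ℝ) (hc : 0 < c) : Integrable (fun v : V => Real.exp (-(c * ‖v‖))) := by
  set n := Module.finrank ℝ V + 1 with hn
  have h1 : Integrable (fun v : V => ((n.factorial : ℝ) * Real.exp c / c ^ n) * (1 + ‖v‖) ^ (-(n : ℝ))) :=
    (integrable_one_add_norm (by rw [hn]; push_cast; linarith)).const_mul _
  refine h1.mono' (by fun_prop) (Filter.Eventually.of_forall fun v => ?_)
  rw [Real.norm_of_nonneg (Real.exp_pos _).le, Real.rpow_neg (by positivity), Real.rpow_natCast]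
  have h2 := Real.pow_div_factorial_le_exp (c * (1 + ‖v‖)) (by positivity) n
  have hf : (0:ℝ) < n.factorial := by exact_mod_cast n.factorial_pos
  rw [div_le_iff₀ hf, mul_pow, mul_add, mul_one, Real.exp_add] at h2
  rw [Real.exp_neg, ← div_eq_mul_inv, div_div, inv_eq_one_div, div_le_div_iff₀ (Real.exp_pos _) (by positivity)]
  linarith

theorem exists_moment_fin {E : Type} [NormedAddCommGroup E] [NormedSpace ℝ E]
    (hE : PosSemidefSpace E) (L : V →ₗ[ℝ] E) (hL : Function.Injective L)
    (p : ℝ) (hp : 0 < p) (hp1 : p < 1) :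
    ∃ ν : Measure V, ∀ a, ∫⁻ ξ, ENNReal.ofReal (|inner ℝ a ξ| ^ p) ∂ν
      = ENNReal.ofReal (‖L a‖ ^ p) := by
  have hLc : Continuous L := L.continuous_of_finiteDimensional
  obtain ⟨K, hK0, hK⟩ := L.exists_antilipschitzWith (LinearMap.ker_eq_bot.2 hL)
  have hK0' : (0:ℝ) < K := by exact_mod_cast hK0
  have hlow : ∀ v, (K:ℝ)⁻¹ * ‖v‖ ≤ ‖L v‖ := by
    intro v
    have := hK.le_mul_dist v 0
    simp only [map_zero, dist_zero_right] at this
    rw [inv_mul_le_iff₀ hK0']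
    exact this
  have hcf : Continuous (fun v => Real.exp (-‖L v‖)) := by fun_prop
  have hfi : Integrable (fun v => Real.exp (-‖L v‖)) := by
    refine (integrable_exp_neg_norm (V := V) (K:ℝ)⁻¹ (by positivity)).mono' (by fun_prop)
      (Filter.Eventually.of_forall fun v => ?_)
    rw [Real.norm_of_nonneg (Real.exp_pos _).le]
    exact Real.exp_le_exp.2 (neg_le_neg (hlow v))
  obtain ⟨H, _, _, _, ψ, hψ⟩ := exists_feature (fun x y : E => Real.exp (-dist x y))
    (fun x y => by rw [dist_comm]) (psdk_of_space E hE)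
  have hψ' : ∀ x y : V, inner ℝ ((ψ ∘ L) x) ((ψ ∘ L) y) = Real.exp (-‖L (x - y)‖) := by
    intro x y
    simp [hψ, dist_eq_norm]
  have hψc : Continuous (ψ ∘ L) := by
    refine Continuous.comp ?_ hLc
    rw [continuous_iff_continuousAt]
    intro x
    rw [ContinuousAt, tendsto_iff_norm_sub_tendsto_zero]
    have h1 : ∀ y, ‖ψ y - ψ x‖ = Real.sqrt (2 - 2 * Real.exp (-dist y x)) := by
      intro y
      have h2 : ‖ψ y - ψ x‖ ^ 2 = 2 - 2 * Real.exp (-dist y x) := by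
        rw [norm_sub_sq_real, ← real_inner_self_eq_norm_sq, ← real_inner_self_eq_norm_sq,
          hψ, hψ, hψ]
        simp; ring
      rw [← h2, Real.sqrt_sq (norm_nonneg _)]
    simp_rw [h1]
    have h3 : Continuous (fun y => Real.sqrt (2 - 2 * Real.exp (-dist y x))) := by fun_prop
    simpa using h3.tendsto x
  obtain ⟨μ, hμ, hμ'⟩ := bochner _ hcf hfi (ψ ∘ L) hψc hψ'
  exact moment_measure μ (fun v => ‖L v‖) (fun _ => norm_nonneg _)
    (fun r hr a => by simp [norm_smul, abs_of_nonneg hr]) hμ' p hp hp1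

end FinDim

theorem exists_moment_pi {E : Type} [NormedAddCommGroup E] [NormedSpace ℝ E]
    (hE : PosSemidefSpace E) {S : Type} [Fintype S] (x : S → E) (hx : LinearIndependent ℝ x)
    (p : ℝ) (hp : 0 < p) (hp1 : p < 1) :
    ∃ ν : Measure (S → ℝ), ∀ a : S → ℝ, ∫⁻ ξ, ENNReal.ofReal (|∑ i, a i * ξ i| ^ p) ∂ν
      = ENNReal.ofReal (‖∑ i, a i • x i‖ ^ p) := by
  let L : EuclideanSpace ℝ S →ₗ[ℝ] E :=
    (Fintype.linearCombination ℝ x) ∘ₗ (WithLp.linearEquiv 2 ℝ (S → ℝ)).toLinearMap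
  have hL : Function.Injective L := by
    exact hx.fintypeLinearCombination_injective.comp (WithLp.linearEquiv 2 ℝ (S → ℝ)).injective
  obtain ⟨ν, hν⟩ := exists_moment_fin hE L hL p hp hp1
  refine ⟨ν.map WithLp.ofLp, fun a => ?_⟩
  rw [lintegral_map (by fun_prop) (by fun_prop)]
  have := hν (WithLp.toLp 2 a)
  convert this using 4 with ξ
  · simp [PiLp.inner_apply, mul_comm]
  · simp [L, Fintype.linearCombination_apply]

theorem exists_moment_compact {E : Type} [NormedAddCommGroup E] [NormedSpace ℝ E]
    (hE : PosSemidefSpace E) {ι : Type} (x : ι → E) (hx : LinearIndependent ℝ x)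
    (w : ι → ℝ) (hw0 : ∀ i, 0 < w i) (hw1 : ∀ i, w i ≤ 1) (S : Finset ι)
    (hS : ∑ i ∈ S, w i * (1 + ‖x i‖) ≤ 1)
    (p : ℝ) (hp : 1 / 2 ≤ p) (hp1 : p < 1) :
    ∃ ν : Measure ((i : ι) → Set.Icc (-((w i) ^ 2)⁻¹) (((w i) ^ 2)⁻¹)), ν Set.univ ≤ 1 ∧
      ∀ a : ι → ℝ, ∫⁻ η, ENNReal.ofReal (|∑ i ∈ S, a i * (η i : ℝ)| ^ p) ∂ν
      = ENNReal.ofReal (‖∑ i ∈ S, a i • x i‖ ^ p) := by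
  classical
  have hp0 : 0 < p := by linarith
  obtain ⟨ν, hν⟩ := exists_moment_pi hE (S := S) (fun i => x i)
    (hx.comp _ Subtype.val_injective) p hp0 hp1
  have hR : ∀ i, -((w i) ^ 2)⁻¹ ≤ ((w i) ^ 2)⁻¹ := fun i => by
    have : 0 ≤ ((w i) ^ 2)⁻¹ := by positivity
    linarith
  set W : (S → ℝ) → ℝ := fun ξ => ∑ i : S, w i * |ξ i| ^ p with hW
  have hWm : Measurable W := by fun_prop
  have hW0 : ∀ ξ, 0 ≤ W ξ := fun ξ =>
    Finset.sum_nonneg fun i _ => mul_nonneg (hw0 i).le (Real.rpow_nonneg (abs_nonneg _) _)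
  let Z : (S → ℝ) → ι → ℝ := fun ξ i => (if h : i ∈ S then ξ ⟨i, h⟩ else 0) / (W ξ) ^ (1 / p)
  have hZm : ∀ i, Measurable (fun ξ => Z ξ i) := by
    intro i
    by_cases h : i ∈ S
    · simp only [Z, h, dite_true]; fun_prop
    · simp only [Z, h, dite_false]; fun_prop
  let G : (S → ℝ) → ((i : ι) → Set.Icc (-((w i) ^ 2)⁻¹) (((w i) ^ 2)⁻¹)) :=
    fun ξ i => Set.projIcc _ _ (hR i) (Z ξ i)
  have hGm : Measurable G := by
    rw [measurable_pi_iff]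
    intro i
    exact continuous_projIcc.measurable.comp (hZm i)
  have hGZ : ∀ ξ, 0 < W ξ → ∀ i ∈ S, ((G ξ i : _) : ℝ) = Z ξ i := by
    intro ξ hξ i hi
    have hle : |Z ξ i| ≤ ((w i) ^ 2)⁻¹ := by
      simp only [Z, hi, dite_true]
      rw [abs_div, abs_of_pos (Real.rpow_pos_of_pos hξ _), div_le_iff₀ (Real.rpow_pos_of_pos hξ _)]
      have h1 : w i * |ξ ⟨i, hi⟩| ^ p ≤ W ξ :=
        Finset.single_le_sum (f := fun i : S => w i * |ξ i| ^ p) (fun i _ => mul_nonneg (hw0 i).le (Real.rpow_nonneg (abs_nonneg _) _))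
          (Finset.mem_univ (⟨i, hi⟩ : S))
      have h2 : |ξ ⟨i, hi⟩| ^ p ≤ (w i)⁻¹ * W ξ := by
        rw [inv_mul_eq_div, le_div_iff₀ (hw0 i)]; linarith
      have h3 : |ξ ⟨i, hi⟩| ≤ ((w i)⁻¹ * W ξ) ^ (1 / p) := by
        have := Real.rpow_le_rpow (Real.rpow_nonneg (abs_nonneg _) _) h2 (by positivity : 0 ≤ 1 / p)
        rwa [← Real.rpow_mul (abs_nonneg _), mul_one_div_cancel hp0.ne', Real.rpow_one] at this
      refine h3.trans ?_
      rw [Real.mul_rpow (inv_nonneg.2 (hw0 i).le) hξ.le]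
      refine mul_le_mul_of_nonneg_right ?_ (Real.rpow_nonneg hξ.le _)
      rw [← inv_pow, ← Real.rpow_natCast]
      refine Real.rpow_le_rpow_of_exponent_le ((one_le_inv₀ (hw0 i)).2 (hw1 i)) ?_
      rw [div_le_iff₀ hp0]; push_cast; linarith
    show ((Set.projIcc _ _ (hR i) (Z ξ i) : _) : ℝ) = Z ξ i
    rw [Set.projIcc_of_mem (hR i) (abs_le.1 hle)]
  refine ⟨(ν.withDensity (fun ξ => ENNReal.ofReal (W ξ))).map G, ?_, fun a => ?_⟩
  · rw [Measure.map_apply hGm MeasurableSet.univ, Set.preimage_univ, withDensity_apply _ MeasurableSet.univ,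
      Measure.restrict_univ]
    have h1 : ∀ ξ, ENNReal.ofReal (W ξ) = ∑ i : S, ENNReal.ofReal (w i) * ENNReal.ofReal (|ξ i| ^ p) := by
      intro ξ
      simp only [hW]
      rw [ENNReal.ofReal_sum_of_nonneg fun (i : S) _ => mul_nonneg (hw0 i).le (Real.rpow_nonneg (abs_nonneg _) _)]
      exact Finset.sum_congr rfl fun i _ => ENNReal.ofReal_mul (hw0 i).le
    simp_rw [h1]
    rw [lintegral_finsetSum _ (fun i _ => by fun_prop)]
    have h2 : ∀ i : S, ∫⁻ ξ : S → ℝ, ENNReal.ofReal (w i) * ENNReal.ofReal (|ξ i| ^ p) ∂ν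
        ≤ ENNReal.ofReal (w i * (1 + ‖x i‖)) := by
      intro i
      rw [lintegral_const_mul _ (by fun_prop), ENNReal.ofReal_mul (hw0 i).le]
      refine mul_le_mul_right ?_ _
      have h3 := hν (Pi.single i 1)
      simp only [Pi.single_apply, ite_mul, one_mul, zero_mul, ite_smul, one_smul, zero_smul,
        Finset.sum_ite_eq', Finset.mem_univ, if_true] at h3
      rw [h3]
      refine ENNReal.ofReal_le_ofReal ?_
      rcases le_total ‖x i‖ 1 with h | h
      · have := Real.rpow_le_one (norm_nonneg _) h hp0.le
        linarith [norm_nonneg (x i)]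
      · have := Real.rpow_le_rpow_of_exponent_le h hp1.le
        rw [Real.rpow_one] at this
        linarith
    refine (Finset.sum_le_sum fun i _ => h2 i).trans ?_
    rw [← ENNReal.ofReal_sum_of_nonneg (fun (i : S) _ => mul_nonneg (hw0 i).le (by positivity)),
      ← ENNReal.ofReal_one]
    refine ENNReal.ofReal_le_ofReal ?_
    rw [Finset.sum_coe_sort S (fun i => w i * (1 + ‖x i‖))]
    exact hS
  · rw [lintegral_map (by fun_prop) hGm, lintegral_withDensity_eq_lintegral_mul _ (by fun_prop) (by fun_prop)]
    have h4 := hν (fun i => a i)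
    rw [Finset.sum_coe_sort S (fun i => a i • x i)] at h4
    rw [← h4]
    refine lintegral_congr fun ξ => ?_
    simp only [Pi.mul_apply]
    rw [← ENNReal.ofReal_mul (hW0 ξ)]
    congr 1
    rcases (hW0 ξ).eq_or_lt with h | h
    · have h5 : ∀ i, ξ i = 0 := by
        intro i
        have := (Finset.sum_eq_zero_iff_of_nonneg (fun (i : S) _ => mul_nonneg (hw0 i).le (Real.rpow_nonneg (abs_nonneg _) _))).1 h.symm i (Finset.mem_univ i)
        rcases mul_eq_zero.1 this with h6 | h6
        · exact absurd h6 (hw0 i).ne'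
        · rw [Real.rpow_eq_zero (abs_nonneg _) hp0.ne'] at h6
          exact abs_eq_zero.1 h6
      rw [← h]
      simp [h5, Real.zero_rpow hp0.ne']
    · have h6 : ∑ i ∈ S, a i * (G ξ i : ℝ) = (∑ i : S, a i * ξ i) / (W ξ) ^ (1 / p) := by
        rw [Finset.sum_div, ← Finset.sum_coe_sort S]
        refine Finset.sum_congr rfl fun i _ => ?_
        rw [hGZ ξ h i i.2]
        simp only [Z, i.2, dite_true, Subtype.coe_eta]
        ring
      rw [h6, abs_div, abs_of_pos (Real.rpow_pos_of_pos h _), Real.div_rpow (abs_nonneg _)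
        (Real.rpow_nonneg h.le _), ← Real.rpow_mul h.le, one_div_mul_cancel hp0.ne', Real.rpow_one]
      field_simp

theorem rpow_near (t p : ℝ) (ht : 0 ≤ t) (hp : 0 < p) (hp1 : p < 1) :
    |t ^ p - t| ≤ (1 - p) * (1 + t ^ 2) := by
  rcases ht.eq_or_lt with rfl | ht0
  · rw [Real.zero_rpow hp.ne']; simp; linarith
  rw [abs_le]
  constructor
  · have h1 : t ^ p = t * t ^ (p - 1) := by
      rw [show t * t ^ (p - 1) = t ^ (1:ℝ) * t ^ (p - 1) by rw [Real.rpow_one], ← Real.rpow_add ht0]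
      ring_nf
    have h2 : 1 - (1 - p) * t ≤ t ^ (p - 1) := by
      rw [Real.rpow_def_of_pos ht0]
      have h3 := Real.add_one_le_exp (Real.log t * (p - 1))
      have h4 := Real.log_le_sub_one_of_pos ht0
      nlinarith
    rw [h1]
    nlinarith
  · have h1 := Real.geom_mean_le_arith_mean2_weighted hp.le (by linarith : 0 ≤ 1 - p) ht zero_le_one (by ring)
    rw [Real.one_rpow, mul_one, mul_one] at h1
    nlinarith [sq_nonneg t]

theorem exists_limit_measure {E : Type} [NormedAddCommGroup E] [NormedSpace ℝ E]
    (hE : PosSemidefSpace E) {ι : Type} [Countable ι] (x : ι → E) (hx : LinearIndependent ℝ x)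
    (w : ι → ℝ) (hw0 : ∀ i, 0 < w i) (hw1 : ∀ i, w i ≤ 1)
    (hS : ∀ S : Finset ι, ∑ i ∈ S, w i * (1 + ‖x i‖) ≤ 1) :
    ∃ ν : Measure ((i : ι) → Set.Icc (-((w i) ^ 2)⁻¹) (((w i) ^ 2)⁻¹)), IsFiniteMeasure ν ∧
      ∀ a : ι →₀ ℝ, ∫ η, |a.sum fun i c => c * (η i : ℝ)| ∂ν = ‖a.sum fun i c => c • x i‖ := by
  classical
  let K := (i : ι) → Set.Icc (-((w i) ^ 2)⁻¹) (((w i) ^ 2)⁻¹)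
  let P : ℕ → ℝ := fun n => 1 - 1 / ((n:ℝ) + 2)
  have hP1 : ∀ n, P n < 1 := fun n => by
    have : 0 < 1 / ((n:ℝ) + 2) := by positivity
    simp only [P]; linarith
  have hP2 : ∀ n, 1 / 2 ≤ P n := fun n => by
    have : 1 / ((n:ℝ) + 2) ≤ 1 / 2 := by
      apply one_div_le_one_div_of_le <;> linarith [(Nat.cast_nonneg n : (0:ℝ) ≤ n)]
    simp only [P]; linarith
  have hPt : Filter.Tendsto P Filter.atTop (nhds 1) := by
    have h1 : Filter.Tendsto (fun n : ℕ => 1 / ((n:ℝ) + 2)) Filter.atTop (nhds 0) :=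
      tendsto_const_nhds.div_atTop
          (Filter.tendsto_atTop_add_const_right _ 2 tendsto_natCast_atTop_atTop)
    simpa [P] using h1.const_sub 1
  have hex := fun j : Finset ι × ℕ =>
    exists_moment_compact hE x hx w hw0 hw1 j.1 (hS j.1) (P j.2) (hP2 j.2) (hP1 j.2)
  choose νs hν1 hν2 using hex
  have hfin : ∀ j, IsFiniteMeasure (νs j) := fun j => ⟨(hν1 j).trans_lt ENNReal.one_lt_top⟩
  let μs : Finset ι × ℕ → FiniteMeasure K := fun j => ⟨νs j, hfin j⟩
  have hmass : ∀ j, (μs j).mass ≤ 1 := by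
    intro j
    rw [← ENNReal.coe_le_coe, FiniteMeasure.ennreal_mass]
    exact hν1 j
  let U : Ultrafilter (Finset ι × ℕ) := Ultrafilter.of Filter.atTop
  have hU : (U : Filter (Finset ι × ℕ)) ≤ Filter.atTop := Ultrafilter.of_le _
  obtain ⟨ν, -, hν⟩ := (isCompact_iff_ultrafilter_le_nhds'.1
    (isCompact_setOfPred_finiteMeasure_le_of_compactSpace K 1)) (U.map μs)
    (Filter.mem_map.2 (Filter.Eventually.of_forall hmass))
  have hνt : Filter.Tendsto μs U (nhds ν) := hν
  refine ⟨ν, inferInstance, fun a => ?_⟩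
  let gc : C(K, ℝ) := ⟨fun η => |a.sum fun i c => c * (η i : ℝ)|, by
    unfold Finsupp.sum; fun_prop⟩
  let g : BoundedContinuousFunction K ℝ := BoundedContinuousFunction.mkOfCompact gc
  have hg : ∀ η, g η = |a.sum fun i c => c * (η i : ℝ)| := fun η => rfl
  have hg0 : ∀ η, 0 ≤ g η := fun η => abs_nonneg _
  have hgB : ∀ η, g η ≤ ‖g‖ := fun η => (le_abs_self _).trans (g.norm_coe_le_norm η)
  have ht1 := (FiniteMeasure.tendsto_iff_forall_integral_tendsto.1 hνt) g
  have hPU : Filter.Tendsto (fun j : Finset ι × ℕ => P j.2) U (nhds 1) :=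
    hPt.comp ((Filter.tendsto_snd.mono_left (le_of_eq Filter.prod_atTop_atTop_eq.symm)).mono_left hU)
  have hsub : ∀ᶠ j : Finset ι × ℕ in U, a.support ⊆ j.1 := by
    refine hU ?_
    filter_upwards [Filter.Ici_mem_atTop (a.support, 0)] with j hj
    exact hj.1
  have hlim1 : Filter.Tendsto (fun j : Finset ι × ℕ => ‖a.sum fun i c => c • x i‖ ^ (P j.2)) U
      (nhds ‖a.sum fun i c => c • x i‖) := by
    have h1 : ContinuousAt (fun q : ℝ => ‖a.sum fun i c => c • x i‖ ^ q) 1 :=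
      Real.continuousAt_const_rpow' one_ne_zero
    have h2 := h1.tendsto.comp hPU
    rw [Real.rpow_one] at h2
    exact h2
  have hlim2 : Filter.Tendsto (fun j : Finset ι × ℕ => (1 - P j.2) * (1 + ‖g‖ ^ 2)) U (nhds 0) := by
    have := (hPU.const_sub 1).mul_const (1 + ‖g‖ ^ 2)
    simpa using this
  have hclose : ∀ᶠ j : Finset ι × ℕ in U,
      ‖(∫ η, g η ∂(μs j : Measure K)) - ‖a.sum fun i c => c • x i‖ ^ (P j.2)‖
        ≤ (1 - P j.2) * (1 + ‖g‖ ^ 2) := by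
    filter_upwards [hsub] with j hj
    have hp0 : 0 < P j.2 := by linarith [hP2 j.2]
    have h1 := hν2 j a
    rw [← Finsupp.sum_of_support_subset a hj (fun i c => c • x i) (by simp)] at h1
    have h2 : ∀ η : K, |∑ i ∈ j.1, a i * (η i : ℝ)| = g η := by
      intro η
      rw [hg, Finsupp.sum_of_support_subset a hj (fun i c => c * (η i : ℝ)) (by simp)]
    have h1' : ∫⁻ η : K, ENNReal.ofReal (g η ^ P j.2) ∂(νs j)
        = ENNReal.ofReal (‖a.sum fun i c => c • x i‖ ^ P j.2) := by
      rw [← h1]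
      refine lintegral_congr fun η => ?_
      rw [h2]
    have hgp : Continuous (fun η : K => g η ^ P j.2) :=
      g.continuous.rpow_const fun _ => Or.inr hp0.le
    have h3 : ∫ η : K, g η ^ P j.2 ∂(νs j) = ‖a.sum fun i c => c • x i‖ ^ P j.2 := by
      rw [integral_eq_lintegral_of_nonneg_ae (Filter.Eventually.of_forall fun η =>
        Real.rpow_nonneg (hg0 η) _) hgp.aestronglyMeasurable, h1', ENNReal.toReal_ofReal
        (Real.rpow_nonneg (norm_nonneg _) _)]
    have hi1 : Integrable g (νs j) := g.integrable _
    have hi2 : Integrable (fun η : K => g η ^ P j.2) (νs j) :=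
      (BoundedContinuousFunction.mkOfCompact ⟨_, hgp⟩).integrable _
    rw [← h3]
    show ‖(∫ η, g η ∂(νs j)) - _‖ ≤ _
    rw [← integral_sub hi1 hi2]
    have hc0 : 0 ≤ (1 - P j.2) * (1 + ‖g‖ ^ 2) := mul_nonneg (by linarith [hP1 j.2]) (by positivity)
    have h4 := norm_integral_le_of_norm_le_const (μ := νs j) (f := fun η => g η - g η ^ P j.2)
      (C := (1 - P j.2) * (1 + ‖g‖ ^ 2)) (Filter.Eventually.of_forall fun η => by
        rw [← norm_neg, neg_sub]
        refine (rpow_near (g η) (P j.2) (hg0 η) hp0 (hP1 j.2)).trans ?_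
        refine mul_le_mul_of_nonneg_left ?_ (by linarith [hP1 j.2])
        have := pow_le_pow_left₀ (hg0 η) (hgB η) 2
        linarith)
    refine h4.trans (mul_le_of_le_one_right hc0 ?_)
    exact ENNReal.toReal_le_of_le_ofReal zero_le_one (by simpa using hν1 j)
  have hlim3 := squeeze_zero_norm' hclose hlim2
  have hlim4 := hlim3.add hlim1
  simp only [sub_add_cancel, zero_add] at hlim4
  exact tendsto_nhds_unique ht1 hlim4

theorem exists_param {K : Type} [MeasurableSpace K] [StandardBorelSpace K] [Nonempty K]
    (ν : Measure K) [IsFiniteMeasure ν] :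
    ∃ (g : Set.Icc (0:ℝ) 1 → K) (m : NNReal), Measurable g ∧
      ν = m • (volume : Measure (Set.Icc (0:ℝ) 1)).map g := by
  by_cases h0 : ν = 0
  · exact ⟨fun _ => Classical.arbitrary K, 0, measurable_const, by simp [h0]⟩
  have : NeZero ν := ⟨h0⟩
  obtain ⟨g, hg, hgm⟩ := MeasureTheory.Measure.exists_measurable_map_eq ((ν Set.univ)⁻¹ • ν)
  refine ⟨g, (ν Set.univ).toNNReal, hg, ?_⟩
  have h1 : (volume : Measure (Set.Icc (0:ℝ) 1)).map g = (ν Set.univ)⁻¹ • ν := hgm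
  rw [h1]
  ext s hs
  simp only [Measure.smul_apply, smul_eq_mul, ENNReal.smul_def, ENNReal.coe_toNNReal (measure_ne_top ν _)]
  rw [← mul_assoc, ENNReal.mul_inv_cancel (by simpa using h0) (measure_ne_top _ _), one_mul]

theorem exists_embedding_finsupp {E : Type} [NormedAddCommGroup E] [NormedSpace ℝ E]
    (hE : PosSemidefSpace E) {ι : Type} [Countable ι] (x : ι → E) (hx : LinearIndependent ℝ x) :
    ∃ T : (ι →₀ ℝ) →ₗ[ℝ] Lp ℝ 1 (volume : Measure (Set.Icc (0:ℝ) 1)),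
      ∀ a, ‖T a‖ = ‖Finsupp.linearCombination ℝ x a‖ := by
  classical
  have := Encodable.ofCountable ι
  obtain ⟨δ, hδ0, c, hδc, hc1⟩ := posSumOfEncodable one_pos ι
  have hδS : ∀ S : Finset ι, ∑ i ∈ S, δ i ≤ 1 := fun S =>
    (sum_le_hasSum S (fun i _ => (hδ0 i).le) hδc).trans hc1
  let w : ι → ℝ := fun i => δ i / (1 + ‖x i‖)
  have hpos : ∀ i, 0 < 1 + ‖x i‖ := fun i => by positivity
  have hw0 : ∀ i, 0 < w i := fun i => div_pos (hδ0 i) (hpos i)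
  have hw1 : ∀ i, w i ≤ 1 := fun i => by
    have h1 : δ i ≤ 1 := by simpa using hδS {i}
    rw [div_le_one (hpos i)]
    linarith [norm_nonneg (x i)]
  have hS : ∀ S : Finset ι, ∑ i ∈ S, w i * (1 + ‖x i‖) ≤ 1 := by
    intro S
    refine le_trans (le_of_eq (Finset.sum_congr rfl fun i _ => ?_)) (hδS S)
    exact div_mul_cancel₀ _ (hpos i).ne'
  obtain ⟨ν, hνf, hν⟩ := exists_limit_measure hE x hx w hw0 hw1 hS
  have : ∀ i, Nonempty (Set.Icc (-((w i) ^ 2)⁻¹) (((w i) ^ 2)⁻¹)) := fun i =>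
    ⟨⟨0, by simp; positivity⟩⟩
  obtain ⟨g, m, hg, hνg⟩ := exists_param ν
  let F : (ι →₀ ℝ) → Set.Icc (0:ℝ) 1 → ℝ := fun a t => (m:ℝ) * a.sum fun i c => c * (g t i : ℝ)
  have hgi : ∀ i, Measurable (fun t => (g t i : ℝ)) := fun i =>
    measurable_subtype_coe.comp ((measurable_pi_apply i).comp hg)
  have hFm : ∀ a, Measurable (F a) := by
    intro a
    simp only [F, Finsupp.sum]
    fun_prop
  have hFL : ∀ a, MemLp (F a) 1 (volume : Measure (Set.Icc (0:ℝ) 1)) := by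
    intro a
    refine MemLp.of_bound (hFm a).aestronglyMeasurable ((m:ℝ) * ∑ i ∈ a.support, |a i| * ((w i) ^ 2)⁻¹)
      (Filter.Eventually.of_forall fun t => ?_)
    simp only [F, Finsupp.sum]
    rw [norm_mul, Real.norm_of_nonneg m.coe_nonneg]
    refine mul_le_mul_of_nonneg_left ((norm_sum_le _ _).trans (Finset.sum_le_sum fun i _ => ?_)) m.coe_nonneg
    rw [norm_mul]
    exact mul_le_mul_of_nonneg_left (abs_le.2 (g t i).2) (abs_nonneg _)
  let T : (ι →₀ ℝ) →ₗ[ℝ] Lp ℝ 1 (volume : Measure (Set.Icc (0:ℝ) 1)) :=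
    { toFun := fun a => (hFL a).toLp (F a)
      map_add' := by
        intro a b
        rw [← MemLp.toLp_add]
        refine MemLp.toLp_congr _ _ (Filter.Eventually.of_forall fun t => ?_)
        simp only [F, Pi.add_apply]
        rw [Finsupp.sum_add_index' (by simp) (by intros; ring)]
        ring
      map_smul' := by
        intro r a
        rw [RingHom.id_apply, ← MemLp.toLp_const_smul]
        refine MemLp.toLp_congr _ _ (Filter.Eventually.of_forall fun t => ?_)
        simp only [F, Pi.smul_apply, smul_eq_mul]
        rw [Finsupp.sum_smul_index (by simp)]
        simp only [Finsupp.sum, mul_assoc, Finset.mul_sum]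
        refine Finset.sum_congr rfl fun i _ => by ring }
  refine ⟨T, fun a => ?_⟩
  rw [Finsupp.linearCombination_apply, ← hν a, L1.norm_eq_integral_norm]
  have h1 : ∫ t, ‖T a t‖ ∂(volume : Measure (Set.Icc (0:ℝ) 1)) = ∫ t, ‖F a t‖ := by
    refine integral_congr_ae ?_
    filter_upwards [(hFL a).coeFn_toLp] with t ht
    exact congrArg _ ht
  rw [h1, hνg, integral_smul_nnreal_measure, integral_map hg.aemeasurable]
  · simp only [F, norm_mul, NNReal.smul_def, smul_eq_mul]
    rw [integral_const_mul]
    simp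
  · refine Measurable.aestronglyMeasurable ?_
    simp only [Finsupp.sum]
    fun_prop

theorem exists_embedding {E : Type} [NormedAddCommGroup E] [NormedSpace ℝ E]
    [TopologicalSpace.SeparableSpace E] (hE : PosSemidefSpace E) :
    ∃ T : E →ₗ[ℝ] Lp ℝ 1 (volume : Measure (Set.Icc (0:ℝ) 1)), ∀ x : E, ‖T x‖ = ‖x‖ := by
  obtain ⟨b, hbs, hbspan, hbi⟩ := exists_linearIndependent ℝ (Set.range (TopologicalSpace.denseSeq E))
  have : Countable b := ((Set.countable_range _).mono hbs).to_subtype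
  obtain ⟨T, hT⟩ := exists_embedding_finsupp hE (fun i : b => (i : E)) hbi
  have hd : DenseRange (Finsupp.linearCombination ℝ (fun i : b => (i : E))) := by
    have h1 : Set.range (Finsupp.linearCombination ℝ (fun i : b => (i : E)))
        = (Submodule.span ℝ (Set.range (TopologicalSpace.denseSeq E)) : Set E) := by
      rw [← hbspan, ← LinearMap.coe_range, Finsupp.range_linearCombination, Subtype.range_coe]
    rw [DenseRange, h1]
    exact (TopologicalSpace.denseRange_denseSeq E).mono Submodule.subset_span
  have hn : ∃ C : ℝ, ∀ a, ‖T a‖ ≤ C * ‖Finsupp.linearCombination ℝ (fun i : b => (i : E)) a‖ :=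
    ⟨1, fun a => by rw [hT, one_mul]⟩
  let T' := T.extendOfNorm (Finsupp.linearCombination ℝ (fun i : b => (i : E)))
  refine ⟨T'.toLinearMap, fun x => ?_⟩
  refine hd.induction_on (p := fun x => ‖T' x‖ = ‖x‖) x (isClosed_eq (by fun_prop) (by fun_prop)) fun a => ?_
  rw [LinearMap.extendOfNorm_eq hd hn, hT]

theorem statement14 (E : Type) [NormedAddCommGroup E] [NormedSpace ℝ E]
    [TopologicalSpace.SeparableSpace E] :
    (PosSemidefSpace E ↔ PosDefSpace E) ∧
    (PosDefSpace E ↔ NegativeType E) ∧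
    (NegativeType E ↔
      ∃ T : E →ₗ[ℝ] Lp ℝ 1 (volume : Measure (Set.Icc (0:ℝ) 1)),
        ∀ x : E, ‖T x‖ = ‖x‖) := by
  have h21 : PosDefSpace E → PosSemidefSpace E := fun h s => (h s).posSemidef
  have h13 : PosSemidefSpace E → NegativeType E := negType_of_psd E
  have h32 : NegativeType E → PosDefSpace E := posDef_of_negType E
  refine ⟨⟨fun h => h32 (h13 h), h21⟩, ⟨fun h => h13 (h21 h), h32⟩,
    fun h => exists_embedding (h21 (h32 h)), ?_⟩
  rintro ⟨T, hT⟩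
  exact negType_of_embedding E _ T hT
end

section
/- Let 0 < p ≤ 2, 0 < α ≤ 1, and let n be a positive integer. Define F : ℝⁿ → ℝ by F(x) = exp(−‖x‖_p^{α·min{1,p}}), where ‖x‖_p = (Σ_{j=1}^n |x_j|^p)^{1/p}. Then there is a constant c > 0 (depending on p, α, n) such that the Fourier transform F̂(ω) = ∫_{ℝⁿ} F(x) e^{−2πi⟨x,ω⟩} dx is a real number satisfying F̂(ω) ≥ c (1 + ‖ω‖₂)^{−(1+p)n} for every ω ∈ ℝⁿ, where ‖ω‖₂ is the Euclidean norm. -/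
open MeasureTheory Real
open scoped FourierTransform ENNReal

/-- The `ℓ_p` (quasi)norm on `ℝⁿ`: `‖x‖_p = (Σ |x_j|^p)^{1/p}`. -/
noncomputable def pNorm (p : ℝ) {n : ℕ} (x : EuclideanSpace ℝ (Fin n)) : ℝ :=
  (∑ j, |x j| ^ p) ^ (1 / p)

section GoodFramework

open Filter Topology

variable {E : Type*} [NormedAddCommGroup E] [InnerProductSpace ℝ E] [FiniteDimensional ℝ E]
  [MeasurableSpace E] [BorelSpace E]

/-- Cosine transform. -/
noncomputable def CT (g : E → ℝ) (w : E) : ℝ := ∫ x, g x * cos (inner ℝ w x)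

/-- Multipliers preserving nonnegativity of the cosine transform. -/
def Good (f : E → ℝ) : Prop :=
  Measurable f ∧ (∃ C, ∀ x, |f x| ≤ C) ∧
    ∀ g : E → ℝ, Integrable g → (∀ w, 0 ≤ CT g w) → ∀ w, 0 ≤ CT (fun x => f x * g x) w

lemma integrable_mul_cos {g : E → ℝ} (hg : Integrable g) (w : E) :
    Integrable (fun x => g x * cos (inner ℝ w x)) := by
  refine hg.mul_bdd (c := 1) ?_ ?_
  · exact (by fun_prop : Continuous fun x => cos (inner ℝ w x)).aestronglyMeasurable
  · exact Eventually.of_forall fun x => by simpa using abs_cos_le_one _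

lemma Good.integrable_mul {f g : E → ℝ} (hf : Good f) (hg : Integrable g) :
    Integrable (fun x => f x * g x) := by
  obtain ⟨hm, ⟨C, hC⟩, -⟩ := hf
  exact hg.bdd_mul (c := C) hm.aestronglyMeasurable (Eventually.of_forall hC)

lemma good_cos (u : E) : Good (fun x : E => cos (inner ℝ u x)) := by
  refine ⟨by fun_prop, ⟨1, fun x => abs_cos_le_one _⟩, fun g hg h w => ?_⟩
  have h1 : CT (fun x => cos (inner ℝ u x) * g x) w = (CT g (w + u) + CT g (w - u)) / 2 := by
    unfold CT
    rw [← integral_add (integrable_mul_cos hg _) (integrable_mul_cos hg _), ← integral_div]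
    congr 1; ext x
    rw [inner_add_left, inner_sub_left, cos_add, cos_sub]; ring
  rw [h1]
  have := h (w + u); have := h (w - u); linarith

lemma good_const {c : ℝ} (hc : 0 ≤ c) : Good (fun _ : E => c) := by
  refine ⟨by fun_prop, ⟨|c|, fun x => le_rfl⟩, fun g hg h w => ?_⟩
  have : CT (fun x => c * g x) w = c * CT g w := by
    unfold CT; rw [← integral_const_mul]; congr 1; ext x; ring
  rw [this]; exact mul_nonneg hc (h w)

lemma Good.add {f g : E → ℝ} (hf : Good f) (hg : Good g) : Good (fun x => f x + g x) := by
  obtain ⟨C, hC⟩ := hf.2.1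
  obtain ⟨D, hD⟩ := hg.2.1
  refine ⟨hf.1.add hg.1, ⟨C + D, fun x => (abs_add_le _ _).trans (add_le_add (hC x) (hD x))⟩,
    fun k hk h w => ?_⟩
  have : CT (fun x => (f x + g x) * k x) w =
      CT (fun x => f x * k x) w + CT (fun x => g x * k x) w := by
    unfold CT
    rw [← integral_add (integrable_mul_cos (hf.integrable_mul hk) _)
      (integrable_mul_cos (hg.integrable_mul hk) _)]
    congr 1; ext x; ring
  rw [this]
  exact add_nonneg (hf.2.2 k hk h w) (hg.2.2 k hk h w)

lemma Good.mul {f g : E → ℝ} (hf : Good f) (hg : Good g) : Good (fun x => f x * g x) := by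
  obtain ⟨C, hC⟩ := hf.2.1
  obtain ⟨D, hD⟩ := hg.2.1
  refine ⟨hf.1.mul hg.1, ⟨C * D, fun x => ?_⟩, fun k hk h w => ?_⟩
  · rw [abs_mul]
    exact mul_le_mul (hC x) (hD x) (abs_nonneg _) ((abs_nonneg _).trans (hC x))
  · have := hf.2.2 _ (hg.integrable_mul hk) (hg.2.2 k hk h) w
    simpa only [mul_assoc] using this

lemma Good.pow {f : E → ℝ} (hf : Good f) (m : ℕ) : Good (fun x => f x ^ m) := by
  induction m with
  | zero => simpa using good_const (E := E) zero_le_one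
  | succ m ih => simpa only [pow_succ] using ih.mul hf

lemma good_sum {ι : Type*} (s : Finset ι) {f : ι → E → ℝ} (hf : ∀ i ∈ s, Good (f i)) :
    Good (fun x => ∑ i ∈ s, f i x) := by
  classical
  induction s using Finset.induction_on with
  | empty => simpa using good_const (E := E) le_rfl
  | insert a s ha ih =>
    simp only [Finset.sum_insert ha]
    exact (hf a (by simp)).add (ih fun i hi => hf i (by simp [hi]))

lemma good_prod {ι : Type*} (s : Finset ι) {f : ι → E → ℝ} (hf : ∀ i ∈ s, Good (f i)) :
    Good (fun x => ∏ i ∈ s, f i x) := by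
  classical
  induction s using Finset.induction_on with
  | empty => simpa using good_const (E := E) zero_le_one
  | insert a s ha ih =>
    simp only [Finset.prod_insert ha]
    exact (hf a (by simp)).mul (ih fun i hi => hf i (by simp [hi]))

lemma good_lim {F : ℕ → E → ℝ} {f : E → ℝ} (hF : ∀ k, Good (F k)) {C : ℝ}
    (hC : ∀ k x, |F k x| ≤ C) (hlim : ∀ x, Tendsto (fun k => F k x) atTop (𝓝 (f x))) :
    Good f := by
  refine ⟨measurable_of_tendsto_metrizable (fun k => (hF k).1) (tendsto_pi_nhds.2 hlim),
    ⟨C, fun x => le_of_tendsto (hlim x).abs (Eventually.of_forall fun k => hC k x)⟩,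
    fun g hg h w => ?_⟩
  have : Tendsto (fun k => CT (fun x => F k x * g x) w) atTop
      (𝓝 (CT (fun x => f x * g x) w)) := by
    unfold CT
    refine tendsto_integral_of_dominated_convergence (fun x => C * |g x|) ?_ ?_ ?_ ?_
    · intro k
      exact (integrable_mul_cos ((hF k).integrable_mul hg) w).aestronglyMeasurable
    · exact hg.abs.const_mul C
    · intro k
      refine Eventually.of_forall fun x => ?_
      rw [norm_eq_abs, abs_mul, abs_mul]
      calc |F k x| * |g x| * |cos (inner ℝ w x)| ≤ |F k x| * |g x| * 1 := by
            gcongr; exact abs_cos_le_one _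
        _ ≤ C * |g x| := by rw [mul_one]; gcongr; exact hC k x
    · exact Eventually.of_forall fun x => ((hlim x).mul_const _).mul_const _
  exact ge_of_tendsto' this fun k => (hF k).2.2 g hg h w

/-- Fubini for mixtures. -/
lemma CT_mix {T : Type*} [MeasurableSpace T] (ν : Measure T) [IsFiniteMeasure ν]
    {q : T → E → ℝ} (hq : Measurable (Function.uncurry q)) {C : ℝ} (hC : ∀ t x, |q t x| ≤ C)
    {g : E → ℝ} (hg : Integrable g) (w : E) :
    CT (fun x => (∫ t, q t x ∂ν) * g x) w = ∫ t, CT (fun x => q t x * g x) w ∂ν := by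
  unfold CT
  have hIntg : Integrable (fun z : T × E => q z.1 z.2 * (g z.2 * cos (inner ℝ w z.2)))
      (ν.prod volume) := by
    refine Integrable.bdd_mul (c := C) ?_ hq.aestronglyMeasurable
      (Eventually.of_forall fun z => hC _ _)
    exact (integrable_mul_cos hg w).comp_snd ν
  have := integral_integral_swap (f := fun t x => q t x * (g x * cos (inner ℝ w x))) hIntg
  simp only [mul_assoc]
  rw [this]
  congr 1; ext x
  rw [integral_mul_const]

lemma good_mix {T : Type*} [MeasurableSpace T] (ν : Measure T) [IsFiniteMeasure ν]
    {q : T → E → ℝ} (hq : Measurable (Function.uncurry q)) {C : ℝ} (hC : ∀ t x, |q t x| ≤ C)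
    (hgood : ∀ t, Good (q t)) : Good (fun x => ∫ t, q t x ∂ν) := by
  refine ⟨?_, ⟨C * ν.real Set.univ, fun x => ?_⟩, fun g hg h w => ?_⟩
  · have : StronglyMeasurable (Function.uncurry fun x t => q t x) :=
      (hq.comp measurable_swap).stronglyMeasurable
    exact this.integral_prod_right.measurable
  · have := norm_integral_le_of_norm_le_const (μ := ν) (f := fun t => q t x) (C := C)
      (Eventually.of_forall fun t => hC t x)
    exact this
  · rw [CT_mix ν hq hC hg]
    exact integral_nonneg fun t => (hgood t).2.2 g hg h w

lemma good_exp_aux {f : E → ℝ} (hf : Good f) (a : ℕ → ℝ) (ha0 : ∀ k, 0 ≤ a k)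
    (ha1 : ∀ k, a k ≤ 1) : Good (fun x => ∑' k : ℕ, a k * (f x ^ k / k.factorial)) := by
  obtain ⟨C, hC⟩ := hf.2.1
  have hs : ∀ x, Summable fun k : ℕ => |a k * (f x ^ k / k.factorial)| := by
    intro x
    refine Summable.of_nonneg_of_le (fun k => abs_nonneg _) (fun k => ?_)
      (Real.summable_pow_div_factorial |f x|)
    rw [abs_mul, abs_div, abs_pow, abs_of_nonneg (ha0 k), Nat.abs_cast]
    exact mul_le_of_le_one_left (by positivity) (ha1 k)
  refine good_lim (F := fun N x => ∑ k ∈ Finset.range N, a k * (f x ^ k / k.factorial))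
    (C := ∑' k : ℕ, C ^ k / k.factorial) ?_ ?_ ?_
  · intro N
    refine good_sum _ fun k _ => (good_const (ha0 k)).mul ?_
    simp only [div_eq_mul_inv]
    exact (hf.pow k).mul (good_const (by positivity))
  · intro N x
    have hC0 : 0 ≤ C := (abs_nonneg _).trans (hC x)
    calc |∑ k ∈ Finset.range N, a k * (f x ^ k / k.factorial)|
        ≤ ∑ k ∈ Finset.range N, |a k * (f x ^ k / k.factorial)| := Finset.abs_sum_le_sum_abs _ _
      _ ≤ ∑ k ∈ Finset.range N, C ^ k / k.factorial := by
          refine Finset.sum_le_sum fun k _ => ?_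
          rw [abs_mul, abs_div, abs_pow, abs_of_nonneg (ha0 k), Nat.abs_cast]
          refine (mul_le_of_le_one_left (by positivity) (ha1 k)).trans ?_
          have := hC x
          gcongr
      _ ≤ _ := (Real.summable_pow_div_factorial C).sum_le_tsum _ fun k _ => by positivity
  · intro x
    exact (hs x).of_abs.hasSum.tendsto_sum_nat

lemma exp_tsum (y : ℝ) : Real.exp y = ∑' k : ℕ, y ^ k / k.factorial := by
  rw [Real.exp_eq_exp_ℝ, NormedSpace.exp_eq_tsum_div]

lemma good_exp {f : E → ℝ} (hf : Good f) : Good (fun x => Real.exp (f x)) := by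
  have := good_exp_aux hf (fun _ => 1) (fun _ => zero_le_one) (fun _ => le_rfl)
  simpa [← exp_tsum] using this

lemma good_exp_sub {f : E → ℝ} (hf : Good f) : Good (fun x => Real.exp (f x) - f x) := by
  have := good_exp_aux hf (fun k => if k = 1 then 0 else 1) (fun k => by split_ifs <;> simp)
    (fun k => by split_ifs <;> simp)
  convert this using 2 with x
  have hs := Real.summable_pow_div_factorial (f x)
  rw [exp_tsum, hs.tsum_eq_add_tsum_ite 1]
  simp only [pow_one, Nat.factorial_one, Nat.cast_one, div_one, add_sub_cancel_left, ite_mul,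
    zero_mul, one_mul]

/-- Lévy–Khintchine type exponentials are good. -/
lemma good_levy {T : Type*} [MeasurableSpace T] (ν : Measure T) [SigmaFinite ν]
    {q : T → E → ℝ} (hq : Measurable (Function.uncurry q)) (hC : ∀ t x, |q t x| ≤ 1)
    (hgood : ∀ t, Good (q t)) (hIntg : ∀ x, Integrable (fun t => 1 - q t x) ν) :
    Good (fun x => Real.exp (-∫ t, (1 - q t x) ∂ν)) := by
  refine good_lim (F := fun k x => Real.exp (-∫ t in spanningSets ν k, (1 - q t x) ∂ν))
    (C := 1) ?_ ?_ ?_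
  · intro k
    have : IsFiniteMeasure (ν.restrict (spanningSets ν k)) :=
      ⟨by simpa using measure_spanningSets_lt_top ν k⟩
    have h1 := (good_const (E := E) (Real.exp_pos
      (-(∫ t in spanningSets ν k, (1:ℝ) ∂ν))).le).mul
      (good_exp (good_mix (ν.restrict (spanningSets ν k)) hq hC hgood))
    convert h1 using 2 with x
    rw [← Real.exp_add, integral_sub]
    · congr 1; ring
    · exact integrable_const _
    · refine Integrable.of_bound (C := 1) ?_ (Eventually.of_forall fun t => hC t x)
      exact (hq.comp (measurable_id.prodMk measurable_const)).aestronglyMeasurable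
  · intro k x
    rw [abs_of_pos (Real.exp_pos _), Real.exp_le_one_iff, neg_nonpos]
    exact integral_nonneg fun t => sub_nonneg.2 (abs_le.1 (hC t x)).2
  · intro x
    refine (Real.continuous_exp.tendsto _).comp (Tendsto.neg ?_)
    have := tendsto_setIntegral_of_monotone (μ := ν) (s := spanningSets ν)
      (f := fun t => 1 - q t x) (fun k => measurableSet_spanningSets ν k)
      (monotone_spanningSets ν) (by rw [iUnion_spanningSets]; exact (hIntg x).integrableOn)
    simpa [iUnion_spanningSets] using this

/-- Density form. -/
lemma good_levy' {T : Type*} [MeasurableSpace T] (μ : Measure T) [SigmaFinite μ]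
    {q : T → E → ℝ} (hq : Measurable (Function.uncurry q)) (hC : ∀ t x, |q t x| ≤ 1)
    (hgood : ∀ t, Good (q t)) {w : T → ℝ} (hw : Measurable w) (hw0 : ∀ t, 0 ≤ w t)
    (hIntg : ∀ x, Integrable (fun t => (1 - q t x) * w t) μ) :
    Good (fun x => Real.exp (-∫ t, (1 - q t x) * w t ∂μ)) := by
  have hw' : Measurable fun t => Real.toNNReal (w t) := hw.real_toNNReal
  obtain ⟨ν, hν⟩ : ∃ ν, ν = μ.withDensity fun t => (Real.toNNReal (w t) : ℝ≥0∞) := ⟨_, rfl⟩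
  have hsf : SigmaFinite ν := by rw [hν]; infer_instance
  have hIntg' : ∀ x, Integrable (fun t => 1 - q t x) ν := by
    intro x
    rw [hν, integrable_withDensity_iff_integrable_smul hw']
    refine (hIntg x).congr (Eventually.of_forall fun t => ?_)
    simp [NNReal.smul_def, hw0 t, mul_comm]
  have h := good_levy ν hq hC hgood hIntg'
  have heq : ∀ x, ∫ t, (1 - q t x) ∂ν = ∫ t, (1 - q t x) * w t ∂μ := by
    intro x
    rw [hν, integral_withDensity_eq_integral_smul hw']
    refine integral_congr_ae (Eventually.of_forall fun t => ?_)
    simp [NNReal.smul_def, hw0 t, mul_comm]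
  simp only [heq] at h
  exact h

lemma good_mix' {T : Type*} [MeasurableSpace T] (μ : Measure T)
    {q : T → E → ℝ} (hq : Measurable (Function.uncurry q)) (hC : ∀ t x, |q t x| ≤ 1)
    (hgood : ∀ t, Good (q t)) {w : T → ℝ} (hw : Measurable w) (hw0 : ∀ t, 0 ≤ w t)
    (hIntg : Integrable w μ) : Good (fun x => ∫ t, q t x * w t ∂μ) := by
  have hw' : Measurable fun t => Real.toNNReal (w t) := hw.real_toNNReal
  have : IsFiniteMeasure (μ.withDensity fun t => ENNReal.ofReal (w t)) :=
    isFiniteMeasure_withDensity_ofReal hIntg.2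
  have h := good_mix (μ.withDensity fun t => ENNReal.ofReal (w t)) hq hC hgood
  have heq : ∀ x, ∫ t, q t x ∂(μ.withDensity fun t => ENNReal.ofReal (w t)) =
      ∫ t, q t x * w t ∂μ := by
    intro x
    refine (integral_withDensity_eq_integral_smul (μ := μ) hw' (fun t => q t x)).trans ?_
    refine integral_congr_ae (Eventually.of_forall fun t => ?_)
    simp [NNReal.smul_def, hw0 t, mul_comm]
  simp only [heq] at h
  exact h

lemma split_levy {T : Type*} [MeasurableSpace T] (μ : Measure T) [SigmaFinite μ]
    {q : T → E → ℝ} (hq : Measurable (Function.uncurry q)) (hC : ∀ t x, |q t x| ≤ 1)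
    (hgood : ∀ t, Good (q t)) {w k : T → ℝ} (hw : Measurable w) (hk : Measurable k)
    (hk0 : ∀ t, 0 ≤ k t) (hkw : ∀ t, k t ≤ w t) (hkint : Integrable k μ)
    (hIntg : ∀ x, Integrable (fun t => (1 - q t x) * w t) μ) :
    ∃ g : E → ℝ, Good g ∧ (∀ x, 0 < g x) ∧
      (∃ C, ∀ x, g x ≤ C * Real.exp (-∫ t, (1 - q t x) * w t ∂μ)) ∧
      Good (fun x => ∫ t, q t x * k t ∂μ) ∧
      Good (fun x => Real.exp (-∫ t, (1 - q t x) * w t ∂μ) - g x * ∫ t, q t x * k t ∂μ) := by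
  have hqk : ∀ x, Integrable (fun t => q t x * k t) μ := fun x =>
    hkint.bdd_mul (c := 1) (hq.comp (measurable_id.prodMk measurable_const)).aestronglyMeasurable
      (Eventually.of_forall fun t => hC t x)
  have hqk' : ∀ x, Integrable (fun t => (1 - q t x) * k t) μ := fun x => by
    refine (hkint.sub (hqk x)).congr (Eventually.of_forall fun t => ?_)
    simp; ring
  have hd : ∀ x, Integrable (fun t => (1 - q t x) * (w t - k t)) μ := fun x => by
    refine ((hIntg x).sub (hqk' x)).congr (Eventually.of_forall fun t => ?_)
    simp; ring
  have hφ := good_mix' μ hq hC hgood hk hk0 hkint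
  have hg : Good (fun x => Real.exp (-∫ t, (1 - q t x) * (w t - k t) ∂μ)) :=
    good_levy' μ hq hC hgood (hw.sub hk) (fun t => sub_nonneg.2 (hkw t)) hd
  have hg' := (good_const (E := E) (Real.exp_pos (-∫ t, k t ∂μ)).le).mul hg
  have key : ∀ x, Real.exp (-∫ t, k t ∂μ) * Real.exp (-∫ t, (1 - q t x) * (w t - k t) ∂μ) *
      Real.exp (∫ t, q t x * k t ∂μ) = Real.exp (-∫ t, (1 - q t x) * w t ∂μ) := by
    intro x
    rw [← Real.exp_add, ← Real.exp_add]
    congr 1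
    have e1 : ∫ t, (1 - q t x) * (w t - k t) ∂μ =
        ∫ t, (1 - q t x) * w t ∂μ - (∫ t, k t ∂μ - ∫ t, q t x * k t ∂μ) := by
      rw [← integral_sub hkint (hqk x)]
      refine Eq.trans ?_ (integral_sub (hIntg x) (hkint.sub (hqk x)))
      refine integral_congr_ae (Eventually.of_forall fun t => ?_)
      ring
    rw [e1]; ring
  refine ⟨_, hg', fun x => by positivity, ⟨Real.exp (∫ t, k t ∂μ), fun x => ?_⟩, hφ, ?_⟩
  · rw [← key x, mul_comm]
    have h0 : -(∫ t, k t ∂μ) ≤ ∫ t, q t x * k t ∂μ := by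
      rw [← integral_neg]
      refine integral_mono hkint.neg (hqk x) fun t => ?_
      have := (abs_le.1 (hC t x)).1
      have := hk0 t
      show -k t ≤ q t x * k t
      nlinarith
    set A := Real.exp (-∫ t, (1 - q t x) * (w t - k t) ∂μ)
    set B := Real.exp (-∫ t, k t ∂μ)
    have h1 : 1 ≤ Real.exp (∫ t, k t ∂μ) * Real.exp (∫ t, q t x * k t ∂μ) := by
      rw [← Real.exp_add]; exact Real.one_le_exp (by linarith)
    have hAB : 0 < A * B := by positivity
    calc A * B = A * B * 1 := by ring
      _ ≤ A * B * (Real.exp (∫ t, k t ∂μ) * Real.exp (∫ t, q t x * k t ∂μ)) := by gcongr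
      _ = _ := by ring
  · have := hg'.mul (good_exp_sub hφ)
    convert this using 2 with x
    rw [mul_sub, key x]

lemma good_prod_sub {ι : Type*} (s : Finset ι) {f g : ι → E → ℝ} (hf : ∀ i ∈ s, Good (f i))
    (hfg : ∀ i ∈ s, Good (fun x => g i x - f i x)) :
    Good (fun x => ∏ i ∈ s, g i x - ∏ i ∈ s, f i x) := by
  classical
  induction s using Finset.induction_on with
  | empty => simpa using good_const (E := E) le_rfl
  | insert a s ha ih =>
    have hgg : ∀ i ∈ insert a s, Good (g i) := fun i hi => by
      simpa using (hfg i hi).add (hf i hi)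
    simp only [Finset.prod_insert ha]
    have h1 := (hgg a (by simp)).mul
      (ih (fun i hi => hf i (by simp [hi])) fun i hi => hfg i (by simp [hi]))
    have h2 := (hfg a (by simp)).mul (good_prod s fun i hi => hf i (Finset.mem_insert_of_mem hi))
    convert h1.add h2 using 2 with x
    ring

/-- Integrable good functions have nonnegative cosine transform. -/
lemma Good.CT_nonneg {f : E → ℝ} (hf : Good f) (hi : Integrable f) (w : E) : 0 ≤ CT f w := by
  have hgauss : ∀ b : ℝ, 0 < b → Integrable (fun x : E => Real.exp (-b * ‖x‖ ^ 2)) ∧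
      ∀ w, 0 ≤ CT (fun x : E => Real.exp (-b * ‖x‖ ^ 2)) w := by
    intro b hb
    have hb' : 0 < (b : ℂ).re := by simpa using hb
    constructor
    · have := (GaussianFourier.integrable_cexp_neg_mul_sq_norm_add hb' 0 (0 : E)).re
      refine this.congr (Eventually.of_forall fun x => ?_)
      simp only [zero_mul, add_zero]
      have : (-(b : ℂ) * (‖x‖ : ℂ) ^ 2) = ((-b * ‖x‖ ^ 2 : ℝ) : ℂ) := by push_cast; ring
      rw [this]; simp only [RCLike.re_to_complex, Complex.exp_ofReal_re]
    · intro w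
      have h1 := GaussianFourier.integrable_cexp_neg_mul_sq_norm_add hb' Complex.I w
      have h2 := GaussianFourier.integral_cexp_neg_mul_sq_norm_add hb' Complex.I w
      have h3 := congrArg Complex.re h2
      have h4 := integral_re h1
      simp only [RCLike.re_to_complex] at h4
      rw [← h4] at h3
      have h5 : ∀ x : E, (Complex.exp (-(b : ℂ) * (‖x‖ : ℂ) ^ 2 +
          Complex.I * ((inner ℝ w x : ℝ) : ℂ))).re =
          Real.exp (-b * ‖x‖ ^ 2) * cos (inner ℝ w x) := by
        intro x
        have : (-(b : ℂ) * (‖x‖ : ℂ) ^ 2) = ((-b * ‖x‖ ^ 2 : ℝ) : ℂ) := by push_cast; ring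
        rw [this, Complex.exp_re]; simp [Complex.add_re, Complex.add_im]; norm_cast; simp
      have h6 : CT (fun x : E => Real.exp (-b * ‖x‖ ^ 2)) w = _ :=
        (integral_congr_ae (Eventually.of_forall fun x => (h5 x).symm)).trans h3
      rw [h6]
      have e1 : ((π : ℂ) / b) ^ ((Module.finrank ℝ E : ℂ) / 2) =
          (((π / b) ^ ((Module.finrank ℝ E : ℝ) / 2) : ℝ) : ℂ) := by
        rw [Complex.ofReal_cpow (by positivity)]; push_cast; rfl
      have e2 : Complex.exp (Complex.I ^ 2 * (‖w‖ : ℂ) ^ 2 / (4 * b)) =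
          ((Real.exp (-(‖w‖ ^ 2 / (4 * b))) : ℝ) : ℂ) := by
        rw [Complex.I_sq]; push_cast; congr 1; ring
      rw [e1, e2, ← Complex.ofReal_mul, Complex.ofReal_re]
      positivity
  have hlim : Tendsto (fun k : ℕ => CT (fun x => f x * Real.exp (-(1 / ((k : ℝ) + 1)) * ‖x‖ ^ 2)) w)
      atTop (𝓝 (CT f w)) := by
    unfold CT
    refine tendsto_integral_of_dominated_convergence (fun x => |f x|) ?_ hi.abs ?_ ?_
    · intro k
      exact (integrable_mul_cos (hf.integrable_mul
        (hgauss (1 / ((k : ℝ) + 1)) (by positivity)).1) w).aestronglyMeasurable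
    · intro k
      refine Eventually.of_forall fun x => ?_
      rw [norm_eq_abs, abs_mul, abs_mul, abs_of_pos (Real.exp_pos _)]
      have h1 : Real.exp (-(1 / ((k : ℝ) + 1)) * ‖x‖ ^ 2) ≤ 1 := by
        rw [Real.exp_le_one_iff, neg_mul, neg_nonpos]; positivity
      calc |f x| * Real.exp (-(1 / ((k : ℝ) + 1)) * ‖x‖ ^ 2) * |cos (inner ℝ w x)|
          ≤ |f x| * 1 * 1 := by gcongr; exact abs_cos_le_one _
        _ = |f x| := by ring
    · refine Eventually.of_forall fun x => ?_
      have h1 : Tendsto (fun k : ℕ => Real.exp (-(1 / ((k : ℝ) + 1)) * ‖x‖ ^ 2)) atTop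
          (𝓝 1) := by
        have := ((tendsto_one_div_add_atTop_nhds_zero_nat (𝕜 := ℝ)).neg.mul_const (‖x‖ ^ 2))
        simpa [Function.comp_def] using (Real.continuous_exp.tendsto _).comp this
      simpa using (h1.const_mul (f x)).mul_const (cos (inner ℝ w x))
  refine ge_of_tendsto' hlim fun k => ?_
  have := hgauss (1 / ((k : ℝ) + 1)) (by positivity)
  exact hf.2.2 _ this.1 this.2 w

end GoodFramework

section Scaling

open Filter Topology

variable {E : Type*} [NormedAddCommGroup E] [InnerProductSpace ℝ E] [FiniteDimensional ℝ E]
  [MeasurableSpace E] [BorelSpace E]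

lemma integrable_weight [Nontrivial E] {h : E → ℝ} (hm : Measurable h) {C a b : ℝ}
    (h0 : ∀ u, 0 ≤ h u) (h1 : ∀ u, h u ≤ C) (h2 : ∀ u, h u ≤ C * ‖u‖ ^ b) (ha : 0 < a)
    (hab : a < b) :
    Integrable (fun u => h u * ‖u‖ ^ (-((Module.finrank ℝ E : ℝ) + a))) := by
  set d := Module.finrank ℝ E with hd
  have hd1 : 1 ≤ d := Module.finrank_pos
  have hC : 0 ≤ C := (h0 0).trans (h1 0)
  let f : ℝ → ℝ := fun y => if y ≤ 1 then y ^ (b - (d + a)) else y ^ (-((d : ℝ) + a))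
  have hf : Integrable (fun u : E => f ‖u‖) := by
    rw [integrable_fun_norm_addHaar volume (f := f), ← hd,
      ← Set.Ioc_union_Ioi_eq_Ioi zero_le_one]
    refine IntegrableOn.union ?_ ?_
    · have : IntegrableOn (fun y : ℝ => y ^ (b - a - 1)) (Set.Ioc 0 1) := by
        rw [← intervalIntegrable_iff_integrableOn_Ioc_of_le zero_le_one]
        exact intervalIntegral.intervalIntegrable_rpow' (by linarith)
      refine this.congr_fun (fun y hy => ?_) measurableSet_Ioc
      simp only [f, if_pos hy.2, smul_eq_mul]
      rw [← rpow_natCast, ← rpow_add hy.1, Nat.cast_sub hd1]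
      congr 1; push_cast; ring
    · have : IntegrableOn (fun y : ℝ => y ^ (-1 - a)) (Set.Ioi 1) :=
        integrableOn_Ioi_rpow_of_lt (by linarith) one_pos
      refine this.congr_fun (fun y hy => ?_) measurableSet_Ioi
      have hy0 : (0:ℝ) < y := one_pos.trans hy
      simp only [f, if_neg (not_le.2 (Set.mem_Ioi.1 hy)), smul_eq_mul]
      rw [← rpow_natCast, ← rpow_add hy0, Nat.cast_sub hd1]
      congr 1; push_cast; ring
  refine (hf.const_mul C).mono' ?_ ?_
  · exact (hm.mul (by fun_prop)).aestronglyMeasurable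
  · filter_upwards [compl_mem_ae_iff.2 (measure_singleton (μ := (volume : Measure E)) 0)] with u hu
    have hu0 : 0 < ‖u‖ := norm_pos_iff.2 hu
    have hW : 0 ≤ ‖u‖ ^ (-((d : ℝ) + a)) := by positivity
    rw [norm_eq_abs, abs_of_nonneg (mul_nonneg (h0 u) hW)]
    by_cases hle : ‖u‖ ≤ 1
    · simp only [f, if_pos hle]
      rw [sub_eq_add_neg, rpow_add hu0, ← mul_assoc]
      exact mul_le_mul_of_nonneg_right (h2 u) hW
    · simp only [f, if_neg hle]
      exact mul_le_mul_of_nonneg_right (h1 u) hW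

lemma integral_weight_scale (h : E → ℝ) {a r : ℝ} (hr : 0 < r) :
    ∫ u, h (r • u) * ‖u‖ ^ (-((Module.finrank ℝ E : ℝ) + a)) =
      r ^ a * ∫ u, h u * ‖u‖ ^ (-((Module.finrank ℝ E : ℝ) + a)) := by
  set d := Module.finrank ℝ E with hd
  have := Measure.integral_comp_smul_of_nonneg (volume : Measure E)
    (fun u => h u * ‖u‖ ^ (-((d : ℝ) + a))) r (hR := hr.le)
  have e : ∀ u : E, h (r • u) * ‖u‖ ^ (-((d : ℝ) + a)) =
      r ^ ((d : ℝ) + a) * (h (r • u) * ‖r • u‖ ^ (-((d : ℝ) + a))) := by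
    intro u
    rw [norm_smul, norm_eq_abs, abs_of_pos hr, mul_rpow hr.le (norm_nonneg _), rpow_neg hr.le]
    have : r ^ ((d : ℝ) + a) ≠ 0 := (rpow_pos_of_pos hr _).ne'
    field_simp
  simp_rw [e]
  rw [integral_const_mul, this, smul_eq_mul, ← hd, ← mul_assoc]
  congr 1
  rw [rpow_add hr, rpow_natCast]
  field_simp

lemma weight_pos {h : E → ℝ} (hc : Continuous h) (h0 : ∀ u, 0 ≤ h u) {u₀ : E} (hu : u₀ ≠ 0)
    (hh : 0 < h u₀) {s : ℝ} (hi : Integrable (fun u => h u * ‖u‖ ^ s)) :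
    0 < ∫ u, h u * ‖u‖ ^ s := by
  rw [integral_pos_iff_support_of_nonneg (fun u => mul_nonneg (h0 u) (by positivity)) hi]
  have hopen : IsOpen ({u : E | 0 < h u} ∩ {0}ᶜ) :=
    (isOpen_lt continuous_const hc).inter isOpen_compl_singleton
  refine lt_of_lt_of_le (hopen.measure_pos volume ⟨u₀, hh, hu⟩) (measure_mono ?_)
  rintro u ⟨hu1, hu2⟩
  have : 0 < ‖u‖ := norm_pos_iff.2 hu2
  exact (mul_pos hu1 (rpow_pos_of_pos this _)).ne'

lemma levy_cos [Nontrivial E] {a : ℝ} (ha : 0 < a) (ha2 : a < 2) :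
    ∃ C : ℝ, 0 < C ∧ ∀ x : E,
      Integrable (fun u : E => (1 - cos (inner ℝ u x)) *
        (C * ‖u‖ ^ (-((Module.finrank ℝ E : ℝ) + a)))) ∧
      ∫ u : E, (1 - cos (inner ℝ u x)) * (C * ‖u‖ ^ (-((Module.finrank ℝ E : ℝ) + a))) =
        ‖x‖ ^ a := by
  obtain ⟨v, hv⟩ := exists_ne (0 : E)
  obtain ⟨e, he⟩ : ∃ e : E, ‖e‖ = 1 := ⟨(‖v‖⁻¹ : ℝ) • v, by
    rw [norm_smul, norm_inv, norm_norm, inv_mul_cancel₀ (norm_ne_zero_iff.2 hv)]⟩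
  set d := Module.finrank ℝ E with hd
  have hIntg : ∀ x : E, Integrable (fun u : E => (1 - cos (inner ℝ u x)) *
      ‖u‖ ^ (-((d : ℝ) + a))) := by
    intro x
    refine integrable_weight (C := 2 + ‖x‖ ^ 2) (b := 2) (by fun_prop)
      (fun u => sub_nonneg.2 (cos_le_one _)) (fun u => ?_) (fun u => ?_) ha ha2
    · have := neg_one_le_cos (inner ℝ u x); nlinarith [sq_nonneg ‖x‖]
    · have h1 := one_sub_sq_div_two_le_cos (x := inner ℝ u x)
      have h2 : (inner ℝ u x) ^ 2 ≤ (‖u‖ * ‖x‖) ^ 2 :=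
        sq_le_sq' (neg_le_of_abs_le (abs_real_inner_le_norm u x)) (real_inner_le_norm u x)
      rw [rpow_two]
      nlinarith [sq_nonneg ‖u‖, sq_nonneg (‖u‖ * ‖x‖)]
  set I := ∫ u : E, (1 - cos (inner ℝ u e)) * ‖u‖ ^ (-((d : ℝ) + a)) with hI
  have hIpos : 0 < I := by
    refine weight_pos (u₀ := e) (by fun_prop) (fun u => sub_nonneg.2 (cos_le_one _)) ?_ ?_ (hIntg e)
    · rintro rfl; simp at he
    · rw [real_inner_self_eq_norm_sq, he]
      have := Real.cos_lt_cos_of_nonneg_of_le_pi le_rfl (y := 1) (by linarith [pi_gt_three])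
        one_pos
      rw [cos_zero] at this
      norm_num; exact this
  have hval : ∀ x : E, ∫ u : E, (1 - cos (inner ℝ u x)) * ‖u‖ ^ (-((d : ℝ) + a)) =
      ‖x‖ ^ a * I := by
    intro x
    rcases eq_or_ne x 0 with rfl | hx
    · simp [zero_rpow ha.ne']
    have hx0 : 0 < ‖x‖ := norm_pos_iff.2 hx
    have hn : ‖‖x‖ • e‖ = ‖x‖ := by rw [norm_smul, he]; simp
    let R : E ≃ₗᵢ[ℝ] E := Submodule.reflection (Submodule.span ℝ {‖x‖ • e - x})ᗮ
    have hR : R (‖x‖ • e) = x := Submodule.reflection_sub hn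
    rw [← R.measurePreserving.integral_comp R.toHomeomorph.measurableEmbedding]
    rw [hI, ← integral_weight_scale (fun u : E => 1 - cos (inner ℝ u e)) hx0]
    refine integral_congr_ae (Eventually.of_forall fun u => ?_)
    simp only [R.norm_map]
    have : inner ℝ (R u) x = inner ℝ (‖x‖ • u) e := by
      conv_lhs => rw [← hR]
      rw [R.inner_map_map, real_inner_smul_left, real_inner_smul_right]
    rw [this]
  refine ⟨I⁻¹, by positivity, fun x => ⟨?_, ?_⟩⟩
  · refine ((hIntg x).const_mul I⁻¹).congr (Eventually.of_forall fun u => ?_)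
    simp only; ring
  · rw [show (fun u : E => (1 - cos (inner ℝ u x)) * (I⁻¹ * ‖u‖ ^ (-((d : ℝ) + a)))) =
      fun u : E => I⁻¹ * ((1 - cos (inner ℝ u x)) * ‖u‖ ^ (-((d : ℝ) + a))) from by
        ext u; ring, integral_const_mul, hval]
    field_simp

lemma levy_exp {a : ℝ} (ha : 0 < a) (ha1 : a < 1) :
    ∃ C : ℝ, 0 < C ∧ ∀ s : ℝ, 0 ≤ s →
      Integrable (fun t : ℝ => (1 - Real.exp (-(|t| * s))) * (C * |t| ^ (-(1 + a)))) ∧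
      ∫ t : ℝ, (1 - Real.exp (-(|t| * s))) * (C * |t| ^ (-(1 + a))) = s ^ a := by
  have hIntg : ∀ s : ℝ, 0 ≤ s → Integrable (fun t : ℝ => (1 - Real.exp (-(|t| * s))) *
      |t| ^ (-(1 + a))) := by
    intro s hs
    have := integrable_weight (E := ℝ) (h := fun t => 1 - Real.exp (-(|t| * s)))
      (C := 1 + s) (b := 1) (a := a) (by fun_prop)
      (fun u => by
        rw [sub_nonneg, Real.exp_le_one_iff, neg_nonpos]; positivity) (fun u => ?_)
      (fun u => ?_) ha ha1
    · simpa using this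
    · have := Real.exp_pos (-(|u| * s)); linarith
    · have := Real.add_one_le_exp (-(|u| * s))
      rw [rpow_one, norm_eq_abs]; nlinarith [abs_nonneg u]
  have hIntg1 := hIntg 1 zero_le_one
  simp only [mul_one] at hIntg1
  set I := ∫ t : ℝ, (1 - Real.exp (-|t|)) * |t| ^ (-(1 + a)) with hI
  have hIpos : 0 < I := by
    refine weight_pos (E := ℝ) (h := fun t => 1 - Real.exp (-|t|)) (u₀ := 1) (by fun_prop)
      (fun u => by
        rw [sub_nonneg, Real.exp_le_one_iff, neg_nonpos]; positivity) one_ne_zero ?_ hIntg1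
    simp
  have hval : ∀ s : ℝ, 0 ≤ s → ∫ t : ℝ, (1 - Real.exp (-(|t| * s))) * |t| ^ (-(1 + a)) =
      s ^ a * I := by
    intro s hs
    rcases hs.eq_or_lt with rfl | hs
    · simp [zero_rpow ha.ne']
    have := integral_weight_scale (E := ℝ) (fun t => 1 - Real.exp (-|t|)) (a := a) hs
    simp only [Module.finrank_self, Nat.cast_one, norm_eq_abs, smul_eq_mul, abs_mul,
      abs_of_pos hs] at this
    rw [hI, ← this]
    simp only [mul_comm]
  refine ⟨I⁻¹, by positivity, fun x hx => ⟨?_, ?_⟩⟩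
  · refine ((hIntg x hx).const_mul I⁻¹).congr (Eventually.of_forall fun u => ?_)
    simp only; ring
  · rw [show (fun u : ℝ => (1 - Real.exp (-(|u| * x))) * (I⁻¹ * |u| ^ (-(1 + a)))) =
      fun u : ℝ => I⁻¹ * ((1 - Real.exp (-(|u| * x))) * |u| ^ (-(1 + a))) from by
        ext u; ring, integral_const_mul, hval x hx]
    field_simp

/-- Lower bound for the cosine transform. -/
lemma CT_lower {F G m k : E → ℝ} (hF : Integrable F) (hGi : Integrable G) (hG : Good G)
    (hGpos : ∀ x, 0 < G x) (hk : Measurable k) (hki : Integrable k) (hk0 : ∀ u, 0 ≤ k u)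
    (hm : ∀ x, m x = ∫ u, cos (inner ℝ u x) * k u)
    (hgood : Good (fun x => F x - G x * m x)) {c N : ℝ} (hc : 0 < c) (hN : 0 ≤ N)
    (hlow : ∀ u, c * (1 + ‖u‖) ^ (-N) ≤ k u) :
    ∃ c' : ℝ, 0 < c' ∧ ∀ w, c' * (1 + ‖w‖) ^ (-N) ≤ CT F w := by
  have hmeas : Measurable (Function.uncurry fun u x : E => cos (inner ℝ u x)) := by
    have : Continuous (Function.uncurry fun u x : E => cos (inner ℝ u x)) := by
      unfold Function.uncurry; fun_prop
    exact this.measurable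
  have hgm : Good m := by
    have := good_mix' (volume : Measure E) (q := fun u x : E => cos (inner ℝ u x)) hmeas
      (fun _ _ => abs_cos_le_one _) good_cos hk hk0 hki
    convert this using 2 with x
    exact hm x
  have hGm : Integrable (fun x => G x * m x) := by
    simpa only [mul_comm] using hgm.integrable_mul hGi
  have hGCT : ∀ w, 0 ≤ CT G w := hG.CT_nonneg hGi
  have h1 : ∀ w, CT (fun x => G x * m x) w ≤ CT F w := by
    intro w
    have h2 := hgood.CT_nonneg (hF.sub hGm) w
    have h3 : CT (fun x => F x - G x * m x) w = CT F w - CT (fun x => G x * m x) w := by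
      unfold CT
      rw [← integral_sub (integrable_mul_cos hF w) (integrable_mul_cos hGm w)]
      congr 1; ext x; ring
    linarith
  -- continuity of CT G
  have hcont : Continuous (CT G) := by
    unfold CT
    refine continuous_of_dominated (bound := fun x => |G x|) ?_ ?_ hGi.abs ?_
    · intro w; exact (integrable_mul_cos hGi w).aestronglyMeasurable
    · intro w
      refine Eventually.of_forall fun x => ?_
      rw [norm_eq_abs, abs_mul]
      exact mul_le_of_le_one_right (abs_nonneg _) (abs_cos_le_one _)
    · exact Eventually.of_forall fun x => by fun_prop
  have hbd : ∀ w, |CT G w| ≤ ∫ x, |G x| := by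
    intro w
    unfold CT
    refine (abs_integral_le_integral_abs).trans ?_
    refine integral_mono (integrable_mul_cos hGi w).abs hGi.abs fun x => ?_
    simp only [abs_mul]
    exact mul_le_of_le_one_right (abs_nonneg _) (abs_cos_le_one _)
  have hzero : 0 < CT G 0 := by
    unfold CT
    simp only [inner_zero_left, cos_zero, mul_one]
    rw [integral_pos_iff_support_of_nonneg (fun x => (hGpos x).le) hGi]
    have : Function.support G = Set.univ := by ext x; simp [(hGpos x).ne']
    rw [this]
    exact isOpen_univ.measure_pos volume ⟨0, trivial⟩
  obtain ⟨ρ, hρ, hball⟩ := Metric.continuousAt_iff.1 hcont.continuousAt (CT G 0 / 2) (half_pos hzero)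
  set ρ' := min ρ 1 with hρ'
  have hρ'0 : 0 < ρ' := lt_min hρ one_pos
  have hball' : ∀ v ∈ Metric.ball (0 : E) ρ', CT G 0 / 2 ≤ CT G v := by
    intro v hv
    have := hball (lt_of_lt_of_le hv (min_le_left _ _))
    rw [Real.dist_eq, abs_lt] at this
    linarith [this.1]
  have hvol : 0 < (volume : Measure E).real (Metric.ball 0 ρ') :=
    ENNReal.toReal_pos (Metric.measure_ball_pos volume 0 hρ'0).ne' measure_ball_lt_top.ne
  have hform : ∀ w, CT (fun x => G x * m x) w =
      ∫ u, k u * ((CT G (w + u) + CT G (w - u)) / 2) := by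
    intro w
    have hIntg : Integrable (fun z : E × E => cos (inner ℝ z.1 z.2) *
        (k z.1 * (G z.2 * cos (inner ℝ w z.2)))) (volume.prod volume) := by
      refine Integrable.bdd_mul (c := 1) ?_ hmeas.aestronglyMeasurable
        (Eventually.of_forall fun z => abs_cos_le_one _)
      exact hki.mul_prod (integrable_mul_cos hGi w)
    have hsw := integral_integral_swap
      (f := fun u x => cos (inner ℝ u x) * (k u * (G x * cos (inner ℝ w x)))) hIntg
    have e1 : ∀ u : E, ∫ x, cos (inner ℝ u x) * (k u * (G x * cos (inner ℝ w x))) =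
        k u * ((CT G (w + u) + CT G (w - u)) / 2) := by
      intro u
      unfold CT
      rw [← integral_add (integrable_mul_cos hGi _) (integrable_mul_cos hGi _), ← integral_div,
        ← integral_const_mul]
      congr 1; ext x
      rw [inner_add_left, inner_sub_left, cos_add, cos_sub]; ring
    simp only [e1] at hsw
    rw [hsw]
    unfold CT
    congr 1; ext x
    simp only
    rw [hm x, mul_right_comm, mul_comm, ← integral_mul_const]
    congr 1; ext u; ring
  refine ⟨c * 2 ^ (-N) * (CT G 0 / 4) * (volume : Measure E).real (Metric.ball 0 ρ'),
    by positivity, fun w => ?_⟩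
  refine le_trans ?_ (h1 w)
  rw [hform w]
  have hki2 : Integrable (fun u => k u * ((CT G (w + u) + CT G (w - u)) / 2)) := by
    refine hki.mul_bdd (c := ∫ x, |G x|) ?_ ?_
    · exact Continuous.aestronglyMeasurable (by fun_prop)
    · refine Eventually.of_forall fun u => ?_
      have a1 := hbd (w + u); have a2 := hbd (w - u)
      rw [norm_eq_abs, abs_le] 
      rw [abs_le] at a1 a2
      constructor <;> linarith [a1.1, a2.1, a1.2, a2.2]
  have hnn : ∀ u, 0 ≤ k u * ((CT G (w + u) + CT G (w - u)) / 2) := fun u =>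
    mul_nonneg (hk0 u) (by have := hGCT (w + u); have := hGCT (w - u); linarith)
  have hw0 : 0 < 1 + ‖w‖ := by positivity
  calc c * 2 ^ (-N) * (CT G 0 / 4) * (volume : Measure E).real (Metric.ball 0 ρ') *
        (1 + ‖w‖) ^ (-N)
      = ∫ u in Metric.ball w ρ', c * 2 ^ (-N) * (CT G 0 / 4) * (1 + ‖w‖) ^ (-N) := by
        rw [setIntegral_const, smul_eq_mul, measureReal_def, measureReal_def,
          Measure.addHaar_ball_center volume w]; ring
    _ ≤ ∫ u in Metric.ball w ρ', k u * ((CT G (w + u) + CT G (w - u)) / 2) := by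
        refine setIntegral_mono_on ?_ hki2.integrableOn measurableSet_ball fun u hu => ?_
        · exact integrableOn_const measure_ball_lt_top.ne
        · have hu1 : ‖w - u‖ < ρ' := by rwa [mem_ball_iff_norm, norm_sub_rev] at hu
          have hu2 : CT G 0 / 2 ≤ CT G (w - u) := hball' _ (by simpa using hu1)
          have hu3 : ‖u‖ ≤ ‖w‖ + 1 := by
            have := norm_sub_norm_le u w
            rw [norm_sub_rev] at this
            have := min_le_right ρ 1
            linarith
          have hk1 : c * (2 ^ (-N) * (1 + ‖w‖) ^ (-N)) ≤ k u := by
            refine le_trans ?_ (hlow u)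
            rw [← mul_rpow (by norm_num) hw0.le]
            refine mul_le_mul_of_nonneg_left ?_ hc.le
            refine rpow_le_rpow_of_nonpos (by positivity) ?_ (by linarith)
            nlinarith [norm_nonneg w]
          have hu4 : CT G 0 / 4 ≤ (CT G (w + u) + CT G (w - u)) / 2 := by
            have := hGCT (w + u); linarith
          calc c * 2 ^ (-N) * (CT G 0 / 4) * (1 + ‖w‖) ^ (-N)
              = c * (2 ^ (-N) * (1 + ‖w‖) ^ (-N)) * (CT G 0 / 4) := by ring
            _ ≤ _ := mul_le_mul hk1 hu4 (by positivity) (hk0 u)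
    _ ≤ _ := setIntegral_le_integral hki2 (Eventually.of_forall hnn)

end Scaling

section Final

open Filter Topology

lemma split_levy_ae {E : Type*} [NormedAddCommGroup E] [InnerProductSpace ℝ E]
    [FiniteDimensional ℝ E] [MeasurableSpace E] [BorelSpace E]
    {T : Type*} [MeasurableSpace T] (μ : Measure T) [SigmaFinite μ]
    {q : T → E → ℝ} (hq : Measurable (Function.uncurry q)) (hC : ∀ t x, |q t x| ≤ 1)
    (hgood : ∀ t, Good (q t)) {w k : T → ℝ} (hw : Measurable w) (hk : Measurable k)
    (hk0 : ∀ t, 0 ≤ k t) (hkw : ∀ᵐ t ∂μ, k t ≤ w t) (hkint : Integrable k μ)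
    (hIntg : ∀ x, Integrable (fun t => (1 - q t x) * w t) μ) {ψ : E → ℝ}
    (hψ : ∀ x, ∫ t, (1 - q t x) * w t ∂μ = ψ x) :
    ∃ g : E → ℝ, Good g ∧ (∀ x, 0 < g x) ∧
      (∃ C, ∀ x, g x ≤ C * Real.exp (-ψ x)) ∧
      Good (fun x => ∫ t, q t x * k t ∂μ) ∧
      Good (fun x => Real.exp (-ψ x) - g x * ∫ t, q t x * k t ∂μ) := by
  have hae : ∀ x, (fun t => (1 - q t x) * w t) =ᵐ[μ]
      (fun t => (1 - q t x) * max (w t) (k t)) := by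
    intro x
    filter_upwards [hkw] with t ht
    rw [max_eq_left ht]
  have h := split_levy μ hq hC hgood (w := fun t => max (w t) (k t)) (hw.max hk) hk hk0
    (fun t => le_max_right _ _) hkint (fun x => (hIntg x).congr (hae x))
  have e : ∀ x, ∫ t, (1 - q t x) * max (w t) (k t) ∂μ = ψ x := fun x => by
    rw [← hψ x]; exact (integral_congr_ae (hae x)).symm
  simp only [e] at h
  exact h

lemma int_even {E : Type*} [NormedAddCommGroup E] [InnerProductSpace ℝ E]
    [FiniteDimensional ℝ E] [MeasurableSpace E] [BorelSpace E] {F : E → ℝ}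
    (hF : Integrable F) (he : ∀ x, F (-x) = F x) (w : E) :
    ∫ x, Complex.exp (((inner ℝ w x : ℝ) : ℂ) * Complex.I) * (F x : ℂ) = (CT F w : ℂ) ∧
    Integrable (fun x => Complex.exp (((inner ℝ w x : ℝ) : ℂ) * Complex.I) * (F x : ℂ)) := by
  have hi : Integrable
      (fun x => Complex.exp (((inner ℝ w x : ℝ) : ℂ) * Complex.I) * (F x : ℂ)) := by
    refine hF.ofReal.bdd_mul (c := 1) ?_ ?_
    · exact Continuous.aestronglyMeasurable (by fun_prop)
    · exact Eventually.of_forall fun x => (Complex.norm_exp_ofReal_mul_I _).le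
  refine ⟨?_, hi⟩
  apply Complex.ext
  · have := integral_re hi
    simp only [RCLike.re_to_complex] at this
    rw [← this, Complex.ofReal_re]
    unfold CT
    congr 1; ext x
    rw [Complex.re_mul_ofReal, Complex.exp_ofReal_mul_I_re, mul_comm]
  · have := integral_im hi
    simp only [RCLike.im_to_complex] at this
    rw [← this, Complex.ofReal_im]
    have e : ∀ x, (Complex.exp (((inner ℝ w x : ℝ) : ℂ) * Complex.I) * (F x : ℂ)).im =
        sin (inner ℝ w x) * F x := fun x => by
      rw [Complex.im_mul_ofReal, Complex.exp_ofReal_mul_I_im]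
    simp only [e]
    have h2 := integral_neg_eq_self (fun x => sin (inner ℝ w x) * F x) (volume : Measure E)
    simp only [inner_neg_right, sin_neg, he, neg_mul, integral_neg] at h2
    linarith

lemma prod_CT {n : ℕ} {K : ℝ → ℝ} (hK : Integrable K) (he : ∀ x, K (-x) = K x) :
    Integrable (fun u : EuclideanSpace ℝ (Fin n) => ∏ j, K (u j)) ∧
    ∀ x : EuclideanSpace ℝ (Fin n), ∏ j, CT K (x j) = CT (fun u => ∏ j, K (u j)) x := by
  have hmp := PiLp.volume_preserving_ofLp (Fin n)
  have hemb : MeasurableEmbedding (WithLp.ofLp : EuclideanSpace ℝ (Fin n) → (Fin n → ℝ)) :=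
    (MeasurableEquiv.toLp 2 (Fin n → ℝ)).symm.measurableEmbedding
  have hi : Integrable (fun u : EuclideanSpace ℝ (Fin n) => ∏ j, K (u j)) := by
    have h1 : Integrable (fun u : Fin n → ℝ => ∏ j, K (u j)) :=
      Integrable.fintype_prod fun _ => hK
    exact (hmp.integrable_comp_emb hemb).2 h1
  refine ⟨hi, fun x => ?_⟩
  have h2 := (int_even hi (fun u => by simp [he]) x).1
  have h3 : ∀ j, (CT K (x j) : ℂ) =
      ∫ t, Complex.exp (((inner ℝ (x j) t : ℝ) : ℂ) * Complex.I) * (K t : ℂ) := fun j =>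
    (int_even hK he (x j)).1.symm
  rw [← Complex.ofReal_inj, ← h2]
  push_cast
  simp only [h3]
  rw [← integral_fintype_prod_volume_eq_prod
    (f := fun j t => Complex.exp (((inner ℝ (x j) t : ℝ) : ℂ) * Complex.I) * (K t : ℂ)),
    ← hmp.integral_comp hemb]
  congr 1; ext u
  rw [Finset.prod_mul_distrib, ← Complex.exp_sum, PiLp.inner_apply]
  push_cast
  rw [Finset.sum_mul]

lemma integrable_exp_norm {E : Type*} [NormedAddCommGroup E] [InnerProductSpace ℝ E]
    [FiniteDimensional ℝ E] [MeasurableSpace E] [BorelSpace E] [Nontrivial E] {b γ : ℝ}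
    (hb : 0 < b) (hγ : 0 < γ) : Integrable (fun x : E => Real.exp (-b * ‖x‖ ^ γ)) := by
  rw [integrable_fun_norm_addHaar volume (f := fun y => Real.exp (-b * y ^ γ))]
  have hd : 1 ≤ Module.finrank ℝ E := Module.finrank_pos
  have := integrableOn_rpow_mul_exp_neg_mul_rpow (s := ((Module.finrank ℝ E - 1 : ℕ) : ℝ))
    (lt_of_lt_of_le (by norm_num) (Nat.cast_nonneg _)) hγ hb
  simpa [rpow_natCast] using this

lemma integrable_main {n : ℕ} (hn : 0 < n) {p β : ℝ} (hp : 0 < p) (hβ : 0 < β) :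
    Integrable (fun x : EuclideanSpace ℝ (Fin n) => Real.exp (-(∑ j, |x j| ^ p) ^ β)) := by
  have : Nonempty (Fin n) := ⟨⟨0, hn⟩⟩
  have hn1 : (1:ℝ) ≤ n := by exact_mod_cast hn
  have hn0 : (0:ℝ) < n := by linarith
  refine (integrable_exp_norm (E := EuclideanSpace ℝ (Fin n)) (b := ((n : ℝ) ^ (p * β))⁻¹)
    (γ := p * β) (by positivity) (by positivity)).mono' ?_ ?_
  · exact (by fun_prop : Measurable fun x : EuclideanSpace ℝ (Fin n) =>
      Real.exp (-(∑ j, |x j| ^ p) ^ β)).aestronglyMeasurable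
  · refine Eventually.of_forall fun x => ?_
    rw [norm_eq_abs, abs_of_pos (Real.exp_pos _), Real.exp_le_exp, neg_mul, neg_le_neg_iff]
    set s := ∑ j, |x j| ^ p with hs
    have hs0 : 0 ≤ s := Finset.sum_nonneg fun j _ => by positivity
    have h1 : ∀ j, |x j| ≤ s ^ (1 / p) := by
      intro j
      have : |x j| ^ p ≤ s :=
        Finset.single_le_sum (f := fun j => |x j| ^ p) (fun j _ => by positivity)
          (Finset.mem_univ j)
      calc |x j| = (|x j| ^ p) ^ (1 / p) := by
            rw [← rpow_mul (abs_nonneg _), mul_one_div_cancel hp.ne', rpow_one]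
        _ ≤ _ := rpow_le_rpow (by positivity) this (by positivity)
    have h2 : ‖x‖ ≤ n * s ^ (1 / p) := by
      refine le_of_sq_le_sq ?_ (by positivity)
      rw [EuclideanSpace.norm_sq_eq]
      calc ∑ j, ‖x j‖ ^ 2 ≤ ∑ j : Fin n, (s ^ (1 / p)) ^ 2 := by
            refine Finset.sum_le_sum fun j _ => ?_
            rw [norm_eq_abs]
            exact pow_le_pow_left₀ (abs_nonneg _) (h1 j) 2
        _ = n * (s ^ (1 / p)) ^ 2 := by simp
        _ ≤ (n * s ^ (1 / p)) ^ 2 := by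
            rw [mul_pow]
            refine mul_le_mul_of_nonneg_right ?_ (by positivity)
            nlinarith
    have h3 : ‖x‖ ^ (p * β) ≤ (n : ℝ) ^ (p * β) * s ^ β := by
      calc ‖x‖ ^ (p * β) ≤ (n * s ^ (1 / p)) ^ (p * β) :=
            rpow_le_rpow (norm_nonneg _) h2 (by positivity)
        _ = _ := by
            rw [mul_rpow hn0.le (by positivity), ← rpow_mul hs0]
            congr 2; field_simp
    rw [inv_mul_le_iff₀ (by positivity)]
    exact h3

lemma kernel_le {C y s : ℝ} (hC : 0 < C) (hy : 0 < y) (hs : 0 ≤ s) :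
    C * (1 + y) ^ (-s) ≤ C * y ^ (-s) :=
  mul_le_mul_of_nonneg_left (rpow_le_rpow_of_nonpos hy (by linarith) (by linarith)) hC.le

lemma coord_split (n : ℕ) {p : ℝ} (hp : 0 < p) (hp2 : p < 2) :
    ∃ C : ℝ, 0 < C ∧ Integrable (fun u : ℝ => C * (1 + |u|) ^ (-(1 + p))) ∧
      ∀ j : Fin n,
      (∀ t : ℝ, 0 ≤ t → Good (fun x : EuclideanSpace ℝ (Fin n) => Real.exp (-(t * |x j| ^ p)))) ∧
      ∃ g : EuclideanSpace ℝ (Fin n) → ℝ, Good g ∧ (∀ x, 0 < g x) ∧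
        (∃ D, ∀ x, g x ≤ D * Real.exp (-|x j| ^ p)) ∧
        Good (fun x : EuclideanSpace ℝ (Fin n) =>
          CT (fun u : ℝ => C * (1 + |u|) ^ (-(1 + p))) (x j)) ∧
        Good (fun x : EuclideanSpace ℝ (Fin n) => Real.exp (-|x j| ^ p) -
          g x * CT (fun u : ℝ => C * (1 + |u|) ^ (-(1 + p))) (x j)) := by
  obtain ⟨C, hC, hCx⟩ := levy_cos (E := ℝ) hp hp2
  simp only [Module.finrank_self, Nat.cast_one, norm_eq_abs] at hCx
  have hki : Integrable (fun u : ℝ => C * (1 + |u|) ^ (-(1 + p))) := by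
    have := integrable_one_add_norm (E := ℝ) (μ := volume) (r := 1 + p) (by simp; linarith)
    exact this.const_mul C
  refine ⟨C, hC, hki, fun j => ?_⟩
  have hq : Measurable (Function.uncurry fun (u : ℝ) (x : EuclideanSpace ℝ (Fin n)) =>
      cos (inner ℝ u (x j))) := by
    have : Continuous (Function.uncurry fun (u : ℝ) (x : EuclideanSpace ℝ (Fin n)) =>
      cos (inner ℝ u (x j))) := by unfold Function.uncurry; fun_prop
    exact this.measurable
  have hqg : ∀ u : ℝ, Good (fun x : EuclideanSpace ℝ (Fin n) => cos (inner ℝ u (x j))) := by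
    intro u
    have := good_cos (EuclideanSpace.single j u)
    convert this using 3 with x
    rw [EuclideanSpace.inner_single_left]
    simp [mul_comm]
  constructor
  · intro t ht
    have := good_levy' (volume : Measure ℝ) hq (fun _ _ => abs_cos_le_one _) hqg
      (w := fun u => t * (C * |u| ^ (-(1 + p)))) (by fun_prop) (fun u => by positivity)
      (fun x => by
        refine ((hCx (x j)).1.const_mul t).congr (Eventually.of_forall fun u => ?_)
        simp only; ring)
    convert this using 4 with x
    rw [← (hCx (x j)).2, ← integral_const_mul]
    congr 1; ext u; ring
  · have h := split_levy_ae (volume : Measure ℝ) hq (fun _ _ => abs_cos_le_one _) hqg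
      (w := fun u => C * |u| ^ (-(1 + p))) (k := fun u => C * (1 + |u|) ^ (-(1 + p)))
      (by fun_prop) (by fun_prop) (fun u => by positivity)
      (by
        filter_upwards [compl_mem_ae_iff.2 (measure_singleton (μ := (volume : Measure ℝ)) 0)]
          with u hu
        exact kernel_le hC (abs_pos.2 hu) (by linarith)) hki (fun x => (hCx (x j)).1)
      (fun x => (hCx (x j)).2)
    have e : ∀ y : ℝ, CT (fun u : ℝ => C * (1 + |u|) ^ (-(1 + p))) y =
        ∫ u : ℝ, cos (inner ℝ u y) * (C * (1 + |u|) ^ (-(1 + p))) := by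
      intro y; unfold CT; congr 1; ext u; rw [real_inner_comm, mul_comm]
    simp only [e]
    exact h

/-- The reduction used for `p < 2`. -/
lemma main_aux {n : ℕ} {p : ℝ} (hp : 0 < p) (hp2 : p < 2) :
    ∃ G m k : EuclideanSpace ℝ (Fin n) → ℝ, Good G ∧ (∀ x, 0 < G x) ∧ Good m ∧
      (∃ D, ∀ x, G x ≤ D * Real.exp (-∑ j, |x j| ^ p)) ∧
      Measurable k ∧ Integrable k ∧ (∀ u, 0 ≤ k u) ∧
      (∀ x, m x = ∫ u, cos (inner ℝ u x) * k u) ∧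
      (∃ c, 0 < c ∧ ∀ u, c * (1 + ‖u‖) ^ (-((1 + p) * n)) ≤ k u) ∧
      (∀ t : ℝ, 0 ≤ t → Good (fun x : EuclideanSpace ℝ (Fin n) =>
        Real.exp (-(t * ∑ j, |x j| ^ p)))) ∧
      Good (fun x : EuclideanSpace ℝ (Fin n) => Real.exp (-∑ j, |x j| ^ p) - G x * m x) := by
  obtain ⟨C, hC, hki, H⟩ := coord_split n hp hp2
  choose H1 g hg hgpos hgD hφ hsub using H
  choose D hD using hgD
  set K : ℝ → ℝ := fun u => C * (1 + |u|) ^ (-(1 + p)) with hK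
  have hP := prod_CT (n := n) hki (fun x => by simp [hK])
  refine ⟨fun x => ∏ j, g j x, fun x => ∏ j, CT K (x j), fun u => ∏ j, K (u j),
    good_prod _ fun j _ => hg j, fun x => Finset.prod_pos fun j _ => hgpos j x,
    good_prod _ fun j _ => hφ j, ⟨∏ j, D j, fun x => ?_⟩, ?_, hP.1,
    fun u => Finset.prod_nonneg fun j _ => by simp only [hK]; positivity, fun x => ?_,
    ⟨C ^ n, by positivity, fun u => ?_⟩, fun t ht => ?_, ?_⟩
  · rw [← Finset.sum_neg_distrib, Real.exp_sum, ← Finset.prod_mul_distrib]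
    exact Finset.prod_le_prod (fun j _ => (hgpos j x).le) fun j _ => hD j x
  · simp only [hK]; fun_prop
  · refine (hP.2 x).trans ?_
    unfold CT
    congr 1; ext u; rw [real_inner_comm, mul_comm]
  · rw [rpow_neg (by positivity), rpow_mul (by positivity), rpow_natCast, ← inv_pow, ← mul_pow]
    have : (C * ((1 + ‖u‖) ^ (1 + p))⁻¹) ^ n = ∏ j : Fin n, (C * ((1 + ‖u‖) ^ (1 + p))⁻¹) := by
      simp
    rw [this]
    refine Finset.prod_le_prod (fun j _ => by positivity) fun j _ => ?_
    simp only [hK]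
    rw [← rpow_neg (by positivity)]
    refine mul_le_mul_of_nonneg_left ?_ hC.le
    refine rpow_le_rpow_of_nonpos (by positivity) ?_ (by linarith)
    have := PiLp.norm_apply_le u j
    rw [norm_eq_abs] at this
    linarith
  · have := good_prod Finset.univ fun j _ => H1 j t ht
    convert this using 2 with x
    rw [Finset.mul_sum, ← Finset.sum_neg_distrib, Real.exp_sum]
  · have := good_prod_sub Finset.univ (f := fun j x => g j x * CT K (x j))
      (g := fun j x => Real.exp (-|x j| ^ p)) (fun j _ => (hg j).mul (hφ j)) fun j _ => hsub j
    convert this using 2 with x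
    rw [← Finset.sum_neg_distrib, Real.exp_sum, Finset.prod_mul_distrib]

lemma main_lt_two {n : ℕ} (hn : 0 < n) {p β : ℝ} (hp : 0 < p) (hp2 : p < 2) (hβ : 0 < β)
    (hβ1 : β ≤ 1) : ∃ c : ℝ, 0 < c ∧ ∀ w : EuclideanSpace ℝ (Fin n),
      c * (1 + ‖w‖) ^ (-((1 + p) * n)) ≤
        CT (fun x : EuclideanSpace ℝ (Fin n) => Real.exp (-(∑ j, |x j| ^ p) ^ β)) w := by
  obtain ⟨G, m, k, hG, hGpos, hm, ⟨D, hD⟩, hk, hki, hk0, hmk, ⟨c, hc, hck⟩, ht, hsub⟩ :=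
    main_aux (n := n) hp hp2
  have hF := integrable_main hn hp hβ
  have hF1 := integrable_main hn hp one_pos
  simp only [rpow_one] at hF1
  have hs0 : ∀ x : EuclideanSpace ℝ (Fin n), 0 ≤ ∑ j, |x j| ^ p := fun x =>
    Finset.sum_nonneg fun j _ => by positivity
  have hGi : Integrable G := by
    refine (hF1.const_mul D).mono' hG.1.aestronglyMeasurable (Eventually.of_forall fun x => ?_)
    rw [norm_eq_abs, abs_of_pos (hGpos x)]; exact hD x
  rcases hβ1.eq_or_lt with rfl | hβ1
  · refine CT_lower hF hGi hG hGpos hk hki hk0 hmk ?_ hc (by positivity) hck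
    simpa only [rpow_one] using hsub
  obtain ⟨B, hB, hBs⟩ := levy_exp hβ hβ1
  have hmeas : ∀ f : ℝ → ℝ, Measurable f → Measurable (Function.uncurry
      fun (t : ℝ) (x : EuclideanSpace ℝ (Fin n)) => Real.exp (-(f t * ∑ j, |x j| ^ p))) := by
    intro f hf
    unfold Function.uncurry
    have h1 : Measurable fun z : ℝ × EuclideanSpace ℝ (Fin n) => f z.1 := hf.comp measurable_fst
    have h2 : Measurable fun z : ℝ × EuclideanSpace ℝ (Fin n) => ∑ j, |z.2 j| ^ p :=
      (by fun_prop : Measurable fun x : EuclideanSpace ℝ (Fin n) =>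
        ∑ j, |x j| ^ p).comp measurable_snd
    exact Real.measurable_exp.comp (h1.mul h2).neg
  have hle : ∀ (t : ℝ), 0 ≤ t → ∀ x : EuclideanSpace ℝ (Fin n),
      |Real.exp (-(t * ∑ j, |x j| ^ p))| ≤ 1 := by
    intro t ht x
    rw [abs_of_pos (Real.exp_pos _), Real.exp_le_one_iff, neg_nonpos]
    exact mul_nonneg ht (hs0 x)
  set κ : ℝ → ℝ := fun t => if 1 ≤ |t| then B * (1 + |t|) ^ (-(1 + β)) else 0 with hκ
  have hκm : Measurable κ :=
    Measurable.ite (measurableSet_le measurable_const (by fun_prop)) (by fun_prop) (by fun_prop)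
  have hκ0 : ∀ t, 0 ≤ κ t := fun t => by simp only [hκ]; split_ifs <;> positivity
  have hκi : Integrable κ := by
    have := (integrable_one_add_norm (E := ℝ) (μ := volume) (r := 1 + β)
      (by simp; linarith)).const_mul B
    refine this.mono' hκm.aestronglyMeasurable (Eventually.of_forall fun t => ?_)
    rw [norm_eq_abs, abs_of_nonneg (hκ0 t)]
    simp only [hκ, norm_eq_abs]
    split_ifs
    · exact le_rfl
    · positivity
  obtain ⟨g, hg, hgpos, ⟨D', hD'⟩, hφ, hgs⟩ := split_levy_ae (volume : Measure ℝ)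
    (q := fun (t : ℝ) (x : EuclideanSpace ℝ (Fin n)) => Real.exp (-(|t| * ∑ j, |x j| ^ p)))
    (hmeas (fun t => |t|) (by fun_prop)) (fun t => hle _ (abs_nonneg t))
    (fun t => ht _ (abs_nonneg t)) (w := fun t => B * |t| ^ (-(1 + β))) (k := κ) (by fun_prop)
    hκm hκ0 (Eventually.of_forall fun t => by
      simp only [hκ]
      split_ifs with h1
      · exact kernel_le hB (by linarith) (by linarith)
      · positivity) hκi (fun x => (hBs _ (hs0 x)).1) (fun x => (hBs _ (hs0 x)).2)
  -- the factor `Q`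
  set q' : ℝ → EuclideanSpace ℝ (Fin n) → ℝ :=
    fun t x => Real.exp (-(max (|t| - 1) 0 * ∑ j, |x j| ^ p)) with hq'
  have hQ : Good (fun x => ∫ t, q' t x * κ t) :=
    good_mix' (volume : Measure ℝ) (hmeas (fun t => max (|t| - 1) 0) (by fun_prop))
      (fun t => hle _ (le_max_right _ _)) (fun t => ht _ (le_max_right _ _)) hκm hκ0 hκi
  have hQpos : ∀ x, 0 < ∫ t, q' t x * κ t := by
    intro x
    have hqi : Integrable (fun t => q' t x * κ t) := by
      refine hκi.bdd_mul (c := 1) ?_ (Eventually.of_forall fun t => hle _ (le_max_right _ _) x)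
      exact ((hmeas (fun t => max (|t| - 1) 0) (by fun_prop)).comp
        (measurable_id.prodMk measurable_const)).aestronglyMeasurable
    rw [integral_pos_iff_support_of_nonneg
      (fun t => mul_nonneg (Real.exp_pos _).le (hκ0 t)) hqi]
    refine lt_of_lt_of_le (isOpen_Ioo.measure_pos volume (Set.nonempty_Ioo.2 (one_lt_two (α := ℝ))))
      (measure_mono fun t ht' => ?_)
    have h1 : 1 ≤ |t| := ht'.1.le.trans (le_abs_self t)
    have : 0 < κ t := by simp only [hκ, if_pos h1]; positivity
    exact (mul_pos (Real.exp_pos _) this).ne'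
  have hfac : ∀ x : EuclideanSpace ℝ (Fin n),
      ∫ t, Real.exp (-(|t| * ∑ j, |x j| ^ p)) * κ t =
        Real.exp (-∑ j, |x j| ^ p) * ∫ t, q' t x * κ t := by
    intro x
    rw [← integral_const_mul]
    congr 1; ext t
    by_cases h1 : 1 ≤ |t|
    · simp only [hq', max_eq_left (sub_nonneg.2 h1)]
      rw [← mul_assoc, ← Real.exp_add]
      congr 2; ring
    · simp [hκ, if_neg h1]
  simp only [hfac] at hgs
  obtain ⟨A, hA⟩ := hg.2.1
  obtain ⟨A', hA'⟩ := hQ.2.1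
  have hgQ := hg.mul hQ
  have hG' := hgQ.mul hG
  refine CT_lower (G := fun x => (g x * ∫ t, q' t x * κ t) * G x) hF (hgQ.integrable_mul hGi) hG'
    (fun x => mul_pos (mul_pos (hgpos x) (hQpos x)) (hGpos x)) hk hki hk0 hmk ?_ hc
    (by positivity) hck
  convert hgs.add (hgQ.mul hsub) using 2 with x
  ring

lemma main_two {n : ℕ} (hn : 0 < n) {α : ℝ} (hα : 0 < α) (hα1 : α ≤ 1) :
    ∃ c : ℝ, 0 < c ∧ ∀ w : EuclideanSpace ℝ (Fin n),
      c * (1 + ‖w‖) ^ (-((n : ℝ) + α)) ≤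
        CT (fun x : EuclideanSpace ℝ (Fin n) => Real.exp (-‖x‖ ^ α)) w := by
  have : Nonempty (Fin n) := ⟨⟨0, hn⟩⟩
  obtain ⟨C, hC, hCx⟩ := levy_cos (E := EuclideanSpace ℝ (Fin n)) hα (by linarith)
  simp only [finrank_euclideanSpace, Fintype.card_fin] at hCx
  have hF : Integrable (fun x : EuclideanSpace ℝ (Fin n) => Real.exp (-‖x‖ ^ α)) := by
    simpa using integrable_exp_norm (E := EuclideanSpace ℝ (Fin n)) one_pos hα
  have hki : Integrable (fun u : EuclideanSpace ℝ (Fin n) =>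
      C * (1 + ‖u‖) ^ (-((n : ℝ) + α))) := by
    have := integrable_one_add_norm (E := EuclideanSpace ℝ (Fin n)) (μ := volume)
      (r := (n : ℝ) + α) (by simp; linarith)
    exact this.const_mul C
  have hq : Measurable (Function.uncurry fun (u x : EuclideanSpace ℝ (Fin n)) =>
      cos (inner ℝ u x)) := by
    have : Continuous (Function.uncurry fun (u x : EuclideanSpace ℝ (Fin n)) =>
      cos (inner ℝ u x)) := by unfold Function.uncurry; fun_prop
    exact this.measurable
  obtain ⟨g, hg, hgpos, ⟨D, hD⟩, hφ, hgs⟩ := split_levy_ae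
    (volume : Measure (EuclideanSpace ℝ (Fin n))) hq (fun _ _ => abs_cos_le_one _) good_cos
    (w := fun u => C * ‖u‖ ^ (-((n : ℝ) + α))) (k := fun u => C * (1 + ‖u‖) ^ (-((n : ℝ) + α)))
    (by fun_prop) (by fun_prop) (fun u => by positivity)
    (by
      filter_upwards [compl_mem_ae_iff.2
        (measure_singleton (μ := (volume : Measure (EuclideanSpace ℝ (Fin n)))) 0)] with u hu
      exact kernel_le hC (norm_pos_iff.2 hu) (by positivity)) hki (fun x => (hCx x).1)
    (fun x => (hCx x).2)
  have hgi : Integrable g := by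
    refine (hF.const_mul D).mono' hg.1.aestronglyMeasurable (Eventually.of_forall fun x => ?_)
    rw [norm_eq_abs, abs_of_pos (hgpos x)]; exact hD x
  exact CT_lower (k := fun u => C * (1 + ‖u‖) ^ (-((n : ℝ) + α))) hF hgi hg hgpos (by fun_prop)
    hki (fun u => by positivity) (fun x => rfl) hgs hC (by positivity) (fun u => le_rfl)

lemma fourier_of_CT {n : ℕ} {F : EuclideanSpace ℝ (Fin n) → ℝ} (hF : Integrable F)
    (he : ∀ x, F (-x) = F x) {N : ℝ} (hN : 0 ≤ N)
    (h : ∃ c : ℝ, 0 < c ∧ ∀ w, c * (1 + ‖w‖) ^ (-N) ≤ CT F w) :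
    ∃ c : ℝ, 0 < c ∧ ∀ ω : EuclideanSpace ℝ (Fin n), ∃ r : ℝ,
      𝓕 (fun x : EuclideanSpace ℝ (Fin n) => (F x : ℂ)) ω = (r : ℂ) ∧
        c * (1 + ‖ω‖) ^ (-N) ≤ r := by
  obtain ⟨c, hc, hcw⟩ := h
  refine ⟨c * (2 * π) ^ (-N), by positivity, fun ω => ⟨CT F (-(2 * π) • ω), ?_, ?_⟩⟩
  · rw [Real.fourier_eq', ← (int_even hF he _).1]
    congr 1; ext x
    rw [smul_eq_mul, real_inner_smul_left, real_inner_comm]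
    congr 4; ring
  · refine le_trans ?_ (hcw _)
    rw [mul_assoc, ← mul_rpow (by positivity) (by positivity)]
    refine mul_le_mul_of_nonneg_left ?_ hc.le
    refine rpow_le_rpow_of_nonpos (by positivity) ?_ (by linarith)
    rw [norm_smul, norm_neg, norm_eq_abs, abs_of_pos (by positivity)]
    nlinarith [pi_gt_three, norm_nonneg ω]

end Final

theorem statement15 (p α : ℝ) (hp0 : 0 < p) (hp2 : p ≤ 2)
    (hα0 : 0 < α) (hα1 : α ≤ 1) (n : ℕ) (hn : 0 < n) :
    ∃ c : ℝ, 0 < c ∧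
      ∀ ω : EuclideanSpace ℝ (Fin n),
        ∃ r : ℝ,
          𝓕 (fun x : EuclideanSpace ℝ (Fin n) =>
              (Real.exp (-(pNorm p x ^ (α * min 1 p))) : ℂ)) ω = (r : ℂ) ∧
          c * (1 + ‖ω‖) ^ (-((1 + p) * n)) ≤ r := by
  have hmin : 0 < min 1 p := lt_min one_pos hp0
  have hβ : 0 < 1 / p * (α * min 1 p) := by positivity
  have hβ1 : 1 / p * (α * min 1 p) ≤ 1 := by
    have h1 : α * min 1 p ≤ 1 * p := mul_le_mul hα1 (min_le_right _ _) hmin.le zero_le_one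
    rw [one_div, inv_mul_le_iff₀ hp0]; linarith
  have hpn : ∀ x : EuclideanSpace ℝ (Fin n), pNorm p x ^ (α * min 1 p) =
      (∑ j, |x j| ^ p) ^ (1 / p * (α * min 1 p)) := by
    intro x
    rw [pNorm, ← rpow_mul (Finset.sum_nonneg fun j _ => by positivity)]
  simp only [hpn]
  refine fourier_of_CT (F := fun x : EuclideanSpace ℝ (Fin n) =>
    Real.exp (-(∑ j, |x j| ^ p) ^ (1 / p * (α * min 1 p)))) (integrable_main hn hp0 hβ)
    (fun x => by simp) (by positivity) ?_
  rcases hp2.eq_or_lt with rfl | hp2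
  · obtain ⟨c, hc, h⟩ := main_two hn hα0 hα1
    refine ⟨c, hc, fun w => ?_⟩
    have e : ∀ x : EuclideanSpace ℝ (Fin n),
        (∑ j, |x j| ^ (2:ℝ)) ^ (1 / 2 * (α * min 1 2)) = ‖x‖ ^ α := by
      intro x
      have : ∑ j, |x j| ^ (2:ℝ) = ‖x‖ ^ (2:ℝ) := by
        rw [rpow_two, EuclideanSpace.norm_sq_eq]
        simp
      rw [this, ← rpow_mul (norm_nonneg _)]
      congr 1; norm_num; ring
    simp only [e]
    refine le_trans ?_ (h w)
    refine mul_le_mul_of_nonneg_left ?_ hc.le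
    refine rpow_le_rpow_of_exponent_le (by linarith [norm_nonneg w]) ?_
    have : (1:ℝ) ≤ n := by exact_mod_cast hn
    linarith
  · exact main_lt_two hn hp0 hp2 hβ hβ1
end

section
/- Let 0 < p ≤ 2, 0 < α ≤ 1, and let n be a positive integer. Define F : ℝⁿ → ℝ by F(x) = exp(−‖x‖_p^{α·min{1,p}}), where ‖x‖_p = (Σ_{j=1}^n |x_j|^p)^{1/p}, and let F̂ denote its Fourier transform. Then for each fixed ω ∈ ℝⁿ, the function t ↦ F̂(tω) is monotonically decreasing (antitone) on t ∈ [0,∞). -/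
open MeasureTheory Real
open scoped FourierTransform ENNReal

namespace RayMono

open Filter Topology

/-- Binomial coefficients of an exponent in `[0,1]` alternate in sign. -/
lemma choose_rec (a : ℝ) (k : ℕ) :
    ((k : ℝ) + 1) * Ring.choose a (k + 1) = (a - k) * Ring.choose a k := by
  have h1 := Ring.descPochhammer_eq_factorial_smul_choose a (k + 1)
  have h0 := Ring.descPochhammer_eq_factorial_smul_choose a k
  rw [descPochhammer_succ_right, Polynomial.smeval_mul, h0] at h1
  simp [Polynomial.smeval_sub, Nat.factorial_succ, Polynomial.smeval_natCast] at h1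
  have hk : (k.factorial : ℝ) ≠ 0 := by positivity
  apply mul_left_cancel₀ hk
  linarith

lemma choose_sign (a : ℝ) (h0 : 0 ≤ a) (h1 : a ≤ 1) (k : ℕ) :
    0 ≤ (-1) ^ k * Ring.choose a (k + 1) := by
  induction k with
  | zero => simpa using h0
  | succ k ih =>
    have h := choose_rec a (k + 1)
    push_cast at h
    have hpos : (0 : ℝ) < (k : ℝ) + 1 + 1 := by positivity
    have : ((k : ℝ) + 1 + 1) * ((-1) ^ (k + 1) * Ring.choose a (k + 1 + 1))
        = ((k : ℝ) + 1 - a) * ((-1) ^ k * Ring.choose a (k + 1)) := by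
      rw [pow_succ]; linear_combination (-(-1) ^ k) * h
    have h2 : 0 ≤ ((k : ℝ) + 1 - a) * ((-1) ^ k * Ring.choose a (k + 1)) := by
      apply mul_nonneg _ ih
      have : (0 : ℝ) ≤ k := by positivity
      linarith
    rw [← this] at h2
    exact nonneg_of_mul_nonneg_right h2 hpos

lemma binom_hasSum (a z : ℝ) (hz0 : 0 ≤ z) (hz1 : z < 1) :
    HasSum (fun k : ℕ => ((-1) ^ k * Ring.choose a (k + 1)) * z ^ (k + 1))
      (1 - (1 - z) ^ a) := by
  have h := (Real.one_add_rpow_hasFPowerSeriesOnBall_zero (a := a)).hasSum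
    (y := -z) (by
      simp only [Metric.mem_eball, edist_zero_right, enorm_neg]
      rw [Real.enorm_of_nonneg hz0]
      exact ENNReal.ofReal_lt_one.2 hz1)
  simp only [binomialSeries_apply, zero_add, List.ofFn_const, List.prod_replicate,
    smul_eq_mul] at h
  rw [← hasSum_nat_add_iff' 1] at h
  have h2 := h.neg
  have e1 : (fun k : ℕ => ((-1) ^ k * Ring.choose a (k + 1)) * z ^ (k + 1))
      = fun k : ℕ => -(Ring.choose a (k + 1) * (-z) ^ (k + 1)) := by
    funext k; rw [neg_pow z]; ring
  have e2 : 1 - (1 - z) ^ a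
      = -((1 + -z) ^ a - ∑ i ∈ Finset.range 1, Ring.choose a i * (-z) ^ i) := by
    simp [sub_eq_add_neg]
  rw [e1, e2]
  exact h2

variable {n : ℕ}

/-- Gaussian weight. -/
noncomputable def gw (a : Fin n → ℝ) (x : Fin n → ℝ) : ℝ := Real.exp (-∑ j, a j * x j ^ 2)

lemma gw_pos (a x : Fin n → ℝ) : 0 < gw a x := Real.exp_pos _

lemma gw_meas (a : Fin n → ℝ) : Measurable (gw a) := by unfold gw; fun_prop

lemma gw_add (a b x : Fin n → ℝ) : gw (a + b) x = gw a x * gw b x := by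
  unfold gw
  rw [← Real.exp_add]
  congr 1
  simp [add_mul, Finset.sum_add_distrib]
  ring

lemma gw_le_one (a x : Fin n → ℝ) (ha : ∀ j, 0 ≤ a j) : gw a x ≤ 1 := by
  unfold gw
  rw [Real.exp_le_one_iff, neg_nonpos]
  exact Finset.sum_nonneg fun j _ => mul_nonneg (ha j) (sq_nonneg _)

lemma gw_integrable (a : Fin n → ℝ) (ha : ∀ j, 0 < a j) : Integrable (gw a) := by
  have h := (GaussianFourier.integrable_cexp_neg_sum_mul_add (b := fun j => (a j : ℂ))
    (by simpa using ha) (fun _ => 0)).re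
  refine h.congr (Eventually.of_forall fun x => ?_)
  simp only [gw]
  have : (-∑ i, (a i : ℂ) * (x i : ℂ) ^ 2 + ∑ i, (0 : ℂ) * (x i : ℂ))
    = ((-∑ i, a i * x i ^ 2 : ℝ) : ℂ) := by push_cast; simp
  rw [this, ← Complex.ofReal_exp]
  rfl

/-- bounded measurable functions -/
def BM (f : (Fin n → ℝ) → ℝ) : Prop := Measurable f ∧ ∃ C, ∀ x, |f x| ≤ C

lemma BM.mul {f g : (Fin n → ℝ) → ℝ} (hf : BM f) (hg : BM g) : BM (fun x => f x * g x) := by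
  obtain ⟨mf, C, hC⟩ := hf
  obtain ⟨mg, D, hD⟩ := hg
  refine ⟨mf.mul mg, C * D, fun x => ?_⟩
  rw [abs_mul]
  exact mul_le_mul (hC x) (hD x) (abs_nonneg _) ((abs_nonneg _).trans (hC x))

lemma BM.add {f g : (Fin n → ℝ) → ℝ} (hf : BM f) (hg : BM g) : BM (fun x => f x + g x) := by
  obtain ⟨mf, C, hC⟩ := hf
  obtain ⟨mg, D, hD⟩ := hg
  exact ⟨mf.add mg, C + D, fun x => (abs_add_le _ _).trans (add_le_add (hC x) (hD x))⟩

lemma BM.integrable {f g : (Fin n → ℝ) → ℝ} (hf : BM f) (hg : Integrable g) :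
    Integrable (fun x => f x * g x) := by
  obtain ⟨mf, C, hC⟩ := hf
  exact hg.bdd_mul mf.aestronglyMeasurable (Eventually.of_forall hC)

/-- `G` is good for the test function `w`. -/
def Good (w G : (Fin n → ℝ) → ℝ) : Prop :=
  BM G ∧ ∀ a : Fin n → ℝ, (∀ j, 0 < a j) → 0 ≤ ∫ x, (w x * G x) * gw a x

/-- Multipliers preserving goodness. -/
def Mult (w H : (Fin n → ℝ) → ℝ) : Prop :=
  BM H ∧ ∀ G, Good w G → Good w (fun x => H x * G x)

variable {w : (Fin n → ℝ) → ℝ}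

lemma mult_gw (u : Fin n → ℝ) (hu : ∀ j, 0 ≤ u j) : Mult w (gw u) := by
  have hb : BM (gw u) := ⟨gw_meas u, 1, fun x => by
    rw [abs_of_pos (gw_pos _ _)]; exact gw_le_one u x hu⟩
  refine ⟨hb, fun G hG => ⟨hb.mul hG.1, fun a ha => ?_⟩⟩
  have := hG.2 (u + a) (fun j => add_pos_of_nonneg_of_pos (hu j) (ha j))
  refine this.trans_eq (integral_congr_ae (Eventually.of_forall fun x => ?_))
  simp only [gw_add]
  ring

lemma Mult.mul {H K : (Fin n → ℝ) → ℝ} (hH : Mult w H) (hK : Mult w K) :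
    Mult w (fun x => H x * K x) := by
  refine ⟨hH.1.mul hK.1, fun G hG => ?_⟩
  have := hH.2 _ (hK.2 G hG)
  simpa only [mul_assoc] using this

lemma Mult.add (hw : BM w) {H K : (Fin n → ℝ) → ℝ} (hH : Mult w H) (hK : Mult w K) :
    Mult w (fun x => H x + K x) := by
  refine ⟨hH.1.add hK.1, fun G hG => ⟨(hH.1.add hK.1).mul hG.1, fun a ha => ?_⟩⟩
  have h1 := (hH.2 G hG).2 a ha
  have h2 := (hK.2 G hG).2 a ha
  have i1 := (hw.mul (hH.1.mul hG.1)).integrable (gw_integrable a ha)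
  have i2 := (hw.mul (hK.1.mul hG.1)).integrable (gw_integrable a ha)
  have := add_nonneg h1 h2
  rw [← integral_add i1 i2] at this
  refine this.trans_eq (integral_congr_ae (Eventually.of_forall fun x => ?_))
  simp only
  ring

lemma mult_const (c : ℝ) (hc : 0 ≤ c) : Mult w (fun _ => c) := by
  have hb : BM (n := n) (fun _ => c) := ⟨measurable_const, |c|, fun _ => le_rfl⟩
  refine ⟨hb, fun G hG => ⟨hb.mul hG.1, fun a ha => ?_⟩⟩
  have := mul_nonneg hc (hG.2 a ha)
  rw [← integral_const_mul] at this
  refine this.trans_eq (integral_congr_ae (Eventually.of_forall fun x => ?_))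
  simp only
  ring

lemma mult_lim (hw : BM w) {H : ℕ → (Fin n → ℝ) → ℝ} {L : (Fin n → ℝ) → ℝ}
    (hH : ∀ k, Mult w (H k)) (C : ℝ) (hC : ∀ k x, |H k x| ≤ C)
    (hl : ∀ x, Tendsto (fun k => H k x) atTop (𝓝 (L x))) : Mult w L := by
  have hb : BM L := ⟨measurable_of_tendsto_metrizable (fun k => (hH k).1.1)
    (tendsto_pi_nhds.2 hl), C, fun x => le_of_tendsto (hl x).abs (Eventually.of_forall
      fun k => hC k x)⟩
  refine ⟨hb, fun G hG => ⟨hb.mul hG.1, fun a ha => ?_⟩⟩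
  have i := ((hw.mul hG.1).integrable (gw_integrable a ha)).norm.const_mul C
  refine ge_of_tendsto' (tendsto_integral_of_dominated_convergence
    (F := fun k x => (w x * (H k x * G x)) * gw a x) _ (fun k => ?_) i (fun k => ?_) ?_)
    (fun k => ((hH k).2 G hG).2 a ha)
  · exact ((hw.1.mul ((hH k).1.1.mul hG.1.1)).mul (gw_meas a)).aestronglyMeasurable
  · refine Eventually.of_forall fun x => ?_
    have : w x * (H k x * G x) * gw a x = H k x * (w x * G x * gw a x) := by ring
    rw [this, norm_mul]
    exact mul_le_mul_of_nonneg_right (hC k x) (norm_nonneg _)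
  · refine Eventually.of_forall fun x => ?_
    exact (((hl x).mul_const _).const_mul _).mul_const _

lemma Mult.pow {H : (Fin n → ℝ) → ℝ} (hH : Mult w H) (k : ℕ) : Mult w (fun x => H x ^ k) := by
  induction k with
  | zero => simpa using mult_const 1 zero_le_one
  | succ k ih => simpa only [pow_succ] using ih.mul hH

lemma Mult.sum (hw : BM w) {H : ℕ → (Fin n → ℝ) → ℝ} (hH : ∀ k, Mult w (H k)) (m : ℕ) :
    Mult w (fun x => ∑ k ∈ Finset.range m, H k x) := by
  induction m with
  | zero => simpa using mult_const 0 le_rfl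
  | succ k ih => simpa only [Finset.sum_range_succ] using ih.add hw (hH k)

/-- sums of nonnegative series of multipliers -/
lemma mult_hasSum (hw : BM w) {H : ℕ → (Fin n → ℝ) → ℝ} {L : (Fin n → ℝ) → ℝ}
    (hH : ∀ k, Mult w (H k)) (h0 : ∀ k x, 0 ≤ H k x) (C : ℝ) (hC : ∀ x, L x ≤ C)
    (hl : ∀ x, HasSum (fun k => H k x) (L x)) : Mult w L := by
  refine mult_lim hw (fun m => Mult.sum hw hH m) C (fun m x => ?_)
    (fun x => (hl x).tendsto_sum_nat)
  rw [abs_of_nonneg (Finset.sum_nonneg fun k _ => h0 k x)]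
  exact (sum_le_hasSum _ (fun k _ => h0 k x) (hl x)).trans (hC x)

lemma Mult.exp (hw : BM w) {H : (Fin n → ℝ) → ℝ} (hH : Mult w H) (h0 : ∀ x, 0 ≤ H x) :
    Mult w (fun x => Real.exp (H x)) := by
  obtain ⟨C, hC⟩ := hH.1.2
  refine mult_hasSum hw (H := fun k x => (k.factorial : ℝ)⁻¹ * H x ^ k)
    (fun k => (mult_const _ (by positivity)).mul (hH.pow k))
    (fun k x => mul_nonneg (by positivity) (pow_nonneg (h0 x) k)) (Real.exp C)
    (fun x => Real.exp_le_exp.2 ((le_abs_self _).trans (hC x))) (fun x => ?_)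
  have := NormedSpace.exp_series_hasSum_exp' (𝕂 := ℝ) (H x)
  rw [← Real.exp_eq_exp_ℝ] at this
  simpa using this

/-- `exp (-c (1-z)^γ)` is a multiplier when `z` is. -/
lemma Mult.one_sub_rpow (hw : BM w) {z : (Fin n → ℝ) → ℝ} (hz : Mult w z)
    (h0 : ∀ x, 0 ≤ z x) (h1 : ∀ x, z x < 1) (g : ℝ) (hg0 : 0 ≤ g) (hg1 : g ≤ 1)
    (c : ℝ) (hc : 0 ≤ c) : Mult w (fun x => Real.exp (-(c * (1 - z x) ^ g))) := by
  have hS : Mult w (fun x => 1 - (1 - z x) ^ g) := by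
    refine mult_hasSum hw
      (H := fun k x => ((-1) ^ k * Ring.choose g (k + 1)) * z x ^ (k + 1))
      (fun k => (mult_const _ (choose_sign g hg0 hg1 k)).mul (hz.pow (k + 1)))
      (fun k x => mul_nonneg (choose_sign g hg0 hg1 k) (pow_nonneg (h0 x) _)) 1
      (fun x => ?_) (fun x => binom_hasSum g _ (h0 x) (h1 x))
    have := Real.rpow_nonneg (sub_nonneg.2 (h1 x).le) g
    linarith
  have hE := (((mult_const c hc).mul hS).exp hw (fun x => ?_))
  · have := (mult_const (w := w) (Real.exp (-c)) (Real.exp_pos _).le).mul hE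
    convert this using 2 with x
    rw [← Real.exp_add]
    congr 1; ring
  · refine mul_nonneg hc (sub_nonneg.2 (Real.rpow_le_one ?_ ?_ hg0))
    · linarith [h1 x]
    · linarith [h0 x]

/-- negative-definite-type exponents -/
def Neg (w ψ : (Fin n → ℝ) → ℝ) : Prop :=
  (∀ x, 0 ≤ ψ x) ∧ ∀ c, 0 ≤ c → Mult w (fun x => Real.exp (-(c * ψ x)))

lemma Neg.add {ψ φ : (Fin n → ℝ) → ℝ} (h1 : Neg w ψ) (h2 : Neg w φ) :
    Neg w (fun x => ψ x + φ x) := by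
  refine ⟨fun x => add_nonneg (h1.1 x) (h2.1 x), fun c hc => ?_⟩
  have := (h1.2 c hc).mul (h2.2 c hc)
  convert this using 2 with x
  rw [← Real.exp_add]; congr 1; ring

lemma Neg.sum {ι : Type*} (s : Finset ι) {ψ : ι → (Fin n → ℝ) → ℝ} (h : ∀ i, Neg w (ψ i)) :
    Neg w (fun x => ∑ i ∈ s, ψ i x) := by
  classical
  induction s using Finset.induction_on with
  | empty => exact ⟨fun x => by simp, fun c hc => by simpa using mult_const 1 zero_le_one⟩
  | insert a s ha ih =>
    simp only [Finset.sum_insert ha]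
    exact (h a).add ih

lemma neg_sq (j : Fin n) : Neg w (fun x => x j ^ 2) := by
  refine ⟨fun x => sq_nonneg _, fun c hc => ?_⟩
  have := mult_gw (w := w) (fun i => if i = j then c else 0)
    (fun i => by split_ifs <;> simp [hc])
  convert this using 2 with x
  simp [gw]

lemma aux_lim (s g : ℝ) (hs : 0 ≤ s) (hg : 0 < g) :
    Tendsto (fun k : ℕ => ((1 - Real.exp (-((1 / ((k : ℝ) + 1)) * (s + 1 / ((k : ℝ) + 1)))))
      / (1 / ((k : ℝ) + 1))) ^ g) atTop (𝓝 (s ^ g)) := by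
  have hu : Tendsto (fun k : ℕ => 1 / ((k : ℝ) + 1)) atTop (𝓝 0) :=
    tendsto_one_div_add_atTop_nhds_zero_nat
  have hupos : ∀ k : ℕ, 0 < 1 / ((k : ℝ) + 1) := fun k => by positivity
  refine Tendsto.rpow_const ?_ (Or.inr hg.le)
  have hd : HasDerivAt (fun u : ℝ => 1 - Real.exp (-(u * (s + u)))) s 0 := by
    have h1 : HasDerivAt (fun u : ℝ => -(u * (s + u))) (-(1 * (s + 0) + 0 * 1)) 0 :=
      ((hasDerivAt_id (0 : ℝ)).mul ((hasDerivAt_id (0 : ℝ)).const_add s)).neg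
    have h2 := (h1.exp).const_sub 1
    have e : -(Real.exp (-(0 * (s + 0))) * -(1 * (s + 0) + 0 * 1)) = s := by simp
    rw [e] at h2
    exact h2
  have ht := hd.tendsto_slope_zero
  have hu' : Tendsto (fun k : ℕ => 1 / ((k : ℝ) + 1)) atTop (𝓝[≠] 0) :=
    tendsto_nhdsWithin_iff.2 ⟨hu, Eventually.of_forall fun k => (hupos k).ne'⟩
  refine (ht.comp hu').congr fun k => ?_
  simp [div_eq_inv_mul]

lemma Neg.rpow (hw : BM w) {ψ : (Fin n → ℝ) → ℝ} (h : Neg w ψ) (g : ℝ) (hg0 : 0 < g)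
    (hg1 : g ≤ 1) : Neg w (fun x => ψ x ^ g) := by
  refine ⟨fun x => Real.rpow_nonneg (h.1 x) g, fun c hc => ?_⟩
  set u : ℕ → ℝ := fun k => 1 / ((k : ℝ) + 1) with hu
  have hupos : ∀ k, 0 < u k := fun k => by simp only [hu]; positivity
  have hpos : ∀ k x, 0 < u k * (ψ x + u k) := fun k x =>
    mul_pos (hupos k) (add_pos_of_nonneg_of_pos (h.1 x) (hupos k))
  have hlt : ∀ k x, Real.exp (-(u k * (ψ x + u k))) < 1 := fun k x => by
    rw [Real.exp_lt_one_iff]; linarith [hpos k x]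
  have hz : ∀ k, Mult w (fun x => Real.exp (-(u k * (ψ x + u k)))) := fun k => by
    have := (mult_const (w := w) (Real.exp (-(u k * u k))) (Real.exp_pos _).le).mul
      (h.2 (u k) (hupos k).le)
    convert this using 2 with x
    rw [← Real.exp_add]; congr 1; ring
  have hM : ∀ k, Mult w (fun x => Real.exp (-(c *
      ((1 - Real.exp (-(u k * (ψ x + u k)))) / u k) ^ g))) := fun k => by
    have := (hz k).one_sub_rpow hw (fun x => (Real.exp_pos _).le) (hlt k) g hg0.le hg1
      (c * (1 / u k) ^ g) (mul_nonneg hc (Real.rpow_nonneg (by have := hupos k; positivity) _))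
    convert this using 2 with x
    rw [mul_assoc, ← Real.mul_rpow (by have := hupos k; positivity)
      (sub_nonneg.2 (hlt k x).le)]
    congr 3
    ring_nf
  refine mult_lim hw hM 1 (fun k x => ?_) (fun x => ?_)
  · rw [abs_of_pos (Real.exp_pos _), Real.exp_le_one_iff, neg_nonpos]
    exact mul_nonneg hc (Real.rpow_nonneg (div_nonneg (sub_nonneg.2 (hlt k x).le)
      (hupos k).le) _)
  · exact (Real.continuous_exp.tendsto _).comp (((aux_lim (ψ x) g (h.1 x) hg0).const_mul c).neg)

/-- the phase -/
noncomputable def ph (ω x : Fin n → ℝ) : ℝ := ∑ j, x j * ω j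

lemma ph_meas (ω : Fin n → ℝ) : Measurable (ph ω) := by unfold ph; fun_prop

lemma gauss_cos (a : Fin n → ℝ) (ha : ∀ j, 0 < a j) (ω : Fin n → ℝ) (t : ℝ) :
    ∫ x, Real.cos (2 * π * t * ph ω x) * gw a x
      = ∏ j, (π / a j) ^ (1 / 2 : ℝ) * Real.exp (-((2 * π * t * ω j) ^ 2 / (4 * a j))) := by
  have hb : ∀ j, 0 < ((a j : ℂ)).re := by simpa using ha
  set c : Fin n → ℂ := fun j => ((2 * π * t * ω j : ℝ) : ℂ) * Complex.I with hc
  have hI := GaussianFourier.integrable_cexp_neg_sum_mul_add hb c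
  have hE := GaussianFourier.integral_cexp_neg_sum_mul_add hb c
  have h1 := integral_re hI
  rw [hE] at h1
  have h2 : ∀ x : Fin n → ℝ, RCLike.re (Complex.exp (-∑ i, (a i : ℂ) * (x i : ℂ) ^ 2
      + ∑ i, c i * x i)) = Real.cos (2 * π * t * ph ω x) * gw a x := by
    intro x
    have e : (-∑ i, (a i : ℂ) * (x i : ℂ) ^ 2 + ∑ i, c i * x i)
        = ((-∑ i, a i * x i ^ 2 : ℝ) : ℂ) + ((2 * π * t * ph ω x : ℝ) : ℂ) * Complex.I := by
      simp only [hc, ph, Finset.mul_sum]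
      push_cast
      rw [Finset.sum_mul]
      congr 1
      refine Finset.sum_congr rfl fun i _ => ?_
      ring
    rw [e]
    change (Complex.exp _).re = _
    rw [Complex.exp_re]
    simp only [Complex.add_re, Complex.ofReal_re, Complex.re_ofReal_mul, Complex.I_re, mul_zero,
      add_zero, Complex.add_im, Complex.ofReal_im, Complex.im_ofReal_mul, Complex.I_im, mul_one,
      zero_add, gw]
    ring
  simp_rw [h2] at h1
  rw [h1]
  have h3 : ∀ j, ((π : ℂ) / (a j : ℂ)) ^ (1 / 2 : ℂ) * Complex.exp (c j ^ 2 / (4 * (a j : ℂ)))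
      = (((π / a j) ^ (1 / 2 : ℝ) * Real.exp (-((2 * π * t * ω j) ^ 2 / (4 * a j))) : ℝ) : ℂ) := by
    intro j
    have hpos : 0 ≤ π / a j := div_nonneg Real.pi_pos.le (ha j).le
    rw [Complex.ofReal_mul, Complex.ofReal_cpow hpos, Complex.ofReal_exp]
    congr 2
    · push_cast; rfl
    · push_cast; rfl
    · simp only [hc, mul_pow, Complex.I_sq]
      push_cast
      ring
  simp_rw [h3]
  rw [← Complex.ofReal_prod]
  rfl

/-- the test function -/
noncomputable def wt (ω : Fin n → ℝ) (s t : ℝ) (x : Fin n → ℝ) : ℝ :=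
  Real.cos (2 * π * s * ph ω x) - Real.cos (2 * π * t * ph ω x)

lemma cos_bm (ω : Fin n → ℝ) (t : ℝ) : BM (fun x => Real.cos (2 * π * t * ph ω x)) :=
  ⟨by have := ph_meas ω; fun_prop, 1, fun _ => Real.abs_cos_le_one _⟩

lemma wt_bm (ω : Fin n → ℝ) (s t : ℝ) : BM (wt ω s t) := by
  obtain ⟨m1, C, h1⟩ := cos_bm ω s
  obtain ⟨m2, D, h2⟩ := cos_bm ω t
  exact ⟨m1.sub m2, C + D, fun x => (abs_sub _ _).trans (add_le_add (h1 x) (h2 x))⟩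

lemma good_one (ω : Fin n → ℝ) (s t : ℝ) (hs : 0 ≤ s) (hst : s ≤ t) :
    Good (wt ω s t) (fun _ => 1) := by
  refine ⟨⟨measurable_const, 1, fun _ => by simp⟩, fun a ha => ?_⟩
  have e : ∀ x, wt ω s t x * 1 * gw a x
      = Real.cos (2 * π * s * ph ω x) * gw a x - Real.cos (2 * π * t * ph ω x) * gw a x := by
    intro x; simp only [wt]; ring
  simp_rw [e]
  rw [integral_sub ((cos_bm ω s).integrable (gw_integrable a ha))
    ((cos_bm ω t).integrable (gw_integrable a ha)), gauss_cos a ha, gauss_cos a ha, sub_nonneg]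
  refine Finset.prod_le_prod (fun j _ => ?_) (fun j _ => ?_)
  · exact mul_nonneg (Real.rpow_nonneg (div_nonneg Real.pi_pos.le (ha j).le) _) (Real.exp_pos _).le
  · refine mul_le_mul_of_nonneg_left (Real.exp_le_exp.2 (neg_le_neg ?_))
      (Real.rpow_nonneg (div_nonneg Real.pi_pos.le (ha j).le) _)
    refine div_le_div_of_nonneg_right ?_ (by have := ha j; positivity)
    have : s ^ 2 ≤ t ^ 2 := pow_le_pow_left₀ hs hst 2
    have h4 := mul_le_mul_of_nonneg_left this (sq_nonneg (2 * π * ω j))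
    nlinarith

lemma mult_integral_nonneg {H : (Fin n → ℝ) → ℝ} (hw : BM w) (h1 : Good w (fun _ => 1))
    (hH : Mult w H) (hi : Integrable H) : 0 ≤ ∫ x, w x * H x := by
  have hg := hH.2 _ h1
  have hu : Tendsto (fun k : ℕ => 1 / ((k : ℝ) + 1)) atTop (𝓝 0) :=
    tendsto_one_div_add_atTop_nhds_zero_nat
  have hupos : ∀ k : ℕ, 0 < 1 / ((k : ℝ) + 1) := fun k => by positivity
  have hwi := hw.integrable hi
  refine ge_of_tendsto' (tendsto_integral_of_dominated_convergence
    (F := fun (k : ℕ) x => (w x * (H x * 1)) * gw (fun _ => 1 / ((k : ℝ) + 1)) x) _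
      (fun k => ?_) hwi.norm (fun k => ?_) ?_)
    (fun k => hg.2 _ (fun _ => hupos k))
  · exact ((hw.1.mul (hH.1.1.mul measurable_const)).mul (gw_meas _)).aestronglyMeasurable
  · refine Eventually.of_forall fun x => ?_
    rw [norm_mul, mul_one]
    refine mul_le_of_le_one_right (norm_nonneg _) ?_
    rw [Real.norm_of_nonneg (gw_pos _ _).le]
    exact gw_le_one _ _ (fun _ => (hupos k).le)
  · refine Eventually.of_forall fun x => ?_
    have : Tendsto (fun k : ℕ => gw (fun _ => 1 / ((k : ℝ) + 1)) x) atTop (𝓝 1) := by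
      have h0 : Tendsto (fun k : ℕ => -∑ j, (1 / ((k : ℝ) + 1)) * x j ^ 2) atTop
          (𝓝 (-∑ j, 0 * x j ^ 2)) :=
        (tendsto_finsetSum _ fun j _ => hu.mul_const _).neg
      have := (Real.continuous_exp.tendsto _).comp h0
      simpa [gw, Function.comp_def] using this
    simpa using this.const_mul (w x * (H x * 1))

lemma mult_F (hw : BM w) (p α : ℝ) (hp0 : 0 < p) (hp2 : p ≤ 2) (hα0 : 0 < α) (hα1 : α ≤ 1) :
    Mult w (fun x => Real.exp (-(((∑ j, |x j| ^ p) ^ (1 / p)) ^ (α * min 1 p)))) := by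
  have hN : Neg w (fun x => ∑ j, |x j| ^ p) := by
    refine Neg.sum _ fun j => ?_
    have := (neg_sq (w := w) j).rpow hw (p / 2) (by linarith) (by linarith)
    convert this using 2 with x
    rw [← sq_abs, ← Real.rpow_natCast, ← Real.rpow_mul (abs_nonneg _)]
    congr 1
    push_cast
    ring
  have hm : 0 < min 1 p := lt_min one_pos hp0
  have hR := hN.rpow hw (1 / p * (α * min 1 p)) (by positivity) (by
    rw [one_div, inv_mul_le_iff₀ hp0, mul_one]
    calc α * min 1 p ≤ 1 * min 1 p := mul_le_mul_of_nonneg_right hα1 hm.le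
      _ ≤ p := by rw [one_mul]; exact min_le_right _ _)
  have := hR.2 1 zero_le_one
  convert this using 2 with x
  simp only [one_mul]
  rw [Real.rpow_mul (hN.1 x)]

lemma fourier_re (f : EuclideanSpace ℝ (Fin n) → ℝ) (hf : Integrable f)
    (ω : EuclideanSpace ℝ (Fin n)) (t : ℝ) :
    (𝓕 (fun x => (f x : ℂ)) (t • ω)).re
      = ∫ x : Fin n → ℝ, Real.cos (2 * π * t * ph (fun j => ω j) x) * f (WithLp.toLp 2 x) := by
  have hI : Integrable (fun v : EuclideanSpace ℝ (Fin n) =>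
      Complex.exp ((↑(-2 * π * inner ℝ v (t • ω)) * Complex.I)) • (f v : ℂ)) := by
    refine (hf.ofReal (𝕜 := ℂ)).bdd_mul (c := 1) ?_ ?_
    · exact Continuous.aestronglyMeasurable (by fun_prop)
    · exact Eventually.of_forall fun v => (Complex.norm_exp_ofReal_mul_I _).le
  rw [Real.fourier_eq']
  have h1 := integral_re hI
  refine h1.symm.trans ?_
  rw [← (PiLp.volume_preserving_toLp (Fin n)).integral_comp
    (MeasurableEquiv.toLp 2 _).measurableEmbedding]
  refine integral_congr_ae (Eventually.of_forall fun x => ?_)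
  change (Complex.exp _ * _ : ℂ).re = _
  rw [Complex.re_mul_ofReal, Complex.exp_ofReal_mul_I_re]
  congr 1
  rw [← Real.cos_neg]
  congr 1
  rw [inner_smul_right, PiLp.inner_apply]
  simp only [ph, RCLike.inner_apply, conj_trivial, Finset.mul_sum, ← Finset.sum_neg_distrib]
  refine Finset.sum_congr rfl fun j _ => ?_
  ring

end RayMono

open RayMono

theorem statement16 (p α : ℝ) (hp0 : 0 < p) (hp2 : p ≤ 2)
    (hα0 : 0 < α) (hα1 : α ≤ 1) (n : ℕ) (hn : 0 < n)
    (ω : EuclideanSpace ℝ (Fin n)) :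
    AntitoneOn
      (fun t : ℝ =>
        (𝓕 (fun x : EuclideanSpace ℝ (Fin n) =>
            (Real.exp (-(pNorm p x ^ (α * min 1 p))) : ℂ)) (t • ω)).re)
      (Set.Ici 0) := by
  intro s hs t ht hst
  by_cases hf : Integrable (fun x : EuclideanSpace ℝ (Fin n) =>
      Real.exp (-(pNorm p x ^ (α * min 1 p))))
  · have hw := wt_bm (fun j => ω j) s t
    have hM := mult_F hw p α hp0 hp2 hα0 hα1
    have hi : Integrable (fun x : Fin n → ℝ =>
        Real.exp (-(((∑ j, |x j| ^ p) ^ (1 / p)) ^ (α * min 1 p)))) :=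
      (PiLp.volume_preserving_toLp (Fin n)).integrable_comp_of_integrable hf
    have h := mult_integral_nonneg hw (good_one _ s t hs hst) hM hi
    have key := fun r => fourier_re _ hf ω r
    have e1 := key s
    have e2 := key t
    simp only at e1 e2 ⊢
    rw [e1, e2, ← sub_nonneg]
    refine h.trans_eq ?_
    have i1 := (cos_bm (fun j => ω j) s).integrable hi
    have i2 := (cos_bm (fun j => ω j) t).integrable hi
    refine Eq.trans ?_ (integral_sub i1 i2)
    refine integral_congr_ae (Filter.Eventually.of_forall fun x => ?_)
    simp only [wt, pNorm]
    ring
  · have hz : ∀ v, 𝓕 (fun x : EuclideanSpace ℝ (Fin n) =>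
            (Real.exp (-(pNorm p x ^ (α * min 1 p))) : ℂ)) v = 0 := by
      intro v
      rw [Real.fourier_eq]
      apply integral_undef
      intro h
      rw [Real.fourierIntegral_convergent_iff v] at h
      exact hf h.re
    simp only [hz]
    exact le_rfl
end
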